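/- arXiv:0802.1800 — 3 statements merged into one kernel-verified Lean document; each statement's English description precedes it below -/
import Mathlib

section
/- Let (R, m) be a complete noetherian local ring, and let a, b ⊆ R be ideals such that min{ dim R/a, dim R/b } > dim R/(a + b). Then cd(R, a ∩ b) ≥ min{ c(R), sdim R − 1 } − dim R/(a + b). -/
/-!
Auxiliary definitions: integer-valued topological (Krull) dimension, connectivity
dimension, subdimension, local cohomological dimension and depth.
-/

open TopologicalSpace

/-- The (topological Krull) dimension of a topological space, as an integer:
the supremum of the lengths of strictly increasing chains of irreducible closed subsets,
with the convention that the empty space has dimension `-1`. -/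
noncomputable def topDim (T : Type*) [TopologicalSpace T] : ℤ :=
  sSup ({-1} ∪ {d : ℤ | ∃ n : ℕ, d = (n : ℤ) ∧
    ∃ c : Fin (n + 1) → IrreducibleCloseds T, StrictMono c})

/-- The connectivity dimension `c(T)` of a topological space `T`: the minimum of `topDim Z`
over the closed subsets `Z ⊆ T` such that `T \ Z` is disconnected, the empty space counting
as disconnected (of dimension `-1`). -/
noncomputable def connDim (T : Type*) [TopologicalSpace T] : ℤ :=
  sInf {d : ℤ | ∃ Z : Set T, IsClosed Z ∧ ¬ ConnectedSpace ↥(Zᶜ) ∧ d = topDim ↥Z}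

/-- The subdimension `sdim T` of a topological space: the minimum of the dimensions of its
irreducible components. -/
noncomputable def subDim (T : Type*) [TopologicalSpace T] : ℤ :=
  sInf {d : ℤ | ∃ C ∈ irreducibleComponents T, d = topDim ↥C}

/-- The connectivity dimension `c(R)` of a commutative ring `R`, i.e. that of `Spec R`. -/
noncomputable def ringConnDim (R : Type) [CommRing R] : ℤ :=
  connDim (PrimeSpectrum R)

/-- The cohomological dimension `cd(M, a) = sup { i ∈ ℕ | H^i_a(M) ≠ 0 }` of an ideal `a`
with respect to a module `M`, where `H^i_a` is local cohomology with support in `a`. -/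
noncomputable def cohDim (R : Type) [CommRing R] (a : Ideal R)
    (M : Type) [AddCommGroup M] [Module R M] : ℤ :=
  sSup {d : ℤ | ∃ i : ℕ, d = (i : ℤ) ∧
    Nontrivial ((localCohomology a i).obj (ModuleCat.of R M))}

/-- `depth(a, M)`: the supremum of the lengths of `M`-regular sequences contained in the
ideal `a`. -/
noncomputable def idealDepth (R : Type) [CommRing R] (a : Ideal R)
    (M : Type) [AddCommGroup M] [Module R M] : ℤ :=
  sSup {d : ℤ | ∃ rs : List R, d = (rs.length : ℤ) ∧ (∀ r ∈ rs, r ∈ a) ∧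
    RingTheory.Sequence.IsRegular M rs}

open TopologicalSpace

section LC
open CategoryTheory CategoryTheory.Abelian

variable {R : Type} [CommRing R]

/-- The quotient `R / a^n`. -/
noncomputable abbrev lcQ (a : Ideal R) (n : ℕ) : ModuleCat.{0} R := ModuleCat.of R (R ⧸ a ^ n)

/-- The transition maps. -/
noncomputable def lcTr (a : Ideal R) {m n : ℕ} (h : m ≤ n) : lcQ a n ⟶ lcQ a m :=
  ModuleCat.ofHom (Submodule.mapQ _ _ LinearMap.id (Ideal.pow_le_pow_right h))

lemma lcTr_comp (a : Ideal R) {l m n : ℕ} (h : l ≤ m) (h' : m ≤ n) :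
    lcTr a h' ≫ lcTr a h = lcTr a (h.trans h') := by
  ext
  rfl

lemma lcTr_self (a : Ideal R) (n : ℕ) : lcTr a (le_refl n) = 𝟙 _ := by
  ext
  rfl

variable (a : Ideal R) (i : ℕ) (M : Type) [AddCommGroup M] [Module R M]

/-- Ext modules. -/
abbrev lcE (n : ℕ) : Type := Ext (lcQ a n) (ModuleCat.of R M) i

/-- Transition maps on Ext. -/
noncomputable def lcF (m n : ℕ) (h : m ≤ n) : lcE a i M m →ₗ[R] lcE a i M n :=
  (Ext.mk₀ (lcTr a h)).precompOfLinear R (ModuleCat.of R M) (zero_add i)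

lemma lcF_apply {m n : ℕ} (h : m ≤ n) (x : lcE a i M m) :
    lcF a i M m n h x = (Ext.mk₀ (lcTr a h)).comp x (zero_add i) := rfl

instance lcF_dir : DirectedSystem (lcE a i M) (fun m n h => lcF a i M m n h) where
  map_self j x := by rw [lcF_apply, lcTr_self, Ext.mk₀_id_comp]
  map_map l m n h h' x := by
    rw [lcF_apply, lcF_apply, lcF_apply, ← Ext.comp_assoc (h₁₂ := add_zero 0) (h := by omega), Ext.mk₀_comp_mk₀, lcTr_comp]

/-- Local cohomology. -/
def LH : Type := Module.DirectLimit (lcE a i M) (lcF a i M)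

noncomputable instance : AddCommGroup (LH a i M) :=
  inferInstanceAs (AddCommGroup (Module.DirectLimit (lcE a i M) (lcF a i M)))
noncomputable instance : Module R (LH a i M) :=
  inferInstanceAs (Module R (Module.DirectLimit (lcE a i M) (lcF a i M)))

/-- Structure map. -/
noncomputable def LHof (n : ℕ) : lcE a i M n →ₗ[R] LH a i M :=
  Module.DirectLimit.of R ℕ (lcE a i M) (lcF a i M) n

lemma LHof_surj (x : LH a i M) : ∃ n y, LHof a i M n y = x :=
  Module.DirectLimit.exists_of x

lemma LHof_f {m n : ℕ} (h : m ≤ n) (x : lcE a i M m) :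
    LHof a i M n (lcF a i M m n h x) = LHof a i M m x := Module.DirectLimit.of_f

lemma LHof_zero {n : ℕ} {x : lcE a i M n} (h : LHof a i M n x = 0) :
    ∃ m, ∃ h : n ≤ m, lcF a i M n m h x = 0 := Module.DirectLimit.of.zero_exact h

variable {M} {N P : Type} [AddCommGroup N] [Module R N] [AddCommGroup P] [Module R P]

lemma lc_smul_one (r : R) (n : ℕ) :
    r • 𝟙 (lcQ a n) = ModuleCat.ofHom (r • LinearMap.id) := rfl

lemma lcF_post {j : ℕ} {k : ℕ} (α : Ext (ModuleCat.of R M) (ModuleCat.of R N) j) (h : i + j = k)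
    {m n : ℕ} (hmn : m ≤ n) (x : lcE a i M m) :
    α.postcompOfLinear R (lcQ a n) h (lcF a i M m n hmn x) =
      lcF a k N m n hmn (α.postcompOfLinear R (lcQ a m) h x) := by
  simp only [lcF_apply, Ext.postcompOfLinear, LinearMap.flip_apply, Ext.bilinearCompOfLinear_apply_apply]
  rw [Ext.comp_assoc]; omega

/-- Post-composition. -/
noncomputable def LHpost {j : ℕ} {k : ℕ} (α : Ext (ModuleCat.of R M) (ModuleCat.of R N) j)
    (h : i + j = k) : LH a i M →ₗ[R] LH a k N :=
  Module.DirectLimit.map (fun n => α.postcompOfLinear R (lcQ a n) h)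
    (fun m n hmn => by ext x; exact lcF_post a i α h hmn x)

lemma LHpost_of {j : ℕ} {k : ℕ} (α : Ext (ModuleCat.of R M) (ModuleCat.of R N) j)
    (h : i + j = k) (n : ℕ) (x : lcE a i M n) :
    LHpost a i α h (LHof a i M n x) = LHof a k N n (α.postcompOfLinear R (lcQ a n) h x) :=
  Module.DirectLimit.map_apply_of _ _ _

/-- Functoriality. -/
noncomputable def LHmap (f : M →ₗ[R] N) : LH a i M →ₗ[R] LH a i N :=
  LHpost a i (Ext.mk₀ (ModuleCat.ofHom f)) (add_zero i)

lemma LHmap_of (f : M →ₗ[R] N) (n : ℕ) (x : lcE a i M n) :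
    LHmap a i f (LHof a i M n x) =
      LHof a i N n (x.comp (Ext.mk₀ (ModuleCat.ofHom f)) (add_zero i)) := LHpost_of _ _ _ _ _ _

lemma LHmap_id (x : LH a i M) : LHmap a i LinearMap.id x = x := by
  obtain ⟨n, x, rfl⟩ := LHof_surj a i M x
  rw [LHmap_of]; congr 1; exact Ext.comp_mk₀_id _

lemma LHmap_comp (f : M →ₗ[R] N) (g : N →ₗ[R] P) (x : LH a i M) :
    LHmap a i g (LHmap a i f x) = LHmap a i (g ∘ₗ f) x := by
  obtain ⟨n, x, rfl⟩ := LHof_surj a i M x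
  rw [LHmap_of, LHmap_of, LHmap_of]; congr 1
  rw [Ext.comp_assoc (h₂₃ := add_zero 0) (h := by omega), Ext.mk₀_comp_mk₀]; rfl

lemma LHmap_zero (x : LH a i M) : LHmap a i (0 : M →ₗ[R] N) x = 0 := by
  obtain ⟨n, x, rfl⟩ := LHof_surj a i M x
  rw [LHmap_of, show ModuleCat.ofHom (0 : M →ₗ[R] N) = 0 from rfl]; simp

lemma LHmap_smul (r : R) (x : LH a i M) : LHmap a i (r • LinearMap.id : M →ₗ[R] M) x = r • x := by
  obtain ⟨n, x, rfl⟩ := LHof_surj a i M x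
  rw [LHmap_of, show ModuleCat.ofHom (r • LinearMap.id : M →ₗ[R] M) = r • 𝟙 _ from rfl,
    Ext.mk₀_smul, Ext.comp_smul, map_smul, Ext.comp_mk₀_id]

lemma LH_torsion (x : LH a i M) : ∃ n, ∀ r ∈ a ^ n, r • x = 0 := by
  obtain ⟨n, x, rfl⟩ := LHof_surj a i M x
  refine ⟨n, fun r hr => ?_⟩
  rw [← map_smul]
  suffices r • x = 0 by rw [this, map_zero]
  have h0 : r • 𝟙 (lcQ a n) = 0 := by
    ext
    exact (Submodule.Quotient.mk_eq_zero _).2 (Ideal.mul_mem_right _ _ hr)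
  have := Ext.mk₀_id_comp x
  rw [← this, ← Ext.smul_comp, ← Ext.mk₀_smul, h0]; simp

lemma LHmap_inj_of_equiv (e : M ≃ₗ[R] N) : Function.Bijective (LHmap a i (e : M →ₗ[R] N)) := by
  refine Function.bijective_iff_has_inverse.2 ⟨LHmap a i (e.symm : N →ₗ[R] M), fun x => ?_, fun x => ?_⟩
  · rw [LHmap_comp]; convert LHmap_id a i x; ext; simp
  · rw [LHmap_comp]; convert LHmap_id a i x; ext; simp

/-- Short exact sequences. -/
structure SES (f : M →ₗ[R] N) (g : N →ₗ[R] P) : Prop where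
  inj : Function.Injective f
  surj : Function.Surjective g
  ex : Function.Exact f g

namespace SES
variable {f : M →ₗ[R] N} {g : N →ₗ[R] P}

lemma comp_zero (S : SES f g) : g ∘ₗ f = 0 := S.ex.linearMap_comp_eq_zero

/-- The associated short complex. -/
noncomputable abbrev sc (S : SES f g) : ShortComplex (ModuleCat.{0} R) :=
  ShortComplex.mk (ModuleCat.ofHom f) (ModuleCat.ofHom g)
    (by rw [← ModuleCat.ofHom_comp, S.comp_zero]; rfl)

lemma se (S : SES f g) : S.sc.ShortExact where
  exact := by
    rw [ShortComplex.ShortExact.moduleCat_exact_iff_function_exact]; exact S.ex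
  mono_f := by rw [ModuleCat.mono_iff_injective]; exact S.inj
  epi_g := by rw [ModuleCat.epi_iff_surjective]; exact S.surj

/-- Connecting map. -/
noncomputable def δ (S : SES f g) (a : Ideal R) (i : ℕ) : LH a i P →ₗ[R] LH a (i+1) M :=
  LHpost a i S.se.extClass rfl

lemma δ_of (S : SES f g) (n : ℕ) (x : lcE a i P n) :
    S.δ a i (LHof a i P n x) = LHof a (i+1) M n (x.comp S.se.extClass rfl) :=
  LHpost_of a i _ _ n x

lemma ex2 (S : SES f g) : Function.Exact (LHmap a i f) (LHmap a i g) := by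
  intro x
  constructor
  · obtain ⟨n, x, rfl⟩ := LHof_surj a i N x
    intro h
    rw [LHmap_of] at h
    obtain ⟨m, hm, h⟩ := LHof_zero _ _ _ h
    rw [lcF_apply, ← Ext.comp_assoc (h₁₂ := zero_add i) (h := by omega)] at h
    obtain ⟨y, hy⟩ := Ext.covariant_sequence_exact₂ _ S.se _ h
    refine ⟨LHof a i M m y, ?_⟩
    rw [LHmap_of, ← LHof_f a i N hm x, lcF_apply, ← hy]
  · rintro ⟨y, rfl⟩
    rw [LHmap_comp, S.comp_zero, LHmap_zero]

lemma ex3 (S : SES f g) : Function.Exact (LHmap a i g) (S.δ a i) := by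
  intro x
  constructor
  · obtain ⟨n, x, rfl⟩ := LHof_surj a i P x
    intro h
    rw [δ_of] at h
    obtain ⟨m, hm, h⟩ := LHof_zero _ _ _ h
    rw [lcF_apply, ← Ext.comp_assoc (h₁₂ := zero_add i) (h := by omega)] at h
    obtain ⟨y, hy⟩ := Ext.covariant_sequence_exact₃ _ S.se _ _ h
    refine ⟨LHof a i N m y, ?_⟩
    rw [LHmap_of, ← LHof_f a i P hm x, lcF_apply, ← hy]
  · rintro ⟨y, rfl⟩
    obtain ⟨n, y, rfl⟩ := LHof_surj a i N y
    rw [LHmap_of, δ_of, Ext.comp_assoc (h₂₃ := zero_add 1) (h := by omega), S.se.comp_extClass]; simp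

lemma ex1 (S : SES f g) : Function.Exact (S.δ a i) (LHmap a (i+1) f) := by
  intro x
  constructor
  · obtain ⟨n, x, rfl⟩ := LHof_surj a _ M x
    intro h
    rw [LHmap_of] at h
    obtain ⟨m, hm, h⟩ := LHof_zero _ _ _ h
    rw [lcF_apply, ← Ext.comp_assoc (h₁₂ := zero_add _) (h := by omega)] at h
    obtain ⟨y, hy⟩ := Ext.covariant_sequence_exact₁ _ S.se _ h rfl
    refine ⟨LHof a i P m y, ?_⟩
    rw [δ_of, ← LHof_f a _ M hm x, lcF_apply, ← hy]
  · rintro ⟨y, rfl⟩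
    obtain ⟨n, y, rfl⟩ := LHof_surj a i P y
    rw [δ_of, LHmap_of, Ext.comp_assoc (h₂₃ := add_zero 1) (h := by omega), S.se.extClass_comp]; simp

end SES

lemma LH_injective (J : Type) [AddCommGroup J] [Module R J] [Module.Injective R J] :
    Subsingleton (LH a (i+1) J) := by
  refine ⟨fun x y => ?_⟩
  suffices ∀ x : LH a (i+1) J, x = 0 by rw [this x, this y]
  intro x
  obtain ⟨n, x, rfl⟩ := LHof_surj a _ J x
  have : Injective (ModuleCat.of R J) := Module.injective_object_of_injective_module R J
  rw [Ext.eq_zero_of_injective x, map_zero]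

/-- The torsion functor. -/
def lcΓ (a : Ideal R) (M : Type) [AddCommGroup M] [Module R M] : Submodule R M where
  carrier := {x | ∃ n : ℕ, ∀ r ∈ a ^ n, r • x = 0}
  zero_mem' := ⟨0, by simp⟩
  add_mem' := by
    rintro x y ⟨n, hx⟩ ⟨m, hy⟩
    refine ⟨max n m, fun r hr => ?_⟩
    rw [smul_add, hx r (Ideal.pow_le_pow_right (le_max_left n m) hr),
      hy r (Ideal.pow_le_pow_right (le_max_right n m) hr), add_zero]
  smul_mem' := by
    rintro c x ⟨n, hx⟩
    exact ⟨n, fun r hr => by rw [smul_comm, hx r hr, smul_zero]⟩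

lemma mem_lcΓ {a : Ideal R} {x : M} : x ∈ lcΓ a M ↔ ∃ n : ℕ, ∀ r ∈ a ^ n, r • x = 0 := Iff.rfl

/-- Evaluation at one. -/
noncomputable def LHev0 (n : ℕ) : lcE a 0 M n →ₗ[R] M where
  toFun x := (Ext.homEquiv₀ x).hom (Ideal.Quotient.mk _ 1)
  map_add' x y := by
    have : Ext.homEquiv₀ (x + y) = Ext.homEquiv₀ x + Ext.homEquiv₀ y := Ext.addEquiv₀.map_add x y
    rw [this]; rfl
  map_smul' r x := by
    have : Ext.homEquiv₀ (r • x) = r • Ext.homEquiv₀ x := (Ext.linearEquiv₀ (R := R)).map_smul r x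
    rw [this]; rfl

lemma LHev0_mk₀ (n : ℕ) (f : lcQ a n ⟶ ModuleCat.of R M) :
    LHev0 a n (Ext.mk₀ f) = f.hom (Ideal.Quotient.mk _ 1) := by
  simp only [LHev0, LinearMap.coe_mk, AddHom.coe_mk]
  rw [← Ext.homEquiv₀_symm_apply, Equiv.apply_symm_apply]

lemma LHev0_f {m n : ℕ} (h : m ≤ n) (x : lcE a 0 M m) :
    LHev0 a n (lcF a 0 M m n h x) = LHev0 a m x := by
  obtain ⟨x, rfl⟩ := Ext.homEquiv₀.symm.surjective x
  rw [Ext.homEquiv₀_symm_apply, lcF_apply, Ext.mk₀_comp_mk₀, LHev0_mk₀, LHev0_mk₀]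
  rfl

/-- The map from degree zero cohomology. -/
noncomputable def LHev : LH a 0 M →ₗ[R] M :=
  Module.DirectLimit.lift _ _ _ _ (fun n => LHev0 a n) (fun _ _ h x => LHev0_f a h x)

lemma LHev_of (n : ℕ) (x : lcE a 0 M n) : LHev a (LHof a 0 M n x) = LHev0 a n x :=
  Module.DirectLimit.lift_of _ _ _

lemma LHev0_inj (n : ℕ) (x : lcE a 0 M n) (h : LHev0 a n x = 0) : x = 0 := by
  have : Ext.homEquiv₀ x = 0 := by
    ext
    exact h
  have h3 := Ext.mk₀_homEquiv₀_apply x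
  rw [← h3, this, Ext.mk₀_zero]

lemma LHev_inj : Function.Injective (LHev a (M := M)) := by
  rw [injective_iff_map_eq_zero]
  intro x
  obtain ⟨n, x, rfl⟩ := LHof_surj a 0 M x
  rw [LHev_of]; intro h; rw [LHev0_inj a n x h, map_zero]

lemma LHev_range : LinearMap.range (LHev a (M := M)) = lcΓ a M := by
  apply le_antisymm
  · rintro _ ⟨x, rfl⟩
    obtain ⟨n, hn⟩ := LH_torsion a 0 x
    exact ⟨n, fun r hr => by rw [← map_smul, hn r hr, map_zero]⟩
  · rintro x ⟨n, hx⟩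
    let f : (R ⧸ a ^ n) →ₗ[R] M := Submodule.liftQ _ (LinearMap.toSpanSingleton R M x)
      (fun r hr => by simpa using hx r hr)
    refine ⟨LHof a 0 M n (Ext.mk₀ (ModuleCat.ofHom f)), ?_⟩
    rw [LHev_of, LHev0_mk₀]
    change LinearMap.toSpanSingleton R M x 1 = x
    simp

lemma LHev_map (f : M →ₗ[R] N) (x : LH a 0 M) : LHev a (LHmap a 0 f x) = f (LHev a x) := by
  obtain ⟨n, x, rfl⟩ := LHof_surj a 0 M x
  rw [LHmap_of, LHev_of, LHev_of]
  obtain ⟨x, rfl⟩ := Ext.homEquiv₀.symm.surjective x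
  rw [Ext.homEquiv₀_symm_apply, Ext.mk₀_comp_mk₀, LHev0_mk₀, LHev0_mk₀]
  rfl

end LC

section Comparison
open CategoryTheory CategoryTheory.Limits

variable {R : Type} [CommRing R]

/-- The contravariant Hom functor. -/
noncomputable abbrev cmF (Y : ModuleCat.{0} R) : ModuleCat.{0} R ⥤ (ModuleCat.{0} R)ᵒᵖ :=
  ((linearYoneda R (ModuleCat.{0} R)).obj Y).rightOp

/-- The Hom complex, in the opposite category. -/
noncomputable abbrev cmL {X : ModuleCat.{0} R} (P : ProjectiveResolution X) (Y : ModuleCat.{0} R) :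
    ChainComplex (ModuleCat.{0} R)ᵒᵖ ℕ :=
  ((cmF Y).mapHomologicalComplex _).obj P.complex

/-- `f` represents `α`. -/
def cmRep {X : ModuleCat.{0} R} (P : ProjectiveResolution X) (Y : ModuleCat.{0} R) (i : ℕ)
    (α : ((_root_.Ext R (ModuleCat.{0} R) i).obj (Opposite.op X)).obj Y)
    (f : P.complex.X i ⟶ Y) : Prop :=
  ∃ z : ((cmL P Y).opcycles i).unop, ((cmL P Y).pOpcycles i).unop.hom z = f ∧
    (P.isoLeftDerivedObj (cmF Y) i).hom.unop.hom (((cmL P Y).homologyι i).unop.hom z) = α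

variable {X : ModuleCat.{0} R} (P : ProjectiveResolution X) (Y : ModuleCat.{0} R) (i : ℕ)

lemma cmRep_exists (α : ((_root_.Ext R (ModuleCat.{0} R) i).obj (Opposite.op X)).obj Y) :
    ∃ f, P.complex.d (i+1) i ≫ f = 0 ∧ cmRep P Y i α f := by
  have h1 : Function.Surjective (P.isoLeftDerivedObj (cmF Y) i).hom.unop.hom := by
    rw [← ModuleCat.epi_iff_surjective]; infer_instance
  have h2 : Function.Surjective ((cmL P Y).homologyι i).unop.hom := by
    rw [← ModuleCat.epi_iff_surjective]; infer_instance
  obtain ⟨z, rfl⟩ := h1 α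
  obtain ⟨z, rfl⟩ := h2 z
  refine ⟨_, ?_, z, rfl, rfl⟩
  have h3 := congrArg Quiver.Hom.unop ((cmL P Y).d_pOpcycles (i+1) i)
  exact congrArg (fun t => t.hom z) h3

lemma cmRep_of (f : P.complex.X i ⟶ Y) (hf : P.complex.d (i+1) i ≫ f = 0) :
    ∃ α, cmRep P Y i α f := by
  have h : ((ShortComplex.mk _ _ ((cmL P Y).d_pOpcycles (i+1) i))).Exact := 
    ShortComplex.exact_of_g_is_cokernel _ ((cmL P Y).opcyclesIsCokernel (i+1) i (by simp))
  have h2 := h.unop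
  rw [ShortComplex.moduleCat_exact_iff] at h2
  obtain ⟨z, hz⟩ := h2 f hf
  exact ⟨_, z, hz, rfl⟩

lemma cmRep_zero (α) (f : P.complex.X (i+1) ⟶ Y) (h : cmRep P Y (i+1) α f) :
    α = 0 ↔ ∃ g, P.complex.d (i+1) i ≫ g = f := by
  obtain ⟨z, rfl, rfl⟩ := h
  have h1 : Function.Injective (P.isoLeftDerivedObj (cmF Y) (i+1)).hom.unop.hom := by
    rw [← ModuleCat.mono_iff_injective]; infer_instance
  have h2 : Function.Injective ((cmL P Y).pOpcycles (i+1)).unop.hom := by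
    rw [← ModuleCat.mono_iff_injective]; infer_instance
  refine Iff.trans (map_eq_zero_iff _ h1) ?_
  have h : ((ShortComplex.mk _ _ ((cmL P Y).homologyι_comp_fromOpcycles (i+1) i))).Exact := 
    ShortComplex.exact_of_f_is_kernel _ ((cmL P Y).homologyIsKernel (i+1) i (by simp))
  have h3 := h.unop
  rw [ShortComplex.moduleCat_exact_iff] at h3
  have h4 := congrArg Quiver.Hom.unop ((cmL P Y).p_fromOpcycles (i+1) i)
  constructor
  · intro hz
    obtain ⟨g, hg⟩ := h3 z hz
    refine ⟨g, ?_⟩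
    rw [← hg]
    exact congrArg (fun t => t.hom g) h4.symm
  · rintro ⟨g, hg⟩
    have : z = ((cmL P Y).fromOpcycles (i+1) i).unop.hom g := by
      apply h2
      rw [← hg]
      exact congrArg (fun t => t.hom g) h4.symm
    rw [this]
    have h5 := congrArg Quiver.Hom.unop ((cmL P Y).homologyι_comp_fromOpcycles (i+1) i)
    exact congrArg (fun t => t.hom g) h5

lemma cmRep_map {X' : ModuleCat.{0} R} (P' : ProjectiveResolution X') (g : X' ⟶ X)
    (φ : ProjectiveResolution.Hom P' P g) (α) (f : P.complex.X i ⟶ Y) (h : cmRep P Y i α f) :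
    cmRep P' Y i (((_root_.Ext R (ModuleCat.{0} R) i).map g.op).app Y α) (φ.hom.f i ≫ f) := by
  obtain ⟨z, rfl, rfl⟩ := h
  let ψ := ((cmF Y).mapHomologicalComplex (ComplexShape.down ℕ)).map φ.hom
  refine ⟨(HomologicalComplex.opcyclesMap ψ i).unop.hom z, ?_, ?_⟩
  · have := congrArg Quiver.Hom.unop (HomologicalComplex.p_opcyclesMap ψ i)
    exact congrArg (fun t => t.hom z) this
  · have h1 := congrArg Quiver.Hom.unop (HomologicalComplex.homologyι_naturality ψ i)
    have h2 := congrArg Quiver.Hom.unop (ProjectiveResolution.isoLeftDerivedObj_hom_naturality g P' P φ.hom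
      φ.hom_f_zero_comp_π_f_zero (cmF Y) i)
    have h3 := congrArg (fun t => t.hom z) h1
    have h4 := congrArg (fun t => t.hom (((cmL P Y).homologyι i).unop.hom z)) h2
    refine Eq.trans ?_ h4.symm
    exact congrArg (P'.isoLeftDerivedObj (cmF Y) i).hom.unop.hom h3.symm

/-- The diagram of Ext modules. -/
noncomputable abbrev cmD (a : Ideal R) (i : ℕ) (Y : ModuleCat.{0} R) : (ℕᵒᵖ)ᵒᵖ ⥤ ModuleCat.{0} R :=
  localCohomology.diagram (localCohomology.idealPowersDiagram a) i ⋙ (evaluation _ _).obj Y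

lemma cm_gen {J : Type} [SmallCategory J] [IsFiltered J] (F : J ⥤ ModuleCat.{0} R) (c : Cocone F)
    (hc : IsColimit c) :
    Subsingleton c.pt ↔ ∀ (j : J) (α : F.obj j), ∃ k, ∃ f : j ⟶ k, (F.map f).hom α = 0 := by
  constructor
  · intro hs j α
    obtain ⟨k, f, g, hk⟩ := (Concrete.isColimit_rep_eq_iff_exists F hc α (0 : F.obj j)).1 (hs.elim _ _)
    exact ⟨k, f, hk.trans (map_zero (F.map g).hom)⟩
  · intro h
    refine ⟨fun x y => ?_⟩
    suffices ∀ x : c.pt, x = 0 by rw [this x, this y]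
    intro x
    obtain ⟨j, α, rfl⟩ := Concrete.isColimit_exists_rep F hc x
    obtain ⟨m, f, h0⟩ := h j α
    have h1 := congrArg (fun t => t.hom α) (c.w f)
    exact h1.symm.trans ((congrArg (c.ι.app m).hom h0).trans (map_zero _))

lemma cm_iff1 (a : Ideal R) :
    Subsingleton ((localCohomology a i).obj Y) ↔
      ∀ (n : ℕ) (α : ((_root_.Ext R (ModuleCat.{0} R) i).obj (Opposite.op (lcQ a n))).obj Y),
        ∃ m, ∃ h : n ≤ m, (((_root_.Ext R (ModuleCat.{0} R) i).map (lcTr a h).op).app Y).hom α = 0 := by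
  have := localCohomology.hasColimitDiagram.{0, 0} (localCohomology.idealPowersDiagram a) i
  let c : Cocone (cmD a i Y) := ((evaluation _ _).obj Y).mapCocone
    (colimit.cocone (localCohomology.diagram (localCohomology.idealPowersDiagram a) i))
  have hc : IsColimit c := isColimitOfPreserves ((evaluation _ _).obj Y) (colimit.isColimit _)
  have h0 := cm_gen _ c hc
  refine Iff.trans h0 ⟨fun H n α => ?_, fun H j α => ?_⟩
  · obtain ⟨k, f, h⟩ := H (Opposite.op (Opposite.op n)) α
    exact ⟨k.unop.unop, leOfHom f.unop.unop, h⟩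
  · obtain ⟨m, hm, h⟩ := H j.unop.unop α
    exact ⟨Opposite.op (Opposite.op m), (homOfLE hm).op.op, h⟩

lemma cm_iff2 (a : Ideal R) (M : Type) [AddCommGroup M] [Module R M] :
    Subsingleton (LH a i M) ↔
      ∀ (n : ℕ) (α : lcE a i M n), ∃ m, ∃ h : n ≤ m, lcF a i M n m h α = 0 := by
  constructor
  · intro hs n α
    exact LHof_zero a i M (hs.elim _ _)
  · intro h
    refine ⟨fun x y => ?_⟩
    suffices ∀ x : LH a i M, x = 0 by rw [this x, this y]
    intro x
    obtain ⟨n, α, rfl⟩ := LHof_surj a i M x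
    obtain ⟨m, hm, h0⟩ := h n α
    rw [← LHof_f a i M hm, h0, map_zero]

lemma cm_iff (a : Ideal R) (M : Type) [AddCommGroup M] [Module R M] :
    Subsingleton ((localCohomology a (i+1)).obj (ModuleCat.of R M)) ↔
      Subsingleton (LH a (i+1) M) := by
  rw [cm_iff1, cm_iff2]
  let P (n : ℕ) : ProjectiveResolution (lcQ a n) := projectiveResolution _
  let φ {m n : ℕ} (h : m ≤ n) : ProjectiveResolution.Hom (P n) (P m) (lcTr a h) :=
    { hom := ProjectiveResolution.lift (lcTr a h) (P n) (P m)
      hom_f_zero_comp_π_f_zero := ProjectiveResolution.lift_commutes_zero _ _ _ }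
  have key : ∀ {m n : ℕ} (h : m ≤ n) (f : (P m).complex.X (i+1) ⟶ ModuleCat.of R M)
      (hf : (P m).complex.d (i+1+1) (i+1) ≫ f = 0) (α) (_ : cmRep (P m) _ _ α f),
      ((_root_.Ext R (ModuleCat.{0} R) (i+1)).map (lcTr a h).op).app _ α = 0 ↔
      lcF a (i+1) M m n h ((P m).extMk f (i+1+1) rfl hf) = 0 := by
    intro m n h f hf α hα
    rw [cmRep_zero _ _ _ _ _ (cmRep_map _ _ _ _ _ (φ h) _ _ hα), lcF_apply,
      ProjectiveResolution.mk₀_comp_extMk f _ rfl hf (φ h),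
      ProjectiveResolution.extMk_eq_zero_iff _ _ _ _ _ i rfl]
  constructor
  · intro H n α
    obtain ⟨f, hf, rfl⟩ := (P n).extMk_surjective α (i+1+1) rfl
    obtain ⟨α, hα⟩ := cmRep_of _ _ _ f hf
    obtain ⟨m, hm, h0⟩ := H n α
    exact ⟨m, hm, (key hm f hf α hα).1 h0⟩
  · intro H n α
    obtain ⟨f, hf, hα⟩ := cmRep_exists (P n) _ _ α
    obtain ⟨m, hm, h0⟩ := H n ((P n).extMk f (i+1+1) rfl hf)
    exact ⟨m, hm, (key hm f hf α hα).2 h0⟩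

end Comparison

section Basic1
variable {R : Type} [CommRing R]
variable {M N P : Type} [AddCommGroup M] [Module R M] [AddCommGroup N] [Module R N]
  [AddCommGroup P] [Module R P]

lemma SES_quot (f : M →ₗ[R] N) (hf : Function.Injective f) :
    SES f (LinearMap.range f).mkQ :=
  ⟨hf, Submodule.mkQ_surjective _, by rw [LinearMap.exact_iff]; simp⟩

lemma SES_sub (S : Submodule R N) : SES S.subtype S.mkQ :=
  ⟨Subtype.val_injective, Submodule.mkQ_surjective _, by rw [LinearMap.exact_iff]; simp⟩

lemma SES_ker (g : N →ₗ[R] P) (hg : Function.Surjective g) : SES (LinearMap.ker g).subtype g :=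
  ⟨Subtype.val_injective, hg, by rw [LinearMap.exact_iff]; simp⟩

lemma exists_inj (M : Type) [AddCommGroup M] [Module R M] :
    ∃ (J : Type) (_ : AddCommGroup J) (_ : Module R J) (_ : Module.Injective R J)
      (f : M →ₗ[R] J), Function.Injective f := by
  let J := CategoryTheory.Injective.under (ModuleCat.of R M)
  refine ⟨J, inferInstance, inferInstance, ?_, (CategoryTheory.Injective.ι (ModuleCat.of R M)).hom, ?_⟩
  · have : CategoryTheory.Injective (ModuleCat.of R J) :=
      CategoryTheory.Injective.injective_under (ModuleCat.of R M)
    exact Module.injective_module_of_injective_object R J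
  · exact (ModuleCat.mono_iff_injective _).1 inferInstance

lemma exists_ses (M : Type) [AddCommGroup M] [Module R M] :
    ∃ (J : Type) (_ : AddCommGroup J) (_ : Module R J) (_ : Module.Injective R J)
      (C : Type) (_ : AddCommGroup C) (_ : Module R C)
      (f : M →ₗ[R] J) (g : J →ₗ[R] C), SES f g := by
  obtain ⟨J, _, _, h, f, hf⟩ := exists_inj (R := R) M
  exact ⟨J, _, _, h, J ⧸ LinearMap.range f, inferInstance, inferInstance, f, _, SES_quot f hf⟩

variable {f : M →ₗ[R] N} {g : N →ₗ[R] P} (a : Ideal R) (i : ℕ)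

lemma SES.mid0 (S : SES f g) (h1 : Subsingleton (LH a i M)) (h2 : Subsingleton (LH a i P)) :
    Subsingleton (LH a i N) := by
  refine ⟨fun x y => ?_⟩
  suffices ∀ x : LH a i N, x = 0 by rw [this x, this y]
  intro x
  obtain ⟨y, rfl⟩ := (S.ex2 a i x).1 (h2.elim _ _)
  rw [h1.elim y 0, map_zero]

lemma SES.right0 (S : SES f g) (h1 : Subsingleton (LH a i N)) (h2 : Subsingleton (LH a (i+1) M)) :
    Subsingleton (LH a i P) := by
  refine ⟨fun x y => ?_⟩
  suffices ∀ x : LH a i P, x = 0 by rw [this x, this y]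
  intro x
  obtain ⟨y, rfl⟩ := (S.ex3 a i x).1 (h2.elim _ _)
  rw [h1.elim y 0, map_zero]

lemma SES.left0 (S : SES f g) (h1 : Subsingleton (LH a i P)) (h2 : Subsingleton (LH a (i+1) N)) :
    Subsingleton (LH a (i+1) M) := by
  refine ⟨fun x y => ?_⟩
  suffices ∀ x : LH a (i+1) M, x = 0 by rw [this x, this y]
  intro x
  obtain ⟨y, rfl⟩ := (S.ex1 a i x).1 (h2.elim _ _)
  rw [h1.elim y 0, map_zero]

lemma LH0_equiv (e : M ≃ₗ[R] N) (h : Subsingleton (LH a i M)) : Subsingleton (LH a i N) :=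
  (LHmap_inj_of_equiv a i e).2.subsingleton

lemma LH0_zero (h : Subsingleton M) : Subsingleton (LH a i M) := by
  refine ⟨fun x y => ?_⟩
  suffices ∀ x : LH a i M, x = 0 by rw [this x, this y]
  intro x
  rw [← LHmap_id a i x, show (LinearMap.id : M →ₗ[R] M) = 0 from by ext; exact h.elim _ _, LHmap_zero]

lemma lcΓ_map (f : M →ₗ[R] N) {x : M} (h : x ∈ lcΓ a M) : f x ∈ lcΓ a N := by
  obtain ⟨n, h⟩ := h
  exact ⟨n, fun r hr => by rw [← map_smul, h r hr, map_zero]⟩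

lemma lcΓ_inj {f : M →ₗ[R] N} (hf : Function.Injective f) {x : M} (h : f x ∈ lcΓ a N) :
    x ∈ lcΓ a M := by
  obtain ⟨n, h⟩ := h
  exact ⟨n, fun r hr => hf (by rw [map_smul, h r hr, map_zero])⟩

lemma lcΓ_anti {a b : Ideal R} (h : a ≤ b) : lcΓ b M ≤ lcΓ a M := by
  rintro x ⟨n, hx⟩
  exact ⟨n, fun r hr => hx r (Ideal.pow_right_mono h n hr)⟩

lemma lcΓ_sup {a b : Ideal R} {x : M} (h : x ∈ lcΓ a M) (h' : x ∈ lcΓ b M) : x ∈ lcΓ (a ⊔ b) M := by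
  obtain ⟨n, h⟩ := h
  obtain ⟨m, h'⟩ := h'
  refine ⟨n + m, fun r hr => ?_⟩
  obtain ⟨s, hs, t, ht, rfl⟩ := Submodule.mem_sup.1 (Ideal.sup_pow_add_le_pow_sup_pow hr)
  rw [add_smul, h s hs, h' t ht, add_zero]

lemma lcΓ_span {y : R} {x : M} : x ∈ lcΓ (Ideal.span {y}) M ↔ ∃ n : ℕ, y ^ n • x = 0 := by
  constructor
  · rintro ⟨n, h⟩
    exact ⟨n, h _ (Ideal.pow_mem_pow (Ideal.mem_span_singleton_self y) n)⟩
  · rintro ⟨n, h⟩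
    refine ⟨n, fun r hr => ?_⟩
    rw [Ideal.span_singleton_pow, Ideal.mem_span_singleton] at hr
    obtain ⟨c, rfl⟩ := hr
    rw [mul_comm, mul_smul, h, smul_zero]

/-- all elements are `y`-power torsion. -/
def LHtors (y : R) : Prop := ∀ x : LH a i M, ∃ n : ℕ, y ^ n • x = 0

variable [hN : Module.Injective R N]

lemma SES.shift_bij (S : SES f g) : Function.Bijective (S.δ a (i+1)) := by
  have := LH_injective (R := R) a i N
  have := LH_injective (R := R) a (i+1) N
  constructor
  · rw [injective_iff_map_eq_zero]
    intro x hx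
    obtain ⟨y, rfl⟩ := (S.ex3 a (i+1) x).1 hx
    rw [Subsingleton.elim y 0, map_zero]
  · intro x
    exact (S.ex1 a (i+1) x).1 (Subsingleton.elim _ _)

lemma SES.shift (S : SES f g) : Subsingleton (LH a (i+2) M) ↔ Subsingleton (LH a (i+1) P) :=
  (Equiv.ofBijective _ (S.shift_bij a i)).subsingleton_congr.symm

lemma SES.shift_tors (S : SES f g) (y : R) :
    LHtors (M := M) a (i+2) y ↔ LHtors (M := P) a (i+1) y := by
  constructor
  · intro h x
    obtain ⟨n, hn⟩ := h (S.δ a (i+1) x)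
    exact ⟨n, (S.shift_bij a i).1 (by rw [map_smul, hn, map_zero])⟩
  · intro h x
    obtain ⟨x, rfl⟩ := (S.shift_bij a i).2 x
    obtain ⟨n, hn⟩ := h x
    exact ⟨n, by rw [← map_smul, hn, map_zero]⟩

lemma SES.δ0_zero_iff {N : Type} [AddCommGroup N] [Module R N] {f : M →ₗ[R] N} {g : N →ₗ[R] P}
    (S : SES f g) (x : LH a 0 P) :
    S.δ a 0 x = 0 ↔ ∃ u ∈ lcΓ a N, g u = LHev a x := by
  rw [S.ex3 a 0 x]
  constructor
  · rintro ⟨y, rfl⟩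
    exact ⟨LHev a y, by rw [← LHev_range]; exact ⟨y, rfl⟩, (LHev_map a g y).symm⟩
  · rintro ⟨u, hu, hx⟩
    rw [← LHev_range] at hu
    obtain ⟨y, rfl⟩ := hu
    exact ⟨y, LHev_inj a (by rw [LHev_map, hx])⟩

lemma SES.tors_one (S : SES f g) (y : R) :
    LHtors (M := M) a 1 y ↔ ∀ x ∈ lcΓ a P, ∃ n : ℕ, ∃ u ∈ lcΓ a N, g u = y ^ n • x := by
  have := LH_injective (R := R) a 0 N
  constructor
  · intro h x hx
    rw [← LHev_range] at hx
    obtain ⟨x, rfl⟩ := hx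
    obtain ⟨n, hn⟩ := h (S.δ a 0 x)
    rw [← map_smul, S.δ0_zero_iff a] at hn
    exact ⟨n, by rw [← map_smul]; exact hn⟩
  · intro h x
    obtain ⟨x, rfl⟩ := (S.ex1 a 0 x).1 (Subsingleton.elim _ _)
    obtain ⟨n, hn⟩ := h (LHev a x) (by rw [← LHev_range]; exact ⟨x, rfl⟩)
    exact ⟨n, by rw [← map_smul, S.δ0_zero_iff a, map_smul]; exact hn⟩

lemma SES.one_iff (S : SES f g) :
    Subsingleton (LH a 1 M) ↔ ∀ x ∈ lcΓ a P, ∃ u ∈ lcΓ a N, g u = x := by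
  have : Subsingleton (LH a 1 M) ↔ LHtors (M := M) a 1 1 := by
    constructor
    · intro h x; exact ⟨0, h.elim _ _⟩
    · intro h
      refine ⟨fun x y => ?_⟩
      obtain ⟨n, hn⟩ := h x
      obtain ⟨m, hm⟩ := h y
      simp only [one_pow, one_smul] at hn hm
      rw [hn, hm]
  rw [this, S.tors_one]; simp

end Basic1

section CC
variable {R : Type} [CommRing R]

lemma inj_ext {J : Type} [AddCommGroup J] [Module R J] [Module.Injective R J] (K : Ideal R) (r : R)
    (t : J) (h : ∀ b, r * b ∈ K → b • t = 0) : ∃ t' : J, (∀ c ∈ K, c • t' = 0) ∧ r • t' = t := by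
  let L : Ideal R := LinearMap.ker (K.mkQ ∘ₗ LinearMap.mulLeft R r)
  let h1 : (R ⧸ L) →ₗ[R] (R ⧸ K) := Submodule.liftQ _ (K.mkQ ∘ₗ LinearMap.mulLeft R r) le_rfl
  have h1i : Function.Injective h1 := by
    rw [← LinearMap.ker_eq_bot]; exact Submodule.ker_liftQ_eq_bot _ _ _ le_rfl
  let h2 : (R ⧸ L) →ₗ[R] J := Submodule.liftQ _ (LinearMap.toSpanSingleton R J t) (by
    intro b hb
    have : r * b ∈ K := (Submodule.Quotient.mk_eq_zero K).1 hb
    simpa using h b this)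
  obtain ⟨φ, hφ⟩ := Module.Injective.out h1 h1i h2
  refine ⟨φ (K.mkQ 1), fun c hc => ?_, ?_⟩
  · rw [← map_smul, ← map_smul, show K.mkQ (c • 1) = 0 by simpa [Ideal.Quotient.eq_zero_iff_mem] using hc, map_zero]
  · have := hφ (L.mkQ 1)
    have e2 : h2 (L.mkQ 1) = t := by change (1:R) • t = t; simp
    have e1 : h1 (L.mkQ 1) = r • K.mkQ 1 := by
      change K.mkQ (r * 1) = _
      rw [← smul_eq_mul, map_smul]
    rw [e1, e2, map_smul] at this
    exact this

variable [IsNoetherianRing R]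

lemma colon_stable (K : Ideal R) (y : R) : ∃ N : ℕ, ∀ s b, y ^ (N + s) * b ∈ K → y ^ N * b ∈ K := by
  let F : ℕ →o Ideal R := ⟨fun n => Submodule.comap (LinearMap.mulLeft R (y ^ n)) K, by
    intro m n h b hb
    simp only [Submodule.mem_comap, LinearMap.mulLeft_apply] at hb ⊢
    obtain ⟨k, rfl⟩ := Nat.exists_eq_add_of_le h
    rw [pow_add, mul_comm (y ^ m), mul_assoc]
    exact K.mul_mem_left _ hb⟩
  obtain ⟨N, hN⟩ := monotone_stabilizes_iff_noetherian.2 (inferInstance : IsNoetherian R R) F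
  refine ⟨N, fun s b hb => ?_⟩
  have : b ∈ F (N + s) := hb
  rw [← hN (N + s) (by omega)] at this
  exact this

lemma inj_div {J : Type} [AddCommGroup J] [Module R J] [Module.Injective R J] (I : Ideal R) (y : R)
    (s : ℕ) {t : J} (ht : t ∈ lcΓ I J) : ∃ t' ∈ lcΓ I J, ∃ N : ℕ, y ^ N • (y ^ s • t' - t) = 0 := by
  obtain ⟨m, hm⟩ := ht
  obtain ⟨N, hN⟩ := colon_stable (I ^ m) y
  obtain ⟨t', h1, h2⟩ := inj_ext (I ^ m) (y ^ (N + s)) (y ^ N • t) (by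
    intro b hb
    rw [← mul_smul, mul_comm]
    exact hm _ (hN s b hb))
  refine ⟨t', ⟨m, h1⟩, N, ?_⟩
  rw [smul_sub, ← mul_smul, ← pow_add, h2, sub_self]

variable {M : Type} [AddCommGroup M] [Module R M]

lemma CC_one (I : Ideal R) (y : R) (h : Subsingleton (LH I 1 M))
    (h' : ∀ x ∈ lcΓ I M, ∃ n : ℕ, y ^ n • x = 0) : Subsingleton (LH (I ⊔ Ideal.span {y}) 1 M) := by
  obtain ⟨J, _, _, _, C, _, _, f, g, S⟩ := exists_ses (R := R) M
  rw [S.one_iff] at h ⊢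
  intro x hx
  obtain ⟨u, hu, rfl⟩ := h x (lcΓ_anti le_sup_left hx)
  refine ⟨u, lcΓ_sup hu (lcΓ_span.2 ?_), rfl⟩
  obtain ⟨s, hs⟩ := lcΓ_span.1 (lcΓ_anti le_sup_right hx)
  rw [← map_smul] at hs
  obtain ⟨m, hm⟩ := (S.ex _).1 hs
  obtain ⟨n, hn⟩ := h' m (lcΓ_inj I S.inj (by rw [hm]; exact Submodule.smul_mem _ _ hu))
  exact ⟨n + s, by rw [pow_add, mul_smul, ← hm, ← map_smul, hn, map_zero]⟩

lemma CC_two (I : Ideal R) (y : R) (h : Subsingleton (LH I 2 M))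
    (h' : LHtors (M := M) I 1 y) : Subsingleton (LH (I ⊔ Ideal.span {y}) 2 M) := by
  obtain ⟨J0, _, _, _, C, _, _, f0, g0, S0⟩ := exists_ses (R := R) M
  obtain ⟨J, _, _, _, C', _, _, f, g, S⟩ := exists_ses (R := R) C
  rw [S0.shift, S.one_iff] at h ⊢
  rw [S0.tors_one] at h'
  intro x hx
  obtain ⟨u, hu, rfl⟩ := h x (lcΓ_anti le_sup_left hx)
  obtain ⟨s, hs⟩ := lcΓ_span.1 (lcΓ_anti le_sup_right hx)
  rw [← map_smul] at hs
  obtain ⟨c, hc⟩ := (S.ex _).1 hs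
  obtain ⟨n, t, ht, htc⟩ := h' c (lcΓ_inj I S.inj (by rw [hc]; exact Submodule.smul_mem _ _ hu))
  obtain ⟨t', ht', N, hN⟩ := inj_div I y (s + n) ht
  refine ⟨u - f (g0 t'), lcΓ_sup (Submodule.sub_mem _ hu (lcΓ_map I _ (lcΓ_map I _ ht')))
    (lcΓ_span.2 ⟨N + (s + n), ?_⟩), ?_⟩
  · have e : y ^ (s + n) • u = f (g0 t) := by
      rw [htc, map_smul, hc, ← mul_smul, ← pow_add, add_comm]
    rw [pow_add, mul_smul, smul_sub, e, ← map_smul, ← map_smul, ← map_sub, ← map_sub, ← map_smul,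
      ← map_smul, ← neg_sub, smul_neg, hN]; simp
  · rw [map_sub, (S.ex _).2 ⟨_, rfl⟩, sub_zero]

lemma CC_succ (I : Ideal R) (y : R) (i : ℕ) : ∀ (M : Type) [AddCommGroup M] [Module R M],
    Subsingleton (LH I (i+2) M) → LHtors (M := M) I (i+1) y →
      Subsingleton (LH (I ⊔ Ideal.span {y}) (i+2) M) := by
  induction i with
  | zero => intro M _ _ h h'; exact CC_two I y h h'
  | succ i ih =>
    intro M _ _ h h'
    obtain ⟨J0, _, _, _, C, _, _, f0, g0, S0⟩ := exists_ses (R := R) M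
    rw [S0.shift] at h ⊢
    exact ih C h ((S0.shift_tors I i y).1 h')

lemma LH_bot (i : ℕ) : ∀ (M : Type) [AddCommGroup M] [Module R M],
    Subsingleton (LH (⊥ : Ideal R) (i+1) M) := by
  induction i with
  | zero =>
    intro M _ _
    obtain ⟨J0, _, _, _, C, _, _, f0, g0, S0⟩ := exists_ses (R := R) M
    rw [S0.one_iff]
    intro x _
    obtain ⟨u, rfl⟩ := S0.surj x
    exact ⟨u, ⟨1, by simp +contextual⟩, rfl⟩
  | succ i ih =>
    intro M _ _
    obtain ⟨J0, _, _, _, C, _, _, f0, g0, S0⟩ := exists_ses (R := R) M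
    rw [S0.shift]
    exact ih C

lemma CC (I : Ideal R) (y : R) (k : ℕ) (hk : 1 ≤ k) (h : ∀ i, k ≤ i → Subsingleton (LH I i M))
    (i : ℕ) (hi : k + 1 ≤ i) : Subsingleton (LH (I ⊔ Ideal.span {y}) i M) := by
  obtain ⟨j, rfl⟩ := Nat.exists_eq_add_of_le (show 2 ≤ i by omega)
  rw [add_comm]
  refine CC_succ I y j M (h _ (by omega)) fun x => ⟨0, ?_⟩
  have := h (j+1) (by omega)
  exact Subsingleton.elim _ _

lemma LH_torsion_vanish (a : Ideal R) (h : ∀ x : M, x ∈ lcΓ a M) (i : ℕ) :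
    Subsingleton (LH a (i+1) M) := by
  classical
  obtain ⟨s, rfl⟩ := IsNoetherian.noetherian a
  induction s using Finset.induction_on generalizing i with
  | empty => simpa using LH_bot i M
  | insert y s _ ih =>
    have e : Submodule.span R (↑(insert y s) : Set R) = Ideal.span (s : Set R) ⊔ Ideal.span {y} := by
      rw [Finset.coe_insert, sup_comm]; exact Submodule.span_insert y s
    rw [e] at h ⊢
    have h1 : ∀ x : M, x ∈ lcΓ (Ideal.span (s : Set R)) M := fun x => lcΓ_anti le_sup_left (h x)
    cases i with
    | zero => exact CC_one _ y (ih 0 h1) fun x _ => lcΓ_span.1 (lcΓ_anti le_sup_right (h x))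
    | succ i =>
      refine CC_succ _ y i M (ih (i+1) h1) fun x => ⟨0, ?_⟩
      have := ih i h1
      exact Subsingleton.elim _ _

end CC

set_option linter.unusedSectionVars false

section Dim
variable {R : Type} [CommRing R]

/-- class of modules closed under middle terms of exact sequences -/
structure SerreC (𝒞 : ∀ (M : Type) [AddCommGroup M] [Module R M], Prop) : Prop where
  zero : ∀ (M : Type) [AddCommGroup M] [Module R M], Subsingleton M → 𝒞 M
  mid : ∀ (A B C : Type) [AddCommGroup A] [Module R A] [AddCommGroup B] [Module R B]
    [AddCommGroup C] [Module R C] (f : A →ₗ[R] B) (g : B →ₗ[R] C), Function.Exact f g →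
    𝒞 A → 𝒞 C → 𝒞 B

section
variable {𝒞 : ∀ (M : Type) [AddCommGroup M] [Module R M], Prop}
  {A B : Type} [AddCommGroup A] [Module R A] [AddCommGroup B] [Module R B]

lemma SerreC.sub (H : SerreC 𝒞) (f : A →ₗ[R] B) (hf : Function.Injective f) (h : 𝒞 B) : 𝒞 A := by
  refine H.mid PUnit A B 0 f ?_ (H.zero _ inferInstance) h
  intro y
  simp [map_eq_zero_iff f hf, eq_comm]

lemma SerreC.quot (H : SerreC 𝒞) (f : A →ₗ[R] B) (hf : Function.Surjective f) (h : 𝒞 A) : 𝒞 B := by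
  refine H.mid A B PUnit f 0 ?_ h (H.zero _ inferInstance)
  intro y
  simpa using hf y

end

lemma SerreC_sing : SerreC (R := R) (fun M _ _ => Subsingleton M) where
  zero _ _ _ h := h
  mid A B C _ _ _ _ _ _ f g h h1 h2 := by
    refine ⟨fun x y => ?_⟩
    suffices ∀ x : B, x = 0 by rw [this x, this y]
    intro x
    obtain ⟨z, rfl⟩ := (h x).1 (Subsingleton.elim _ _)
    rw [Subsingleton.elim z 0, map_zero]

variable [IsNoetherianRing R]

lemma FILT {𝒞 : ∀ (M : Type) [AddCommGroup M] [Module R M], Prop} (H : SerreC 𝒞) (a : Ideal R) (i : ℕ)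
    (M : Type) [AddCommGroup M] [Module R M] [hM : Module.Finite R M]
    (h : ∀ q : PrimeSpectrum R, Module.annihilator R M ≤ q.asIdeal → 𝒞 (LH a i (R ⧸ q.asIdeal))) :
    𝒞 (LH a i M) := by
  have h' : ∀ q ∈ Module.support R M, 𝒞 (LH a i (R ⧸ q.asIdeal)) :=
    fun q hq => h q (Module.mem_support_iff_of_finite.1 hq)
  clear h
  revert h'
  refine IsNoetherianRing.induction_on_isQuotientEquivQuotientPrime R hM
    (motive := fun N _ _ _ => (∀ q ∈ Module.support R N, 𝒞 (LH a i (R ⧸ q.asIdeal))) → 𝒞 (LH a i N))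
    ?_ ?_ ?_
  · intro N _ _ _ hN _
    exact H.zero _ (LH0_zero a i hN)
  · intro N _ _ _ p e h
    refine H.sub _ (LHmap_inj_of_equiv a i e).1 (h p ?_)
    rw [Module.mem_support_iff_of_finite, e.annihilator_eq, Ideal.annihilator_quotient]
  · intro N₁ _ _ _ N₂ _ _ _ N₃ _ _ _ f g hf hg hfg h1 h3 h
    rw [Module.support_of_exact hfg hf hg] at h
    exact H.mid _ _ _ _ _ (SES.ex2 a i ⟨hf, hg, hfg⟩) (h1 fun q hq => h q (Or.inl hq))
      (h3 fun q hq => h q (Or.inr hq))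

lemma FILT0 (a : Ideal R) (i : ℕ)
    (M : Type) [AddCommGroup M] [Module R M] [hM : Module.Finite R M]
    (h : ∀ q : PrimeSpectrum R, Module.annihilator R M ≤ q.asIdeal →
      Subsingleton (LH a i (R ⧸ q.asIdeal))) :
    Subsingleton (LH a i M) := FILT SerreC_sing a i M h

variable [IsLocalRing R]

noncomputable def pd (q : PrimeSpectrum R) : ℕ := (Order.coheight q).toNat

lemma pd_coe (q : PrimeSpectrum R) : (pd q : ℕ∞) = Order.coheight q :=
  ENat.natCast_toNat (Order.coheight_lt_top q).ne

lemma pd_lt {p q : PrimeSpectrum R} (h : p < q) : pd q < pd p := by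
  have := Order.coheight_add_one_le h
  rw [← pd_coe, ← pd_coe] at this
  exact_mod_cast this

lemma pd_le {p q : PrimeSpectrum R} (h : p ≤ q) : pd q ≤ pd p := by
  have := Order.coheight_anti h
  rw [← pd_coe, ← pd_coe] at this
  exact_mod_cast this

lemma pd_eq {p q : PrimeSpectrum R} (h : p ≤ q) (h' : pd p ≤ pd q) : p = q := by
  rcases h.eq_or_lt with h | h
  · exact h
  · have := pd_lt h; omega

lemma pd_zero {q : PrimeSpectrum R} (h : pd q = 0) : q.asIdeal = IsLocalRing.maximalIdeal R := by
  have : q ≤ IsLocalRing.closedPoint R := IsLocalRing.le_maximalIdeal q.2.ne_top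
  rw [pd_eq this (by omega)]; rfl

lemma pd_max {q : PrimeSpectrum R} (h : q.asIdeal = IsLocalRing.maximalIdeal R) : pd q = 0 := by
  have : Order.coheight q = 0 := by
    rw [Order.coheight_eq_zero]
    intro x _
    change x.asIdeal ≤ q.asIdeal
    rw [h]
    exact IsLocalRing.le_maximalIdeal x.2.ne_top
  rw [← pd_coe] at this
  exact_mod_cast this

lemma KRULL (q : PrimeSpectrum R) (r : R) (hr : r ∈ IsLocalRing.maximalIdeal R) :
    ∃ q' : PrimeSpectrum R, q ≤ q' ∧ r ∈ q'.asIdeal ∧ pd q ≤ pd q' + 1 := by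
  obtain ⟨s, h1, h2⟩ := Order.exists_series_of_le_coheight q (pd_coe q).le
  have hs : r ∈ (RelSeries.last s).asIdeal := by
    have : pd (RelSeries.last s) = 0 := by
      by_contra h
      have h3 : RelSeries.last s < IsLocalRing.closedPoint R := by
        refine lt_of_le_of_ne (IsLocalRing.le_maximalIdeal (RelSeries.last s).2.ne_top) fun e => h ?_
        exact pd_max (by rw [e]; rfl)
      have := Order.length_le_coheight (p := s.snoc _ h3) (x := q) (by simp [h1])
      rw [← pd_coe] at this
      simp only [RelSeries.snoc_length, h2] at this
      norm_cast at this
      omega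
    rw [pd_zero this]; exact hr
  obtain ⟨t, h3, h4, h5, h6⟩ := PrimeSpectrum.exist_ltSeries_mem_one_of_mem_last s hs
  by_cases hl : t.length = 0
  · refine ⟨IsLocalRing.closedPoint R, IsLocalRing.le_maximalIdeal q.2.ne_top, hr, ?_⟩
    omega
  · refine ⟨t.toFun 1, ?_, h3, ?_⟩
    · rw [← h1, h5]
      exact t.strictMono.monotone (Fin.zero_le _)
    · have : NeZero t.length := ⟨hl⟩
      have := Order.length_le_coheight (p := t.tail hl) (x := t.toFun 1) (le_of_eq (by
        rw [RelSeries.head_tail]))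
      rw [← pd_coe, RelSeries.tail_length] at this
      have : t.length - 1 ≤ pd (t.toFun 1) := by exact_mod_cast this
      omega

lemma ySES (q : PrimeSpectrum R) {y : R} (hy : y ∉ q.asIdeal) :
    SES (y • LinearMap.id : (R ⧸ q.asIdeal) →ₗ[R] (R ⧸ q.asIdeal))
      (LinearMap.range (y • LinearMap.id : (R ⧸ q.asIdeal) →ₗ[R] (R ⧸ q.asIdeal))).mkQ := by
  refine SES_quot _ ?_
  rw [← LinearMap.ker_eq_bot, LinearMap.ker_eq_bot']
  intro m hm
  obtain ⟨b, rfl⟩ := Ideal.Quotient.mk_surjective m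
  have : Ideal.Quotient.mk q.asIdeal (y * b) = 0 := hm
  rw [Ideal.Quotient.eq_zero_iff_mem] at this ⊢
  exact (q.2.mem_or_mem this).resolve_left hy

lemma yann (q : PrimeSpectrum R) {y : R} (hy : y ∉ q.asIdeal) {q' : PrimeSpectrum R}
    (h : Module.annihilator R ((R ⧸ q.asIdeal) ⧸ (LinearMap.range (y • LinearMap.id :
      (R ⧸ q.asIdeal) →ₗ[R] (R ⧸ q.asIdeal)))) ≤ q'.asIdeal) : q < q' ∧ y ∈ q'.asIdeal := by
  have h1 : y ∈ q'.asIdeal := by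
    refine h (Module.mem_annihilator.2 fun m => ?_)
    obtain ⟨m, rfl⟩ := Submodule.mkQ_surjective _ m
    rw [← map_smul, Submodule.mkQ_apply, Submodule.Quotient.mk_eq_zero]
    exact ⟨m, rfl⟩
  refine ⟨lt_of_le_of_ne ?_ fun e => hy (e ▸ h1), h1⟩
  intro r hr
  refine h (Module.mem_annihilator.2 fun m => ?_)
  obtain ⟨m, rfl⟩ := Submodule.mkQ_surjective _ m
  obtain ⟨b, rfl⟩ := Ideal.Quotient.mk_surjective m
  have e : r • Ideal.Quotient.mk q.asIdeal b = 0 := by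
    change Ideal.Quotient.mk q.asIdeal (r * b) = 0
    rw [Ideal.Quotient.eq_zero_iff_mem]
    exact Ideal.mul_mem_right _ _ hr
  rw [← map_smul, e, map_zero]

lemma tors_of_le (a : Ideal R) (q : PrimeSpectrum R) (h : a ≤ q.asIdeal) (x : R ⧸ q.asIdeal) :
    x ∈ lcΓ a (R ⧸ q.asIdeal) := by
  refine ⟨1, fun r hr => ?_⟩
  obtain ⟨b, rfl⟩ := Ideal.Quotient.mk_surjective x
  change Ideal.Quotient.mk q.asIdeal (r * b) = 0
  rw [Ideal.Quotient.eq_zero_iff_mem]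
  exact Ideal.mul_mem_right _ _ (h (by simpa using hr))

lemma sing_of_yinj {T : Type} [AddCommGroup T] [Module R T] (y : R)
    (h : ∀ x : T, y • x = 0 → x = 0) (h' : ∀ x : T, ∃ n : ℕ, y ^ n • x = 0) : Subsingleton T := by
  refine ⟨fun x y => ?_⟩
  suffices ∀ x : T, x = 0 by rw [this x, this y]
  intro x
  obtain ⟨n, hn⟩ := h' x
  induction n with
  | zero => simpa using hn
  | succ n ih => rw [pow_succ', mul_smul] at hn; exact ih (h _ hn)

lemma LH_ytors {a : Ideal R} {i : ℕ} {M : Type} [AddCommGroup M] [Module R M] {y : R} (hy : y ∈ a)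
    (x : LH a i M) : ∃ n : ℕ, y ^ n • x = 0 := by
  obtain ⟨n, hn⟩ := LH_torsion a i x
  exact ⟨n, hn _ (Ideal.pow_mem_pow hy n)⟩

lemma GV (a : Ideal R) (i : ℕ) : ∀ q : PrimeSpectrum R, pd q < i →
    Subsingleton (LH a i (R ⧸ q.asIdeal)) := by
  induction i with
  | zero => intro q h; omega
  | succ i ih =>
    intro q hq
    by_cases ha : a ≤ q.asIdeal
    · exact LH_torsion_vanish a (tors_of_le a q ha) i
    · obtain ⟨y, hya, hyq⟩ := SetLike.not_le_iff_exists.1 ha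
      have S := ySES q hyq
      have h0 := FILT0 a i _ fun q' hq' => ih q' (by have := pd_lt (yann q hyq hq').1; omega)
      refine sing_of_yinj y (fun x hx => ?_) (LH_ytors hya)
      rw [← LHmap_smul] at hx
      obtain ⟨z, rfl⟩ := (S.ex1 a i x).1 hx
      rw [Subsingleton.elim z 0, map_zero]

lemma GVM (a : Ideal R) (i : ℕ) (M : Type) [AddCommGroup M] [Module R M] [Module.Finite R M]
    (h : ∀ q : PrimeSpectrum R, Module.annihilator R M ≤ q.asIdeal → pd q < i) :
    Subsingleton (LH a i M) := FILT0 a i M fun q hq => GV a i q (h q hq)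

lemma GVbound (a : Ideal R) : ∃ N : ℕ, ∀ i, N ≤ i → ∀ (M : Type) [AddCommGroup M] [Module R M]
    [Module.Finite R M], Subsingleton (LH a i M) := by
  obtain ⟨N, hN⟩ : ∃ N : ℕ, ∀ q : PrimeSpectrum R, pd q < N := by
    refine ⟨(LTSeries.longestOf (PrimeSpectrum R)).length + 1, fun q => ?_⟩
    obtain ⟨s, h1, h2⟩ := Order.exists_series_of_le_coheight q (pd_coe q).le
    have := LTSeries.longestOf_is_longest s
    omega
  exact ⟨N, fun i hi M _ _ _ => GVM a i M fun q _ => (hN q).trans_le hi⟩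

lemma AA (a : Ideal R) (k : ℕ) (h : ∀ i, k ≤ i → Subsingleton (LH a i R)) (i : ℕ) (hi : k ≤ i)
    (M : Type) [AddCommGroup M] [Module R M] [Module.Finite R M] : Subsingleton (LH a i M) := by
  obtain ⟨N, hN⟩ := GVbound a
  suffices ∀ j i, k ≤ i → N ≤ i + j → ∀ (M : Type) [AddCommGroup M] [Module R M]
    [Module.Finite R M], Subsingleton (LH a i M) from this N i hi (by omega) M
  intro j
  induction j with
  | zero => intro i _ h2 M _ _ _; exact hN i h2 M
  | succ j ih =>
    intro i hi h2 M _ _ _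
    refine FILT0 a i M fun q _ => ?_
    exact (SES_sub q.asIdeal).right0 a i (h i hi) (ih (i+1) (by omega) (by omega) _)

end Dim

set_option linter.unusedSectionVars false

section Hull
variable {R : Type} [CommRing R]

lemma fg_of_complete [IsLocalRing R] [IsAdicComplete (IsLocalRing.maximalIdeal R) R] {N : Type}
    [AddCommGroup N] [Module R N] (hs : IsHausdorff (IsLocalRing.maximalIdeal R) N)
    (S : Submodule R N) (hS : S.FG)
    (h : ∀ x : N, ∃ s ∈ S, x - s ∈ (IsLocalRing.maximalIdeal R • ⊤ : Submodule R N)) :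
    Module.Finite R N := by
  set m := IsLocalRing.maximalIdeal R
  obtain ⟨n, g, hg⟩ := Submodule.fg_iff_exists_fin_generating_family.1 hS
  have hp : IsPrecomplete m (Fin n → R) := by
    rw [isPrecomplete_iff]
    intro f hf
    have key : ∀ (k : ℕ) (x : Fin n → R), x ∈ (m ^ k • ⊤ : Submodule R (Fin n → R)) ↔
        ∀ j, x j ∈ m ^ k := by
      intro k x
      constructor
      · intro hx j
        have := Submodule.mem_map_of_mem (f := LinearMap.proj (R := R) (φ := fun _ : Fin n => R) j) hx
        rw [Submodule.map_smul''] at this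
        have := Submodule.smul_mono (le_refl (m ^ k)) (le_top : _ ≤ (⊤ : Submodule R R)) this
        simpa using this
      · intro hx
        rw [pi_eq_sum_univ' x]
        exact Submodule.sum_mem _ fun i _ => Submodule.smul_mem_smul (hx i) trivial
    have hR : IsPrecomplete m R := inferInstance
    rw [isPrecomplete_iff] at hR
    have : ∀ j, ∃ L : R, ∀ k, f k j ≡ L [SMOD (m ^ k • ⊤ : Submodule R R)] := by
      intro j
      refine hR (fun k => f k j) fun {a b} hab => ?_
      have := hf hab
      rw [SModEq.sub_mem, key] at this
      rw [SModEq.sub_mem]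
      simpa using this j
    choose L hL using this
    refine ⟨L, fun k => ?_⟩
    rw [SModEq.sub_mem, key]
    intro j
    have := hL j k
    rw [SModEq.sub_mem] at this
    simpa using this
  refine Module.Finite.of_surjective (M := Fin n → R) (Fintype.linearCombination R g)
    (surjective_of_mkQ_comp_surjective (I := m) ?_)
  intro x
  obtain ⟨x, rfl⟩ := Submodule.mkQ_surjective _ x
  obtain ⟨s, hs, hx⟩ := h x
  rw [← hg, ← Fintype.range_linearCombination R] at hs
  obtain ⟨c, rfl⟩ := hs
  refine ⟨c, ?_⟩
  rw [LinearMap.comp_apply, ← sub_eq_zero, ← map_sub, ← neg_sub, map_neg]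
  rw [neg_eq_zero]
  exact (Submodule.Quotient.mk_eq_zero _).2 hx

/-- `K` is essential in `E` -/
def Ess {J : Type} [AddCommGroup J] [Module R J] (K E : Submodule R J) : Prop :=
  ∀ x ∈ E, x ≠ 0 → ∃ r : R, r • x ∈ K ∧ r • x ≠ 0

lemma exists_hull {J : Type} [AddCommGroup J] [Module R J] [hJ : Module.Injective R J]
    (K : Submodule R J) :
    ∃ E : Submodule R J, K ≤ E ∧ Ess K E ∧ Module.Injective R E := by
  obtain ⟨E, -, ⟨hKE, hE⟩, hmax⟩ := zorn_le_nonempty₀ {E : Submodule R J | K ≤ E ∧ Ess K E} (by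
    intro c hc hch y hy
    have hm : ∀ z, z ∈ sSup c ↔ ∃ y ∈ c, z ∈ y := fun z =>
      Submodule.mem_sSup_of_directed ⟨y, hy⟩ hch.directedOn
    refine ⟨sSup c, ⟨(hc hy).1.trans (le_sSup hy), ?_⟩, fun z hz => le_sSup hz⟩
    intro x hx h0
    obtain ⟨z, hz, hxz⟩ := (hm x).1 hx
    exact (hc hz).2 x hxz h0) K ⟨le_rfl, fun x hx h0 => ⟨1, by simpa using hx, by simpa using h0⟩⟩
  obtain ⟨C, -, hC, hCmax⟩ := zorn_le_nonempty₀ {C : Submodule R J | ∀ x ∈ C, x ∈ E → x = 0} (by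
    intro c hc hch y hy
    have hm : ∀ z, z ∈ sSup c ↔ ∃ y ∈ c, z ∈ y := fun z =>
      Submodule.mem_sSup_of_directed ⟨y, hy⟩ hch.directedOn
    refine ⟨sSup c, ?_, fun z hz => le_sSup hz⟩
    intro x hx h0
    obtain ⟨z, hz, hxz⟩ := (hm x).1 hx
    exact hc hz x hxz h0) ⊥ (by simp +contextual)
  have hi : Function.Injective (C.mkQ ∘ₗ E.subtype) := by
    rw [← LinearMap.ker_eq_bot, LinearMap.ker_eq_bot']
    intro x hx
    exact Subtype.ext (hC x ((Submodule.Quotient.mk_eq_zero _).1 hx) x.2)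
  -- E is essential in J/C
  have hess : ∀ x : J, x ∉ C → ∃ (r : R) (e : J), e ∈ E ∧ e ≠ 0 ∧ r • x - e ∈ C := by
    intro x hx
    have : ¬ ∀ y ∈ C ⊔ Submodule.span R {x}, y ∈ E → y = 0 := by
      intro h
      have := hCmax h le_sup_left
      exact hx (this (Submodule.mem_sup_right (Submodule.mem_span_singleton_self x)))
    push Not at this
    obtain ⟨y, hy, hyE, hy0⟩ := this
    obtain ⟨c, hc, z, hz, rfl⟩ := Submodule.mem_sup.1 hy
    obtain ⟨r, rfl⟩ := Submodule.mem_span_singleton.1 hz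
    exact ⟨r, _, hyE, hy0, by simpa using hc⟩
  obtain ⟨φ, hφ⟩ := Module.Injective.extension_property R J _ _ _ hi E.subtype
  have hφE : ∀ x ∈ E, φ (C.mkQ x) = x := fun x hx => LinearMap.congr_fun hφ ⟨x, hx⟩
  have hrange : LinearMap.range φ ≤ E := by
    refine hmax (y := LinearMap.range φ) ⟨?_, ?_⟩ ?_
    · intro x hx; exact ⟨_, hφE x (hKE hx)⟩
    · rintro _ ⟨x, rfl⟩ h0
      obtain ⟨x, rfl⟩ := Submodule.mkQ_surjective _ x
      obtain ⟨r, e, he, he0, hr⟩ := hess x (by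
        intro hx; apply h0
        rw [show C.mkQ x = 0 from (Submodule.Quotient.mk_eq_zero _).2 hx, map_zero])
      have e1 : r • φ (C.mkQ x) = e := by
        rw [← hφE e he, ← map_smul, ← map_smul, ← sub_eq_zero, ← map_sub, ← map_sub,
          show C.mkQ (r • x - e) = 0 from (Submodule.Quotient.mk_eq_zero _).2 hr, map_zero]
      obtain ⟨s, hs1, hs2⟩ := hE e he he0
      exact ⟨s * r, by rwa [mul_smul, e1], by rwa [mul_smul, e1]⟩
    · intro x hx; exact ⟨_, hφE x hx⟩
  refine ⟨E, hKE, hE, ⟨fun X Y _ _ _ _ f hf g => ?_⟩⟩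
  obtain ⟨h, hh⟩ := Module.Injective.extension_property R J _ _ f hf (E.subtype ∘ₗ g)
  refine ⟨LinearMap.codRestrict E (φ ∘ₗ C.mkQ ∘ₗ h) fun y => hrange ⟨_, rfl⟩, fun x => ?_⟩
  refine Subtype.ext ?_
  have : h (f x) = g x := LinearMap.congr_fun hh x
  simp only [LinearMap.codRestrict_apply, LinearMap.comp_apply, this]
  exact hφE _ (g x).2

variable [IsNoetherianRing R] [IsLocalRing R]

/-- properties of the injective hull of the residue field which we need -/
structure IsE (E : Type) [AddCommGroup E] [Module R E] : Prop where
  inj : Module.Injective R E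
  fin : Module.Finite R ((R ⧸ IsLocalRing.maximalIdeal R) →ₗ[R] E)
  emb : ∃ f : (R ⧸ IsLocalRing.maximalIdeal R) →ₗ[R] E, Function.Injective f

lemma exists_E : ∃ (E : Type) (_ : AddCommGroup E) (_ : Module R E), IsE (R := R) E := by
  obtain ⟨J, _, _, _, f, hf⟩ := exists_inj (R := R) (R ⧸ IsLocalRing.maximalIdeal R)
  obtain ⟨E, hE, hess, hinj⟩ := exists_hull (LinearMap.range f)
  refine ⟨E, inferInstance, inferInstance, hinj, ?_, ?_⟩
  · have hsoc : ∀ φ : (R ⧸ IsLocalRing.maximalIdeal R) →ₗ[R] E,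
        ((φ 1 : E) : J) ∈ LinearMap.range f := by
      intro φ
      by_cases h0 : ((φ 1 : E) : J) = 0
      · rw [h0]; exact Submodule.zero_mem _
      obtain ⟨r, hr, hr0⟩ := hess _ (φ 1).2 h0
      have hu : IsUnit r := by
        by_contra hu
        apply hr0
        have : r • (1 : R ⧸ IsLocalRing.maximalIdeal R) = 0 := by
          change Ideal.Quotient.mk _ (r * 1) = 0
          rw [Ideal.Quotient.eq_zero_iff_mem, mul_one]
          exact hu
        rw [← Submodule.coe_smul, ← map_smul, this, map_zero]; rfl
      exact (Submodule.smul_mem_iff_of_isUnit _ hu).1 hr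
    let ev : ((R ⧸ IsLocalRing.maximalIdeal R) →ₗ[R] E) →ₗ[R] LinearMap.range f :=
      { toFun := fun φ => ⟨_, hsoc φ⟩
        map_add' := fun _ _ => rfl
        map_smul' := fun _ _ => rfl }
    refine Module.Finite.of_injective ev ?_
    rw [← LinearMap.ker_eq_bot, LinearMap.ker_eq_bot']
    intro φ hφ
    have h1 : φ 1 = 0 := Subtype.ext (show (ev φ : J) = 0 by rw [hφ]; rfl)
    ext
    simpa using h1
  · exact ⟨LinearMap.codRestrict E f fun x => hE ⟨x, rfl⟩, fun x y h => hf (congrArg Subtype.val h)⟩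

end Hull

set_option linter.unusedSectionVars false

section Dual
variable {R : Type} [CommRing R]

lemma ext_ker {E N P : Type} [AddCommGroup E] [Module R E] [AddCommGroup N] [Module R N]
    [AddCommGroup P] [Module R P] (hE : Module.Injective R E) (h : N →ₗ[R] P) (φ : N →ₗ[R] E)
    (hk : ∀ x, h x = 0 → φ x = 0) : ∃ ψ : P →ₗ[R] E, ψ ∘ₗ h = φ := by
  have hi : Function.Injective ((LinearMap.ker h).liftQ h le_rfl) := by
    rw [← LinearMap.ker_eq_bot]; exact Submodule.ker_liftQ_eq_bot _ _ _ le_rfl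
  obtain ⟨ψ, hψ⟩ := Module.Injective.extension_property R E _ _ _ hi
    ((LinearMap.ker h).liftQ φ fun x hx => hk x hx)
  refine ⟨ψ, LinearMap.ext fun x => ?_⟩
  exact LinearMap.congr_fun hψ (Submodule.Quotient.mk x)

variable [IsNoetherianRing R]

lemma lcΓ_iff {a : Ideal R} {M : Type} [AddCommGroup M] [Module R M] {x : M} :
    x ∈ lcΓ a M ↔ ∀ y ∈ a, ∃ n : ℕ, y ^ n • x = 0 := by
  classical
  constructor
  · rintro ⟨n, hn⟩ y hy
    exact ⟨n, hn _ (Ideal.pow_mem_pow hy n)⟩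
  · intro h
    obtain ⟨s, rfl⟩ := IsNoetherian.noetherian a
    induction s using Finset.induction_on with
    | empty => exact ⟨1, by simp +contextual⟩
    | insert y s _ ih =>
      have e : Submodule.span R (↑(insert y s) : Set R) =
          Ideal.span (s : Set R) ⊔ Ideal.span {y} := by
        rw [Finset.coe_insert, sup_comm]; exact Submodule.span_insert y s
      rw [e] at h ⊢
      exact lcΓ_sup (ih fun z hz => h z (Ideal.mem_sup_left hz)) (lcΓ_span.2 (h y
        (Ideal.mem_sup_right (Ideal.mem_span_singleton_self y))))

variable [IsLocalRing R]

structure DD (R : Type) [CommRing R] [IsNoetherianRing R] [IsLocalRing R] (E : Type) [AddCommGroup E] [Module R E] (N : Type) [AddCommGroup N] [Module R N] :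
    Prop where
  tors : ∀ x : N, x ∈ lcΓ (IsLocalRing.maximalIdeal R) N
  fin : Module.Finite R (N →ₗ[R] E)

variable {E : Type} [AddCommGroup E] [Module R E]

lemma SerreC_DD (hE : IsE (R := R) E) : SerreC (R := R) (fun N _ _ => DD R E N) where
  zero N _ _ h := by
    refine ⟨fun x => ?_, ?_⟩
    · rw [Subsingleton.elim x 0]; exact Submodule.zero_mem _
    · have : Subsingleton (N →ₗ[R] E) := ⟨fun f g => LinearMap.ext fun x => by
        rw [Subsingleton.elim x 0, map_zero, map_zero]⟩
      infer_instance
  mid A B C _ _ _ _ _ _ f g hfg hA hC := by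
    refine ⟨fun x => ?_, ?_⟩
    · rw [lcΓ_iff]
      intro y hy
      obtain ⟨n, hn⟩ := lcΓ_iff.1 (hC.tors (g x)) y hy
      rw [← map_smul] at hn
      obtain ⟨z, hz⟩ := (hfg _).1 hn
      obtain ⟨k, hk⟩ := lcΓ_iff.1 (hA.tors z) y hy
      exact ⟨k + n, by rw [pow_add, mul_smul, ← hz, ← map_smul, hk, map_zero]⟩
    · have h1 := hA.fin
      have h2 := hC.fin
      have h3 : IsNoetherian R (B →ₗ[R] E) := isNoetherian_of_range_eq_ker
        (LinearMap.lcomp R E g) (LinearMap.lcomp R E f) (by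
          ext φ
          constructor
          · rintro ⟨ψ, rfl⟩
            refine LinearMap.ext fun x => ?_
            change ψ (g (f x)) = 0
            rw [(hfg _).2 ⟨x, rfl⟩, map_zero]
          · intro hφ
            obtain ⟨ψ, hψ⟩ := ext_ker hE.inj g φ fun x hx => by
              obtain ⟨z, rfl⟩ := (hfg _).1 hx
              exact LinearMap.congr_fun hφ z
            exact ⟨ψ, hψ⟩)
      infer_instance

lemma DD_k (hE : IsE (R := R) E) : DD R E (R ⧸ (IsLocalRing.maximalIdeal R)) :=
  ⟨tors_of_le (IsLocalRing.maximalIdeal R) (IsLocalRing.closedPoint R) le_rfl, hE.fin⟩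

lemma cogen (hE : IsE (R := R) E) {N : Type} [AddCommGroup N] [Module R N] {x : N} (h0 : x ≠ 0)
    (hx : x ∈ lcΓ (IsLocalRing.maximalIdeal R) N) : ∃ φ : N →ₗ[R] E, φ x ≠ 0 := by
  obtain ⟨n, hn⟩ := hx
  induction n generalizing x with
  | zero => exact absurd (by simpa using hn 1 (by simp)) h0
  | succ n ih =>
    by_cases h : ∀ r ∈ (IsLocalRing.maximalIdeal R), r • x = 0
    · let g : (R ⧸ (IsLocalRing.maximalIdeal R)) →ₗ[R] N := Submodule.liftQ (IsLocalRing.maximalIdeal R) (LinearMap.toSpanSingleton R N x) (by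
        intro r hr; exact h r hr)
      obtain ⟨f, hf⟩ := hE.emb
      obtain ⟨φ, hφ⟩ := ext_ker hE.inj g f (by
        intro z hz
        obtain ⟨b, rfl⟩ := Ideal.Quotient.mk_surjective z
        have hz : b • x = 0 := hz
        have : b ∈ (IsLocalRing.maximalIdeal R) := by
          intro hb
          exact h0 (hb.smul_eq_zero.1 hz)
        rw [Ideal.Quotient.eq_zero_iff_mem.2 this, map_zero])
      refine ⟨φ, fun e => ?_⟩
      have h1 : φ (g 1) = f 1 := LinearMap.congr_fun hφ 1
      have h2 : g 1 = x := by
        change (1 : R) • x = x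
        simp
      rw [h2, e] at h1
      have h3 := hf (h1.symm.trans (map_zero f).symm)
      exact Ideal.Quotient.zero_ne_one_iff.2 (Ideal.IsPrime.ne_top inferInstance) h3.symm
    · push Not at h
      obtain ⟨r, hr, hrx⟩ := h
      obtain ⟨φ, hφ⟩ := ih hrx fun s hs => by
        rw [← mul_smul]; exact hn _ (by rw [pow_succ]; exact Ideal.mul_mem_mul hs hr)
      exact ⟨φ, fun e => hφ (by rw [map_smul, e, smul_zero])⟩

/-- the socle -/
def soc (N : Type) [AddCommGroup N] [Module R N] : Submodule R N where
  carrier := {x | ∀ r ∈ (IsLocalRing.maximalIdeal R), r • x = 0}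
  add_mem' h1 h2 r hr := by rw [smul_add, h1 r hr, h2 r hr, add_zero]
  zero_mem' r _ := smul_zero r
  smul_mem' c x h r hr := by rw [smul_comm, h r hr, smul_zero]

variable [IsAdicComplete (IsLocalRing.maximalIdeal R) R]

lemma DD_of_soc (hE : IsE (R := R) E) {N : Type} [AddCommGroup N] [Module R N]
    (ht : ∀ x : N, x ∈ lcΓ (IsLocalRing.maximalIdeal R) N) (h : Module.Finite R (soc (R := R) N →ₗ[R] E)) : DD R E N := by
  classical
  refine ⟨ht, ?_⟩
  let ρ : (N →ₗ[R] E) →ₗ[R] (soc (R := R) N →ₗ[R] E) := LinearMap.lcomp R E (soc (R := R) N).subtype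
  have hρ : Function.Surjective ρ := fun φ =>
    ext_ker hE.inj (soc (R := R) N).subtype φ fun x hx => by
      rw [show x = 0 from Subtype.ext hx, map_zero]
  have hker : ∀ φ, ρ φ = 0 → φ ∈ ((IsLocalRing.maximalIdeal R) • ⊤ : Submodule R (N →ₗ[R] E)) := by
    intro φ hφ
    obtain ⟨n, g, hg⟩ := Submodule.fg_iff_exists_fin_generating_family.1 (IsNoetherian.noetherian (IsLocalRing.maximalIdeal R))
    obtain ⟨ψ, hψ⟩ := ext_ker hE.inj (LinearMap.pi fun j : Fin n => (g j • LinearMap.id : N →ₗ[R] N)) φ (by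
      intro x hx
      have : x ∈ soc (R := R) N := by
        intro r hr
        rw [← hg] at hr
        have h0 : Submodule.span R (Set.range g) ≤ LinearMap.ker (LinearMap.toSpanSingleton R N x) := by
          rw [Submodule.span_le]
          rintro _ ⟨j, rfl⟩
          exact congrFun hx j
        exact h0 hr
      exact LinearMap.congr_fun hφ ⟨x, this⟩)
    have : φ = ∑ j, g j • (ψ ∘ₗ LinearMap.single R (fun _ : Fin n => N) j) := by
      rw [← hψ]
      refine LinearMap.ext fun x => ?_
      rw [LinearMap.sum_apply, LinearMap.comp_apply]
      conv_lhs => rw [← Finset.univ_sum_single ((LinearMap.pi fun j : Fin n =>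
        (g j • LinearMap.id : N →ₗ[R] N)) x)]
      rw [map_sum]
      refine Finset.sum_congr rfl fun j _ => ?_
      rw [LinearMap.smul_apply, LinearMap.comp_apply, ← map_smul, ← map_smul]
      rfl
    rw [this]
    refine Submodule.sum_mem _ fun j _ => Submodule.smul_mem_smul ?_ trivial
    rw [← hg]; exact Submodule.subset_span ⟨j, rfl⟩
  obtain ⟨n, g, hg⟩ := Submodule.fg_iff_exists_fin_generating_family.1 h.fg_top
  choose l hl using fun j => hρ (g j)
  refine fg_of_complete ?_ (Submodule.span R (Set.range l)) (Submodule.fg_span (Set.finite_range l)) ?_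
  · refine ⟨fun φ hφ => LinearMap.ext fun x => ?_⟩
    obtain ⟨k, hk⟩ := ht x
    have h1 := hφ k
    rw [SModEq.zero] at h1
    refine Submodule.smul_induction_on h1 ?_ ?_
    · intro r hr ψ _
      rw [LinearMap.smul_apply, ← map_smul, hk r hr, map_zero]; rfl
    · intro a b ha hb
      rw [LinearMap.add_apply, ha, hb]; simp
  · intro φ
    have : ρ φ ∈ Submodule.map ρ (Submodule.span R (Set.range l)) := by
      rw [Submodule.map_span, ← Set.range_comp, show ⇑ρ ∘ l = g from funext hl, hg]; trivial
    obtain ⟨s, hs, e⟩ := this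
    exact ⟨s, hs, hker _ (by rw [map_sub, e, sub_self])⟩

lemma DD_of_y (hE : IsE (R := R) E) {N : Type} [AddCommGroup N] [Module R N] {y : R} (hy : y ∈ (IsLocalRing.maximalIdeal R))
    (ht : ∀ x : N, ∃ n : ℕ, y ^ n • x = 0)
    (h : DD R E (LinearMap.ker (y • LinearMap.id : N →ₗ[R] N))) : DD R E N := by
  refine DD_of_soc hE ?_ ?_
  · have key : ∀ (n : ℕ) (x : N), y ^ n • x = 0 → x ∈ lcΓ (IsLocalRing.maximalIdeal R) N := by
      intro n
      induction n with
      | zero => intro x hx; rw [show x = 0 by simpa using hx]; exact Submodule.zero_mem _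
      | succ n ih =>
        intro x hx
        have h1 := ih (y • x) (by rwa [← mul_smul, ← pow_succ])
        rw [lcΓ_iff] at h1 ⊢
        intro z hz
        obtain ⟨k, hk⟩ := h1 z hz
        have h2 := lcΓ_iff.1 (h.tors ⟨z ^ k • x, by
          change y • z ^ k • x = 0
          rw [smul_comm, hk]⟩) z hz
        obtain ⟨l, hl⟩ := h2
        have hl : z ^ l • z ^ k • x = 0 := congrArg Subtype.val hl
        exact ⟨l + k, by rw [pow_add, mul_smul, hl]⟩
    intro x
    obtain ⟨n, hn⟩ := ht x
    exact key n x hn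
  · have hle : soc (R := R) N ≤ LinearMap.ker (y • LinearMap.id : N →ₗ[R] N) := fun x hx => hx y hy
    exact ((SerreC_DD hE).sub (Submodule.inclusion hle) (Submodule.inclusion_injective hle) h).fin

lemma ART (hE : IsE (R := R) E) (a : Ideal R) (ha : a ≤ (IsLocalRing.maximalIdeal R)) (i : ℕ) : ∀ q : PrimeSpectrum R,
    (pd q ≤ i ∨ (IsLocalRing.maximalIdeal R) ≤ (a ⊔ q.asIdeal).radical) → DD R E (LH a i (R ⧸ q.asIdeal)) := by
  have H := SerreC_DD hE
  induction i with
  | zero =>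
    intro q hq
    by_cases haq : a ≤ q.asIdeal
    · have hm : q.asIdeal = (IsLocalRing.maximalIdeal R) := by
        rcases hq with hq | hq
        · exact pd_zero (by omega)
        · rw [sup_eq_right.2 haq, q.2.radical] at hq
          exact le_antisymm (IsLocalRing.le_maximalIdeal q.2.ne_top) hq
      refine H.sub _ (LHev_inj a) ?_
      rw [hm]; exact DD_k hE
    · obtain ⟨y, hya, hyq⟩ := SetLike.not_le_iff_exists.1 haq
      refine H.zero _ (sing_of_yinj y (fun x hx => ?_) (LH_ytors hya))
      refine LHev_inj a ?_
      rw [map_zero]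
      refine (ySES q hyq).inj ?_
      rw [map_zero, LinearMap.smul_apply, LinearMap.id_apply, ← map_smul, hx, map_zero]
  | succ i ih =>
    intro q hq
    by_cases haq : a ≤ q.asIdeal
    · exact H.zero _ (LH_torsion_vanish a (tors_of_le a q haq) i)
    · obtain ⟨y, hya, hyq⟩ := SetLike.not_le_iff_exists.1 haq
      have S := ySES q hyq
      have h0 := FILT H a i ((R ⧸ q.asIdeal) ⧸ (LinearMap.range (y • LinearMap.id :
        (R ⧸ q.asIdeal) →ₗ[R] (R ⧸ q.asIdeal)))) fun q' hq' => ih q' (by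
          have hlt := (yann q hyq hq').1
          rcases hq with hq | hq
          · left; have := pd_lt hlt; omega
          · right; exact hq.trans (Ideal.radical_mono (sup_le_sup_left (show q.asIdeal ≤ q'.asIdeal from hlt.le) _)))
      refine DD_of_y hE (ha hya) (LH_ytors hya) ?_
      refine H.quot (LinearMap.codRestrict _ (S.δ a i) fun x => ?_) ?_ h0
      · change y • (S.δ a i x) = 0
        rw [← LHmap_smul]
        exact (S.ex1 a i _).2 ⟨x, rfl⟩
      · rintro ⟨x, hx⟩
        have hx : y • x = 0 := hx
        rw [← LHmap_smul] at hx
        obtain ⟨z, hz⟩ := (S.ex1 a i x).1 hx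
        exact ⟨z, Subtype.ext hz⟩

end Dual

set_option linter.unusedSectionVars false

section NVsec
variable {R : Type} [CommRing R] [IsNoetherianRing R] [IsLocalRing R]

/-- prime avoidance in a local ring -/
lemma avoid (s : Finset (Ideal R)) (hs : ∀ P ∈ s, P.IsPrime ∧ P ≠ IsLocalRing.maximalIdeal R) :
    ∃ r ∈ IsLocalRing.maximalIdeal R, ∀ P ∈ s, r ∉ P := by
  by_contra h
  push Not at h
  have : ((IsLocalRing.maximalIdeal R : Ideal R) : Set R) ⊆ ⋃ i ∈ (↑s : Set (Ideal R)), (id i : Ideal R) := by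
    intro r hr
    obtain ⟨P, hP, hrP⟩ := h r hr
    exact Set.mem_biUnion (x := P) hP hrP
  obtain ⟨P, hP, hle⟩ := (Ideal.subset_union_prime (f := id) ⊤ ⊤ (fun i hi _ _ => (hs i hi).1)).1 this
  exact (hs P hP).2 (le_antisymm (IsLocalRing.le_maximalIdeal (hs P hP).1.ne_top) hle)

lemma tame (D : Type) [AddCommGroup D] [Module R D] [Module.Finite R D] (q : PrimeSpectrum R)
    (hq : q.asIdeal ≠ IsLocalRing.maximalIdeal R) :
    ∃ r ∈ IsLocalRing.maximalIdeal R, r ∉ q.asIdeal ∧ ∃ u : ℕ,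
      ∀ z ∈ IsLocalRing.maximalIdeal R ^ u, ∀ φ : D, r • φ = 0 → z • φ = 0 := by
  classical
  let s : Finset (Ideal R) := insert q.asIdeal
    ((associatedPrimes.finite R D).toFinset.erase (IsLocalRing.maximalIdeal R))
  obtain ⟨r, hr, h⟩ := avoid s (by
    intro P hP
    rcases Finset.mem_insert.1 hP with rfl | hP
    · exact ⟨q.2, hq⟩
    · rw [Finset.mem_erase, Set.Finite.mem_toFinset] at hP
      exact ⟨hP.2.isPrime, hP.1⟩)
  refine ⟨r, hr, h _ (Finset.mem_insert_self _ _), ?_⟩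
  let K := LinearMap.ker (r • LinearMap.id : D →ₗ[R] D)
  have hrK : r ∈ Module.annihilator R K := by
    rw [Module.mem_annihilator]
    intro x
    exact Subtype.ext x.2
  have hm : IsLocalRing.maximalIdeal R ≤ (Module.annihilator R K).radical := by
    rw [← Ideal.sInf_minimalPrimes]
    refine le_sInf fun P hP => ?_
    have h1 := Module.associatedPrimes.minimalPrimes_annihilator_subset_associatedPrimes R K hP
    have h2 := associatedPrimes.subset_of_injective (f := K.subtype) Subtype.val_injective h1
    by_contra hc
    refine h P (Finset.mem_insert_of_mem ?_) (hP.1.2 hrK)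
    rw [Finset.mem_erase, Set.Finite.mem_toFinset]
    exact ⟨fun e => hc e.ge, h2⟩
  obtain ⟨u, hu⟩ := Ideal.exists_pow_le_of_le_radical_of_fg hm (IsNoetherian.noetherian _)
  refine ⟨u, fun z hz φ hφ => ?_⟩
  have := Module.mem_annihilator.1 (hu hz) ⟨φ, hφ⟩
  exact congrArg Subtype.val this

/-- the projection from `A/rA` to `R/q'` -/
lemma proj_q (q q' : PrimeSpectrum R) (h : q ≤ q') (r : R) (hr : r ∈ q'.asIdeal) :
    ∃ f : ((R ⧸ q.asIdeal) ⧸ (LinearMap.range (r • LinearMap.id :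
      (R ⧸ q.asIdeal) →ₗ[R] (R ⧸ q.asIdeal)))) →ₗ[R] (R ⧸ q'.asIdeal), Function.Surjective f := by
  let g : (R ⧸ q.asIdeal) →ₗ[R] (R ⧸ q'.asIdeal) := Submodule.mapQ q.asIdeal q'.asIdeal LinearMap.id h
  refine ⟨Submodule.liftQ _ g ?_, ?_⟩
  · rintro _ ⟨x, rfl⟩
    obtain ⟨b, rfl⟩ := Ideal.Quotient.mk_surjective x
    change Ideal.Quotient.mk q'.asIdeal (r * b) = 0
    rw [Ideal.Quotient.eq_zero_iff_mem]
    exact Ideal.mul_mem_right _ _ hr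
  · intro x
    obtain ⟨b, rfl⟩ := Ideal.Quotient.mk_surjective x
    exact ⟨Submodule.Quotient.mk (Ideal.Quotient.mk q.asIdeal b), rfl⟩

lemma ann_mono {M N : Type} [AddCommGroup M] [Module R M] [AddCommGroup N] [Module R N]
    (f : N →ₗ[R] M) (hf : Function.Injective f) : Module.annihilator R M ≤ Module.annihilator R N :=
  f.annihilator_le_of_injective hf

lemma pow_ann (M : Type) [AddCommGroup M] [Module R M] [Module.Finite R M]
    (h : ∀ q : PrimeSpectrum R, Module.annihilator R M ≤ q.asIdeal → q.asIdeal = IsLocalRing.maximalIdeal R) :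
    ∃ u : ℕ, IsLocalRing.maximalIdeal R ^ u ≤ Module.annihilator R M := by
  refine Ideal.exists_pow_le_of_le_radical_of_fg ?_ (IsNoetherian.noetherian _)
  rw [Ideal.radical_eq_sInf]
  exact le_sInf fun P hP => (h ⟨P, hP.2⟩ hP.1).ge

lemma NV1 (a : Ideal R) (q : PrimeSpectrum R) (hq : pd q = 1) (ha : a ≤ IsLocalRing.maximalIdeal R)
    (hm : IsLocalRing.maximalIdeal R ≤ (a ⊔ q.asIdeal).radical) (t : ℕ)
    (h : ∀ r ∈ IsLocalRing.maximalIdeal R ^ t, ∀ x : LH a 1 (R ⧸ q.asIdeal), r • x = 0) : False := by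
  have hqm : ¬ IsLocalRing.maximalIdeal R ≤ q.asIdeal := by
    intro h1
    have := pd_max (le_antisymm (IsLocalRing.le_maximalIdeal q.2.ne_top) h1)
    omega
  have haq : ¬ a ≤ q.asIdeal := by
    intro h1
    rw [sup_eq_right.2 h1, q.2.radical] at hm
    exact hqm hm
  obtain ⟨r, hr, hrq⟩ := SetLike.not_le_iff_exists.1 (show ¬ IsLocalRing.maximalIdeal R ^ (t+1) ≤ q.asIdeal
    from fun h1 => hqm (q.2.le_of_pow_le h1))
  obtain ⟨y, hya, hyq⟩ := SetLike.not_le_iff_exists.1 haq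
  have hsq : r * r ∉ q.asIdeal := fun h1 => (q.2.mem_or_mem h1).elim hrq hrq
  have S := ySES q hsq
  set B := (R ⧸ q.asIdeal) ⧸ (LinearMap.range ((r * r) • LinearMap.id :
      (R ⧸ q.asIdeal) →ₗ[R] (R ⧸ q.asIdeal))) with hB
  obtain ⟨u, hu⟩ := pow_ann B fun q' hq' => pd_zero (by
    have := pd_lt (yann q hsq hq').1; omega)
  let e : B := Submodule.Quotient.mk (Ideal.Quotient.mk q.asIdeal 1)
  have he : e ∈ LinearMap.range (LHev a (M := B)) := by
    rw [LHev_range]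
    exact ⟨u, fun z hz => Module.mem_annihilator.1 (hu (Ideal.pow_right_mono ha u hz)) e⟩
  obtain ⟨ξ, hξ⟩ := he
  have h1 : S.δ a 0 (r • ξ) = 0 := by
    rw [map_smul]; exact h r (Ideal.pow_le_pow_right (Nat.le_succ t) hr) _
  obtain ⟨η, hη⟩ := (S.ex3 a 0 _).1 h1
  have h2 : LHev a η = 0 := by
    have h3 : LHev a η ∈ lcΓ a (R ⧸ q.asIdeal) := by rw [← LHev_range]; exact ⟨_, rfl⟩
    obtain ⟨n, hn⟩ := lcΓ_iff.1 h3 y hya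
    have h4 : y ^ n ∉ q.asIdeal := fun h5 => hyq (q.2.mem_of_pow_mem n h5)
    exact (ySES q h4).inj (hn.trans (map_zero _).symm)
  have h5 : r • e = 0 := by
    rw [← hξ, ← map_smul, ← hη, LHev_map, h2, map_zero]
  have h6 : Ideal.Quotient.mk q.asIdeal (r * 1) ∈ (LinearMap.range ((r * r) • LinearMap.id :
      (R ⧸ q.asIdeal) →ₗ[R] (R ⧸ q.asIdeal))) := (Submodule.Quotient.mk_eq_zero _).1 h5
  obtain ⟨b, hb⟩ := h6
  obtain ⟨b, rfl⟩ := Ideal.Quotient.mk_surjective b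
  have hb : Ideal.Quotient.mk q.asIdeal (r * r * b) = Ideal.Quotient.mk q.asIdeal (r * 1) := hb
  rw [Ideal.Quotient.eq] at hb
  have h7 : r * r * b - r * 1 = r * (r * b - 1) := by ring
  rw [h7] at hb
  rcases q.2.mem_or_mem hb with h8 | h8
  · exact hrq h8
  · have h9 : r ∈ IsLocalRing.maximalIdeal R := Ideal.pow_le_self (Nat.succ_ne_zero t) hr
    have h10 : (1 : R) ∈ IsLocalRing.maximalIdeal R := by
      have := sub_mem (Ideal.mul_mem_right b _ h9) (IsLocalRing.le_maximalIdeal q.2.ne_top h8)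
      rwa [sub_sub_cancel] at this
    exact Ideal.IsPrime.ne_top inferInstance ((Ideal.eq_top_iff_one _).2 h10)

variable [IsAdicComplete (IsLocalRing.maximalIdeal R) R]
variable {E : Type} [AddCommGroup E] [Module R E]

lemma NV (hE : IsE (R := R) E) (a : Ideal R) (ha : a ≤ IsLocalRing.maximalIdeal R) (n : ℕ) :
    ∀ q : PrimeSpectrum R, pd q = n + 1 → 
    IsLocalRing.maximalIdeal R ≤ (a ⊔ q.asIdeal).radical → ∀ t : ℕ,
    (∀ r ∈ IsLocalRing.maximalIdeal R ^ t, ∀ x : LH a (n+1) (R ⧸ q.asIdeal), r • x = 0) → False := by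
  induction n with
  | zero => intro q hq hm t; exact NV1 a q hq ha hm t
  | succ n ih =>
    intro q hq hm t h
    have hD := ART hE a ha (n+1) q (Or.inr hm)
    have hDfin := hD.fin
    obtain ⟨r, hrm, hrq, u, hu⟩ := tame (LH a (n+1) (R ⧸ q.asIdeal) →ₗ[R] E) q (by
      intro h1; have := pd_max h1; omega)
    have S := ySES q hrq
    set B := (R ⧸ q.asIdeal) ⧸ (LinearMap.range (r • LinearMap.id :
      (R ⧸ q.asIdeal) →ₗ[R] (R ⧸ q.asIdeal))) with hB
    -- `m^u` kills the cokernel of `r`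
    have h1 : ∀ z ∈ IsLocalRing.maximalIdeal R ^ u, ∀ x : LH a (n+1) (R ⧸ q.asIdeal),
        ∃ x', z • x = r • x' := by
      intro z hz x
      let T := LinearMap.range (r • LinearMap.id : LH a (n+1) (R ⧸ q.asIdeal) →ₗ[R] _)
      by_contra hc
      have h0 : T.mkQ (z • x) ≠ 0 := by
        intro h0
        obtain ⟨x', hx'⟩ := (Submodule.Quotient.mk_eq_zero _).1 h0
        exact hc ⟨x', hx'.symm⟩
      obtain ⟨φ, hφ⟩ := cogen hE h0
        (((SerreC_DD hE).quot T.mkQ (Submodule.mkQ_surjective _) hD).tors _)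
      have h2 := hu z hz (φ ∘ₗ T.mkQ) (by
        refine LinearMap.ext fun w => ?_
        rw [LinearMap.smul_apply, ← map_smul, LinearMap.comp_apply,
          show T.mkQ (r • w) = 0 from (Submodule.Quotient.mk_eq_zero _).2 ⟨w, rfl⟩, map_zero]
        rfl)
      apply hφ
      have h3 := LinearMap.congr_fun h2 x
      rw [LinearMap.smul_apply, ← map_smul] at h3
      exact h3
    have h2 : ∀ z ∈ IsLocalRing.maximalIdeal R ^ u, ∀ v ∈ IsLocalRing.maximalIdeal R ^ t,
        ∀ w : LH a (n+1) B, (z * v) • w = 0 := by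
      intro z hz v hv w
      have h3 : S.δ a (n+1) (v • w) = 0 := by rw [map_smul]; exact h v hv _
      obtain ⟨x, hx⟩ := (S.ex3 a (n+1) _).1 h3
      obtain ⟨x', hx'⟩ := h1 z hz x
      rw [mul_smul, ← hx, ← map_smul, hx', ← LHmap_smul]
      exact (S.ex2 a (n+1) _).2 ⟨x', rfl⟩
    have h3 : ∀ z ∈ IsLocalRing.maximalIdeal R ^ (u + t), ∀ w : LH a (n+1) B, z • w = 0 := by
      intro z hz w
      rw [pow_add] at hz
      refine Submodule.mul_induction_on hz (fun z hz v hv => h2 z hz v hv w) ?_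
      intro x y hx hy
      rw [add_smul, hx, hy, add_zero]
    obtain ⟨q', hqq', hrq', hpd⟩ := KRULL q r hrm
    have hlt : q < q' := lt_of_le_of_ne hqq' fun e => hrq (e ▸ hrq')
    have hpd' := pd_lt hlt
    obtain ⟨f, hf⟩ := proj_q q q' hqq' r hrq'
    refine ih q' (by omega) (hm.trans (Ideal.radical_mono (sup_le_sup_left hqq' _))) (u + t)
      fun z hz x => ?_
    have S' := SES_ker f hf
    have h4 : Subsingleton (LH a (n+2) (LinearMap.ker f)) := by
      refine GVM a (n+2) _ fun q'' hq'' => ?_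
      have := pd_lt (yann q hrq ((ann_mono (LinearMap.ker f).subtype Subtype.val_injective).trans hq'')).1
      omega
    obtain ⟨w, rfl⟩ := (S'.ex3 a (n+1) x).1 (Subsingleton.elim _ _)
    rw [← map_smul, h3 z hz, map_zero]

end NVsec

set_option linter.unusedSectionVars false

section HLVTsec
variable {R : Type} [CommRing R] [IsNoetherianRing R]

lemma choose_z (I Q : Ideal R) (hQ : Q.IsPrime) : ∃ z, z ∉ Q ∧ ∀ q' : Ideal R, q'.IsPrime →
    (∀ r, r * z ∈ I → r ∈ q') → ∃ P ∈ I.minimalPrimes, P ≤ q' ∧ P ≤ Q := by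
  classical
  let s := (Ideal.finite_minimalPrimes_of_isNoetherianRing R I).toFinset
  have hs : ∀ P, P ∈ s ↔ P ∈ I.minimalPrimes := fun P => Set.Finite.mem_toFinset _
  let K := ∏ P ∈ s.filter (fun P => ¬ P ≤ Q), P
  let L := ∏ P ∈ s.filter (fun P => P ≤ Q), P
  have hKL : K * L ≤ I.radical := by
    have : K * L = ∏ P ∈ s, P := by
      rw [mul_comm]; exact Finset.prod_filter_mul_prod_filter_not s (fun P => P ≤ Q) (fun P => P)
    rw [this, ← Ideal.sInf_minimalPrimes]
    refine le_sInf fun P hP => ?_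
    exact Ideal.prod_le_inf.trans (Finset.inf_le (f := fun P : Ideal R => P) ((hs P).2 hP))
  obtain ⟨N, hN⟩ := Ideal.exists_pow_le_of_le_radical_of_fg hKL (IsNoetherian.noetherian _)
  have hK : ¬ K ^ N ≤ Q := by
    intro h
    have h1 : K ≤ Q := hQ.le_of_pow_le h
    obtain ⟨P, hP, hPQ⟩ := (Ideal.IsPrime.prod_le hQ).1 h1
    exact (Finset.mem_filter.1 hP).2 hPQ
  obtain ⟨z, hz, hzQ⟩ := SetLike.not_le_iff_exists.1 hK
  refine ⟨z, hzQ, fun q' hq' h => ?_⟩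
  have hL : L ^ N ≤ q' := by
    intro r hr
    refine h r (hN ?_)
    rw [mul_pow, mul_comm r z]
    exact Ideal.mul_mem_mul hz hr
  obtain ⟨P, hP, hPq⟩ := (Ideal.IsPrime.prod_le hq').1 (hq'.le_of_pow_le hL)
  rw [Finset.mem_filter, hs] at hP
  exact ⟨P, hP.1, hPq, hP.2⟩

variable [IsLocalRing R] [IsAdicComplete (IsLocalRing.maximalIdeal R) R]
variable {E : Type} [AddCommGroup E] [Module R E]

/-- the Cayley-Hamilton trick -/
lemma CH {T : Type} [AddCommGroup T] [Module R T] (hfin : Module.Finite R (T →ₗ[R] E))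
    (w : T →ₗ[R] T) (y z : R) (hw : ∀ x, y • w x = z • x) :
    ∃ (d : ℕ) (b : R), ∀ φ : T →ₗ[R] E, (z ^ d + b * y) • φ = 0 := by
  let W : (T →ₗ[R] E) →ₗ[R] (T →ₗ[R] E) := LinearMap.lcomp R E w
  have hW : ∀ φ, y • W φ = z • φ := fun φ => LinearMap.ext fun x => by
    change y • φ (w x) = z • φ x
    rw [← map_smul, hw, map_smul]
  have hWi : ∀ (i : ℕ) φ, y ^ i • (W ^ i) φ = z ^ i • φ := by
    intro i
    induction i with
    | zero => intro φ; simp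
    | succ i ih =>
      intro φ
      rw [pow_succ W, Module.End.mul_apply, pow_succ y, mul_comm, mul_smul, ih, smul_comm, hW,
        ← mul_smul, ← pow_succ]
  obtain ⟨f, hf, h⟩ := LinearMap.exists_monic_and_aeval_eq_zero R W
  refine ⟨f.natDegree, ∑ i ∈ Finset.range f.natDegree, f.coeff i * y ^ (f.natDegree - i - 1) * z ^ i,
    fun φ => ?_⟩
  have h1 : y ^ f.natDegree • (Polynomial.aeval W f) φ = 0 := by rw [h]; simp
  rw [Polynomial.aeval_eq_sum_range, LinearMap.sum_apply, Finset.smul_sum,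
    Finset.sum_range_succ] at h1
  rw [add_smul, Finset.sum_mul, Finset.sum_smul, add_comm, ← h1]
  congr 1
  · refine Finset.sum_congr rfl fun i hi => ?_
    have hi := Finset.mem_range.1 hi
    have e : y ^ f.natDegree = y ^ (f.natDegree - i - 1) * y * y ^ i := by
      rw [← pow_succ, ← pow_add]; congr 1; omega
    rw [LinearMap.smul_apply, smul_comm, e, mul_smul (_ * y), hWi, ← mul_smul, ← mul_smul]
    congr 1; ring
  · rw [LinearMap.smul_apply, smul_comm, hWi, hf.coeff_natDegree, one_smul]

lemma HLVT (hE : IsE (R := R) E) (a : Ideal R) (Q : PrimeSpectrum R) (haQ : a ≤ Q.asIdeal)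
    (hQ : Q.asIdeal ≠ IsLocalRing.maximalIdeal R) (n : ℕ) : ∀ p : PrimeSpectrum R, p ≤ Q → pd p ≤ n →
    Subsingleton (LH a n (R ⧸ p.asIdeal)) := by
  induction n with
  | zero =>
    intro p hp hpd
    have h1 : p.asIdeal ≤ Q.asIdeal := hp
    rw [pd_zero (q := p) (by omega)] at h1
    exact absurd (le_antisymm (IsLocalRing.le_maximalIdeal Q.2.ne_top) h1) hQ
  | succ n ih =>
    intro p hp hpd
    by_cases hap : a ≤ p.asIdeal
    · exact LH_torsion_vanish a (tors_of_le a p hap) n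
    obtain ⟨y, hya, hyp⟩ := SetLike.not_le_iff_exists.1 hap
    obtain ⟨z, hzQ, hz⟩ := choose_z (p.asIdeal ⊔ Ideal.span {y}) Q.asIdeal Q.2
    set A := R ⧸ p.asIdeal with hA
    let J : Submodule R A := LinearMap.range (y • LinearMap.id : A →ₗ[R] A) ⊔
      LinearMap.range (z • LinearMap.id : A →ₗ[R] A)
    let yJ : A →ₗ[R] J := LinearMap.codRestrict J (y • LinearMap.id) fun x =>
      Submodule.mem_sup_left ⟨x, rfl⟩
    let zJ : A →ₗ[R] J := LinearMap.codRestrict J (z • LinearMap.id) fun x =>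
      Submodule.mem_sup_right ⟨x, rfl⟩
    have hyJ : Function.Injective yJ := fun u v h => (ySES p hyp).inj (congrArg Subtype.val h)
    have S := SES_quot yJ hyJ
    have hC : ∀ q' : PrimeSpectrum R, Module.annihilator R (J ⧸ LinearMap.range yJ) ≤ q'.asIdeal →
        p < q' ∧ (pd q' = n → q' ≤ Q) := by
      intro q' hq'
      have h1 : ∀ r, r * z ∈ p.asIdeal ⊔ Ideal.span {y} → r ∈ q'.asIdeal := by
        intro r hr
        obtain ⟨s, hs, t, ht, e⟩ := Submodule.mem_sup.1 hr
        obtain ⟨b, rfl⟩ := Ideal.mem_span_singleton'.1 ht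
        refine hq' (Module.mem_annihilator.2 fun m => ?_)
        obtain ⟨m, rfl⟩ := Submodule.mkQ_surjective _ m
        obtain ⟨m, hm⟩ := m
        obtain ⟨_, ⟨α, rfl⟩, _, ⟨β, rfl⟩, e'⟩ := Submodule.mem_sup.1 hm
        rw [← map_smul]
        refine (Submodule.Quotient.mk_eq_zero _).2 ⟨r • α + b • β, Subtype.ext ?_⟩
        change y • (r • α + b • β) = r • m
        rw [← e']
        change y • (r • α + b • β) = r • (y • α + z • β)
        have h2 : (r * z) • β = (b * y) • β := by
          rw [← e, add_smul]
          obtain ⟨β, rfl⟩ := Ideal.Quotient.mk_surjective β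
          have : s • (Ideal.Quotient.mk p.asIdeal β) = 0 := by
            change Ideal.Quotient.mk p.asIdeal (s * β) = 0
            rw [Ideal.Quotient.eq_zero_iff_mem]
            exact Ideal.mul_mem_right _ _ hs
          rw [this, zero_add]
        rw [smul_add, smul_add, smul_smul r z, h2, smul_smul, smul_smul, smul_smul, mul_comm y r,
          mul_comm y b]
      have hp' : p ≤ q' := fun r hr => h1 r (Ideal.mem_sup_left (Ideal.mul_mem_right _ _ hr))
      have hy' : y ∈ q'.asIdeal := h1 y (Ideal.mem_sup_right
        (Ideal.mul_mem_right _ _ (Ideal.mem_span_singleton_self y)))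
      have hlt : p < q' := lt_of_le_of_ne hp' fun e => hyp (e ▸ hy')
      refine ⟨hlt, fun hn => ?_⟩
      obtain ⟨P, hP, hPq, hPQ⟩ := hz q'.asIdeal q'.2 h1
      let P' : PrimeSpectrum R := ⟨P, hP.1.1⟩
      have h3 : p < P' := by
        refine lt_of_le_of_ne (fun r hr => hP.1.2 (Ideal.mem_sup_left hr)) fun e => hyp ?_
        rw [e]; exact hP.1.2 (Ideal.mem_sup_right (Ideal.mem_span_singleton_self y))
      have h4 := pd_lt h3
      have h5 : P' = q' := pd_eq hPq (by omega)
      rw [← h5]; exact hPQ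
    have hC0 : Subsingleton (LH a n (J ⧸ LinearMap.range yJ)) := by
      refine FILT0 a n _ fun q' hq' => ?_
      obtain ⟨h1, h2⟩ := hC q' hq'
      have := pd_lt h1
      rcases lt_or_eq_of_le (show pd q' ≤ n by omega) with h3 | h3
      · exact GV a n q' h3
      · exact ih q' (h2 h3) h3.le
    have hC1 : Subsingleton (LH a (n+1) (J ⧸ LinearMap.range yJ)) := by
      refine GVM a (n+1) _ fun q' hq' => ?_
      have := pd_lt (hC q' hq').1
      omega
    have hbij : Function.Bijective (LHmap a (n+1) yJ) := by
      constructor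
      · rw [← LinearMap.ker_eq_bot, LinearMap.ker_eq_bot']
        intro x hx
        obtain ⟨c, rfl⟩ := (S.ex1 a n x).1 hx
        rw [Subsingleton.elim c 0, map_zero]
      · intro x
        exact (S.ex2 a (n+1) x).1 (Subsingleton.elim _ _)
    let e := LinearEquiv.ofBijective _ hbij
    let w : LH a (n+1) A →ₗ[R] LH a (n+1) A := e.symm.toLinearMap ∘ₗ LHmap a (n+1) zJ
    have hw : ∀ x, y • w x = z • x := by
      intro x
      have h1 : LHmap a (n+1) yJ (w x) = LHmap a (n+1) zJ x := e.apply_symm_apply _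
      rw [← LHmap_smul, ← LHmap_smul]
      have h2 := congrArg (LHmap a (n+1) J.subtype) h1
      rw [LHmap_comp, LHmap_comp] at h2
      exact h2
    have hD := ART hE a (haQ.trans (IsLocalRing.le_maximalIdeal Q.2.ne_top)) (n+1) p (Or.inl hpd)
    obtain ⟨d, b, hb⟩ := CH hD.fin w y z hw
    have hdiv : ∀ c, c ∉ p.asIdeal → ∀ φ : LH a (n+1) A →ₗ[R] E, c • φ = 0 → φ = 0 := by
      intro c hc φ hφ
      have S' := ySES p hc
      have h0 := GVM a (n+1) _ fun q' hq' => (pd_lt (yann p hc hq').1).trans_le hpd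
      refine LinearMap.ext fun x => ?_
      obtain ⟨x', rfl⟩ := (S'.ex2 a (n+1) x).1 (Subsingleton.elim _ _)
      rw [LHmap_smul, map_smul]
      exact LinearMap.congr_fun hφ x'
    by_contra hT
    rw [not_subsingleton_iff_nontrivial] at hT
    obtain ⟨x, hx⟩ := exists_ne (0 : LH a (n+1) A)
    obtain ⟨φ, hφ⟩ := cogen hE hx (hD.tors x)
    have hmem : z ^ d + b * y ∈ p.asIdeal := by
      by_contra hc
      apply hφ
      rw [hdiv _ hc φ (hb φ)]; rfl
    apply hzQ
    refine Q.2.mem_of_pow_mem d ?_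
    have := sub_mem (hp hmem) (Ideal.mul_mem_left _ b (haQ hya))
    simpa using this

end HLVTsec

set_option linter.unusedSectionVars false

section MVsec
variable {R : Type} [CommRing R] [IsNoetherianRing R]

lemma lcΓ_rad {c d : Ideal R} (h : c ≤ d.radical) {M : Type} [AddCommGroup M] [Module R M]
    {x : M} (hx : x ∈ lcΓ d M) : x ∈ lcΓ c M := by
  rw [lcΓ_iff] at hx ⊢
  intro y hy
  obtain ⟨k, hk⟩ := h hy
  obtain ⟨n, hn⟩ := hx _ hk
  exact ⟨k * n, by rw [pow_mul, hn]⟩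

lemma MV_split (a b : Ideal R) {J : Type} [AddCommGroup J] [Module R J] (hJ : Module.Injective R J)
    {t : J} (ht : t ∈ lcΓ (a ⊓ b) J) : ∃ t1 ∈ lcΓ a J, ∃ t2 ∈ lcΓ b J, t = t1 + t2 := by
  obtain ⟨n, hn⟩ := ht
  obtain ⟨k, hk⟩ := Ideal.exists_pow_inf_eq_pow_smul a (b ^ n : Ideal R)
  have h1 : ∀ r ∈ a ^ (n + k), r ∈ b ^ n → r • t = 0 := by
    intro r hra hrb
    refine hn r ?_
    have h2 : r ∈ (a ^ (n + k) • ⊤ ⊓ b ^ n : Ideal R) := by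
      refine ⟨?_, hrb⟩
      simpa using hra
    rw [hk (n + k) (by omega), Nat.add_sub_cancel] at h2
    have h3 : a ^ n • (a ^ k • ⊤ ⊓ b ^ n) ≤ a ^ n * b ^ n := by
      rw [smul_eq_mul]
      exact Ideal.mul_mono_right inf_le_right
    have h4 := h3 h2
    rw [← mul_pow] at h4
    exact Ideal.pow_right_mono Ideal.mul_le_inf n h4
  let h : R →ₗ[R] (R ⧸ a ^ (n + k)) × (R ⧸ b ^ n) :=
    LinearMap.prod (Submodule.mkQ _) (Submodule.mkQ _)
  obtain ⟨ψ, hψ⟩ := ext_ker hJ h (LinearMap.toSpanSingleton R J t) (by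
    intro r hr
    have e1 : (Submodule.mkQ (a ^ (n + k)) r) = 0 := congrArg Prod.fst hr
    have e2 : (Submodule.mkQ (b ^ n) r) = 0 := congrArg Prod.snd hr
    exact h1 r ((Submodule.Quotient.mk_eq_zero _).1 e1) ((Submodule.Quotient.mk_eq_zero _).1 e2))
  refine ⟨ψ (Submodule.mkQ _ 1, 0), ⟨n + k, fun r hr => ?_⟩,
    ψ (0, Submodule.mkQ _ 1), ⟨n, fun r hr => ?_⟩, ?_⟩
  · rw [← map_smul, Prod.smul_mk, smul_zero, ← map_smul, smul_eq_mul, mul_one,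
      show Submodule.mkQ (a ^ (n + k)) r = 0 from (Submodule.Quotient.mk_eq_zero _).2 hr]
    exact map_zero ψ
  · rw [← map_smul, Prod.smul_mk, smul_zero, ← map_smul, smul_eq_mul, mul_one,
      show Submodule.mkQ (b ^ n) r = 0 from (Submodule.Quotient.mk_eq_zero _).2 hr]
    exact map_zero ψ
  · rw [← map_add, Prod.mk_add_mk, add_zero, zero_add]
    have := LinearMap.congr_fun hψ 1
    rw [LinearMap.toSpanSingleton_apply, one_smul] at this
    exact this.symm

lemma MV (a b c : Ideal R) (hc : c.radical = (a ⊓ b).radical) (n : ℕ) :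
    ∀ (M : Type) [AddCommGroup M] [Module R M], Subsingleton (LH c (n+1) M) →
    Subsingleton (LH a (n+2) M) → Subsingleton (LH b (n+2) M) →
    Subsingleton (LH (a ⊔ b) (n+2) M) := by
  induction n with
  | zero =>
    intro M _ _ h1 h2 h3
    obtain ⟨J0, _, _, hJ0, C, _, _, f0, g0, S0⟩ := exists_ses (R := R) M
    obtain ⟨J, _, _, hJ, C', _, _, f, g, S⟩ := exists_ses (R := R) C
    rw [S0.shift, S.one_iff] at h2 h3 ⊢
    rw [S0.one_iff] at h1
    intro x hx
    obtain ⟨u, hu, hux⟩ := h2 x (lcΓ_anti le_sup_left hx)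
    obtain ⟨v, hv, hvx⟩ := h3 x (lcΓ_anti le_sup_right hx)
    obtain ⟨w, hw⟩ := (S.ex (u - v)).1 (by rw [map_sub, hux, hvx, sub_self])
    have hwc : w ∈ lcΓ c C := by
      refine lcΓ_inj c S.inj ?_
      rw [hw]
      refine lcΓ_rad (d := a ⊓ b) (hc ▸ Ideal.le_radical) ?_
      exact sub_mem (lcΓ_anti inf_le_left hu) (lcΓ_anti inf_le_right hv)
    obtain ⟨t, ht, htw⟩ := h1 w hwc
    obtain ⟨t1, ht1, t2, ht2, e⟩ := MV_split a b hJ0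
      (lcΓ_rad (c := a ⊓ b) (d := c) (hc ▸ Ideal.le_radical) ht)
    have key : u - f (g0 t1) = v + f (g0 t2) := by
      have : u - v = f (g0 t1) + f (g0 t2) := by
        rw [← hw, ← htw, e, map_add, map_add]
      rw [sub_eq_iff_eq_add, add_assoc, add_comm (f (g0 t2)), ← this]; abel
    refine ⟨u - f (g0 t1), lcΓ_sup ?_ ?_, ?_⟩
    · exact sub_mem hu (lcΓ_map a f (lcΓ_map a g0 ht1))
    · rw [key]
      exact add_mem hv (lcΓ_map b f (lcΓ_map b g0 ht2))
    · rw [map_sub, hux, (S.ex _).2 ⟨_, rfl⟩, sub_zero]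
  | succ n ih =>
    intro M _ _ h1 h2 h3
    obtain ⟨J0, _, _, hJ0, C, _, _, f0, g0, S0⟩ := exists_ses (R := R) M
    rw [S0.shift] at h1 h2 h3 ⊢
    exact ih C h1 h2 h3

lemma rad_eq {c d : Ideal R} (h : ∀ P : Ideal R, P.IsPrime → (c ≤ P ↔ d ≤ P)) :
    c.radical = d.radical := by
  rw [Ideal.radical_eq_sInf, Ideal.radical_eq_sInf]
  congr 1
  ext P
  exact ⟨fun ⟨h1, h2⟩ => ⟨(h P h2).1 h1, h2⟩, fun ⟨h1, h2⟩ => ⟨(h P h2).2 h1, h2⟩⟩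

lemma rad_le_iff {c d : Ideal R} (h : c.radical = d.radical) (P : Ideal R) (hP : P.IsPrime) :
    c ≤ P ↔ d ≤ P := by
  rw [← hP.radical_le_iff, h, hP.radical_le_iff]

variable [IsLocalRing R]

lemma m_le_rad (I : Ideal R) (h : ∀ q : PrimeSpectrum R, I ≤ q.asIdeal → pd q ≤ 0) :
    IsLocalRing.maximalIdeal R ≤ I.radical := by
  rw [Ideal.radical_eq_sInf]
  refine le_sInf fun P hP => ?_
  exact (pd_zero (q := ⟨P, hP.2⟩) (by have := h ⟨P, hP.2⟩ hP.1; omega)).ge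

/-- an element that cuts down the dimension -/
lemma cut (I : Ideal R) (e : ℕ) (h : ∀ q : PrimeSpectrum R, I ≤ q.asIdeal → pd q ≤ e + 1) :
    ∃ y ∈ IsLocalRing.maximalIdeal R, ∀ q : PrimeSpectrum R, I ≤ q.asIdeal → y ∈ q.asIdeal →
      pd q ≤ e := by
  classical
  obtain ⟨y, hy, hs⟩ := avoid ((Ideal.finite_minimalPrimes_of_isNoetherianRing R I).toFinset.erase
    (IsLocalRing.maximalIdeal R)) (by
    intro P hP
    rw [Finset.mem_erase, Set.Finite.mem_toFinset] at hP
    exact ⟨hP.2.1.1, hP.1⟩)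
  refine ⟨y, hy, fun q hq hyq => ?_⟩
  have := q.2
  obtain ⟨P, hP, hPq⟩ := Ideal.exists_minimalPrimes_le hq
  let P' : PrimeSpectrum R := ⟨P, hP.1.1⟩
  have hle : P' ≤ q := hPq
  by_cases hPm : P = IsLocalRing.maximalIdeal R
  · have h1 : pd P' = 0 := pd_max hPm
    have := pd_le hle
    omega
  · have h1 : y ∉ P := hs P (by rw [Finset.mem_erase, Set.Finite.mem_toFinset]; exact ⟨hPm, hP⟩)
    have h2 : P' < q := lt_of_le_of_ne hle fun e => h1 (by rw [← e] at hyq; exact hyq)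
    have := pd_lt h2
    have := h P' hP.1.2
    omega

variable [IsAdicComplete (IsLocalRing.maximalIdeal R) R]
variable {E : Type} [AddCommGroup E] [Module R E]

lemma CASE2 (hE : IsE (R := R) E) (e : ℕ) : ∀ (c : Ideal R) (k : ℕ) (q : PrimeSpectrum R),
    c ≤ IsLocalRing.maximalIdeal R → 1 ≤ k → (∀ i, k ≤ i → Subsingleton (LH c i R)) →
    (∀ Q : PrimeSpectrum R, c ⊔ q.asIdeal ≤ Q.asIdeal → pd Q ≤ e) → pd q < k + e := by
  induction e with
  | zero =>
    intro c k q hc hk h hQ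
    by_contra hlt
    obtain ⟨n, hn⟩ := Nat.exists_eq_add_of_le' (show 1 ≤ pd q by omega)
    have := AA c k h (n+1) (by omega) (R ⧸ q.asIdeal)
    exact NV hE c hc n q hn (m_le_rad _ hQ) 0 fun r _ x => Subsingleton.elim _ _
  | succ e ih =>
    intro c k q hc hk h hQ
    obtain ⟨y, hy, hy'⟩ := cut _ e hQ
    have hym : Ideal.span {y} ≤ IsLocalRing.maximalIdeal R := by
      rw [Ideal.span_singleton_le_iff_mem]; exact hy
    have := ih (c ⊔ Ideal.span {y}) (k+1) q (sup_le hc hym) (by omega)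
      (fun i hi => CC c y k hk h i hi) (fun Q hQ' => by
        have h1 : Ideal.span {y} ≤ Q.asIdeal := (le_sup_right.trans le_sup_left).trans hQ'
        rw [Ideal.span_singleton_le_iff_mem] at h1
        exact hy' Q ((sup_le_sup_right le_sup_left _).trans hQ') h1)
    omega

lemma CASE1 (hE : IsE (R := R) E) (e : ℕ) : ∀ (a b c : Ideal R) (k : ℕ) (p Qa Qb : PrimeSpectrum R),
    c.radical = (a ⊓ b).radical → 1 ≤ k → (∀ i, k ≤ i → Subsingleton (LH c i R)) →
    p ≤ Qa → a ≤ Qa.asIdeal → e < pd Qa → p ≤ Qb → b ≤ Qb.asIdeal → e < pd Qb →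
    (∀ Q : PrimeSpectrum R, a ⊔ b ⊔ p.asIdeal ≤ Q.asIdeal → pd Q ≤ e) → pd p ≤ k + e := by
  induction e with
  | zero =>
    intro a b c k p Qa Qb hc hk h hpa haQ hda hpb hbQ hdb hQ
    by_contra hlt
    obtain ⟨n, hn⟩ := Nat.exists_eq_add_of_le' (show 2 ≤ pd p by omega)
    have h0 := AA c k h (n+1) (by omega) (R ⧸ p.asIdeal)
    have h1 := HLVT hE a Qa haQ (fun e => by have := pd_max e; omega) (n+2) p hpa hn.le
    have h2 := HLVT hE b Qb hbQ (fun e => by have := pd_max e; omega) (n+2) p hpb hn.le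
    have h3 := MV a b c hc n _ h0 h1 h2
    refine NV hE (a ⊔ b) (sup_le (haQ.trans (IsLocalRing.le_maximalIdeal Qa.2.ne_top))
      (hbQ.trans (IsLocalRing.le_maximalIdeal Qb.2.ne_top))) (n+1) p hn (m_le_rad _ hQ) 0
      fun r _ x => Subsingleton.elim _ _
  | succ e ih =>
    intro a b c k p Qa Qb hc hk h hpa haQ hda hpb hbQ hdb hQ
    obtain ⟨y, hy, hy'⟩ := cut _ e hQ
    obtain ⟨Qa', hQa, hya, hda'⟩ := KRULL Qa y hy
    obtain ⟨Qb', hQb, hyb, hdb'⟩ := KRULL Qb y hy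
    have hc' : (c ⊔ Ideal.span {y}).radical =
        ((a ⊔ Ideal.span {y}) ⊓ (b ⊔ Ideal.span {y})).radical := by
      refine rad_eq fun P hP => ?_
      rw [hP.inf_le, sup_le_iff, sup_le_iff, sup_le_iff, rad_le_iff hc P hP, hP.inf_le]
      tauto
    have := ih (a ⊔ Ideal.span {y}) (b ⊔ Ideal.span {y}) (c ⊔ Ideal.span {y}) (k+1) p Qa' Qb' hc'
      (by omega) (fun i hi => CC c y k hk h i hi) (hpa.trans hQa)
      (sup_le (haQ.trans hQa) (by rw [Ideal.span_singleton_le_iff_mem]; exact hya)) (by omega)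
      (hpb.trans hQb)
      (sup_le (hbQ.trans hQb) (by rw [Ideal.span_singleton_le_iff_mem]; exact hyb)) (by omega)
      (fun Q hQ' => by
        simp only [sup_le_iff, Ideal.span_singleton_le_iff_mem] at hQ'
        refine hy' Q ?_ hQ'.1.1.2
        simp only [sup_le_iff]
        tauto)
    omega

end MVsec

set_option linter.unusedSectionVars false

section TopDimSec

lemma int_sSup_ge {s : Set ℤ} {m : ℤ} (hm : m ≤ 0) (h : ∀ d ∈ s, m ≤ d) : m ≤ sSup s := by
  by_cases hb : BddAbove s
  · rcases s.eq_empty_or_nonempty with rfl | ⟨d, hd⟩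
    · rw [Int.csSup_empty]; exact hm
    · exact (h d hd).trans (le_csSup hb hd)
  · rw [Int.csSup_of_not_bddAbove hb]; exact hm

lemma topDim_ge (T : Type) [TopologicalSpace T] : -1 ≤ topDim T := by
  refine int_sSup_ge (by norm_num) ?_
  rintro d (rfl | ⟨n, rfl, _⟩) <;> omega

variable {R : Type} [CommRing R] [IsNoetherianRing R] [IsLocalRing R]
variable {T : Type} [TopologicalSpace T] {f : T → PrimeSpectrum R}

lemma chain_le (hf : Topology.IsClosedEmbedding f) {n : ℕ} (c : Fin (n + 1) → IrreducibleCloseds T)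
    (hc : StrictMono c) : ∃ t, n ≤ pd (f t) := by
  have := hf.quasiSober
  have hg : ∀ i, ∃ t, IsGenericPoint t (c i : Set T) := fun i =>
    QuasiSober.sober (c i).isIrreducible' (c i).isClosed'
  choose t ht using hg
  have hlt : ∀ i j, i < j → pd (f (t i)) < pd (f (t j)) := by
    intro i j hij
    have h1 : c i < c j := hc hij
    have h2 : t i ∈ (c j : Set T) := h1.le (ht i).mem
    have h3 : t j ⤳ t i := by
      rw [specializes_iff_mem_closure, (ht j).def]; exact h2
    have h4 : f (t j) ≤ f (t i) := (PrimeSpectrum.le_iff_specializes _ _).2 (h3.map hf.continuous)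
    refine pd_lt (lt_of_le_of_ne h4 fun e => h1.ne ?_)
    have e' := hf.injective e
    apply SetLike.coe_injective
    rw [← (ht i).def, ← (ht j).def, e']
  have hi : ∀ (i : ℕ) (h : i < n + 1), i ≤ pd (f (t ⟨i, h⟩)) := by
    intro i
    induction i with
    | zero => intro _; omega
    | succ i ih =>
      intro h
      have h1 := ih (by omega)
      have h2 := hlt ⟨i, by omega⟩ ⟨i+1, h⟩ (Fin.mk_lt_mk.2 (by omega))
      omega
  exact ⟨_, hi n (by omega)⟩

lemma topDim_le (hf : Topology.IsClosedEmbedding f) (n : ℤ) (hn : -1 ≤ n)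
    (h : ∀ t, (pd (f t) : ℤ) ≤ n) : topDim T ≤ n := by
  refine csSup_le ⟨-1, Or.inl rfl⟩ ?_
  rintro d (rfl | ⟨m, rfl, c, hc⟩)
  · exact hn
  · obtain ⟨t, ht⟩ := chain_le hf c hc
    have := h t
    omega

lemma le_topDim (hf : Topology.IsClosedEmbedding f) (t : T) : (pd (f t) : ℤ) ≤ topDim T := by
  refine le_csSup ?_ (Or.inr ⟨pd (f t), rfl, ?_⟩)
  · refine ⟨(LTSeries.longestOf (PrimeSpectrum R)).length, ?_⟩
    rintro d (rfl | ⟨m, rfl, c, hc⟩)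
    · omega
    · obtain ⟨t, ht⟩ := chain_le hf c hc
      obtain ⟨s, h1, h2⟩ := Order.exists_series_of_le_coheight (f t) (pd_coe (f t)).le
      have := LTSeries.longestOf_is_longest s
      omega
  · obtain ⟨s, h1, h2⟩ := Order.exists_series_of_le_coheight (f t) (pd_coe (f t)).le
    rw [← h2]
    have hT : ∀ i, ∃ u, f u = s i := by
      intro i
      have h3 : f t ⤳ s i := by
        rw [← PrimeSpectrum.le_iff_specializes, ← h1]; exact LTSeries.head_le s i
      exact h3.mem_closed hf.isClosed_range ⟨t, rfl⟩
    choose u hu using hT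
    have hanti : ∀ i j, i < j → u i ⤳ u j ∧ ¬ u j ⤳ u i := by
      intro i j hij
      have h3 : s i < s j := s.strictMono hij
      rw [← hf.isInducing.specializes_iff, ← hf.isInducing.specializes_iff, hu, hu,
        ← PrimeSpectrum.le_iff_specializes, ← PrimeSpectrum.le_iff_specializes]
      exact ⟨h3.le, h3.not_ge⟩
    let c : T → IrreducibleCloseds T := fun x =>
      ⟨closure {x}, isIrreducible_singleton.closure, isClosed_closure⟩
    have hcle : ∀ x y, c x ≤ c y ↔ y ⤳ x := by
      intro x y
      rw [specializes_iff_closure_subset]; rfl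
    refine ⟨fun i => c (u i.rev), fun i j hij => ?_⟩
    obtain ⟨h3, h4⟩ := hanti j.rev i.rev (Fin.rev_lt_rev.2 hij)
    exact lt_of_le_not_ge ((hcle _ _).2 h3) fun h => h4 ((hcle _ _).1 h)

lemma topDim_lt (hf : Topology.IsClosedEmbedding f) (n : ℤ) (hn : -1 ≤ n) (h : n < topDim T) :
    ∃ t, n < (pd (f t) : ℤ) := by
  by_contra hc
  push Not at hc
  exact absurd (topDim_le hf n hn hc) (not_le.2 h)

lemma quot_emb (I : Ideal R) : Topology.IsClosedEmbedding
    (PrimeSpectrum.comap (Ideal.Quotient.mk I)) :=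
  PrimeSpectrum.isClosedEmbedding_comap_of_surjective _ _ Ideal.Quotient.mk_surjective

lemma quot_le (I : Ideal R) (Q : PrimeSpectrum R) (h : I ≤ Q.asIdeal) :
    (pd Q : ℤ) ≤ topDim (PrimeSpectrum (R ⧸ I)) := by
  have h1 : Q ∈ Set.range (PrimeSpectrum.comap (Ideal.Quotient.mk I)) := by
    rw [range_comap_of_surjective _ _ Ideal.Quotient.mk_surjective,
      Ideal.mk_ker]
    exact h
  obtain ⟨t, rfl⟩ := h1
  exact le_topDim (quot_emb I) t

lemma quot_lt (I : Ideal R) (n : ℤ) (hn : -1 ≤ n) (h : n < topDim (PrimeSpectrum (R ⧸ I))) :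
    ∃ Q : PrimeSpectrum R, I ≤ Q.asIdeal ∧ n < (pd Q : ℤ) := by
  obtain ⟨t, ht⟩ := topDim_lt (quot_emb I) n hn h
  refine ⟨_, ?_, ht⟩
  have h1 : PrimeSpectrum.comap (Ideal.Quotient.mk I) t ∈
      Set.range (PrimeSpectrum.comap (Ideal.Quotient.mk I)) := ⟨t, rfl⟩
  rw [range_comap_of_surjective _ _ Ideal.Quotient.mk_surjective,
      Ideal.mk_ker] at h1
  exact h1

lemma subDim_le (p : PrimeSpectrum R) (hp : p.asIdeal ∈ minimalPrimes R) :
    subDim (PrimeSpectrum R) ≤ pd p := by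
  have hC : closure {p} ∈ irreducibleComponents (PrimeSpectrum R) := by
    refine ⟨isIrreducible_singleton.closure, fun s hs hps => ?_⟩
    have hg := hs.isGenericPoint_genericPoint_closure
    have h1 : hs.genericPoint ⤳ p := by
      rw [specializes_iff_mem_closure, hg.def]
      exact subset_closure (hps (subset_closure rfl))
    rw [← PrimeSpectrum.le_iff_specializes] at h1
    have h2 : p ≤ hs.genericPoint := hp.2 ⟨hs.genericPoint.2, bot_le⟩ h1
    rw [le_antisymm h2 h1, hg.def]
    exact subset_closure
  have h0 : subDim (PrimeSpectrum R) ≤ topDim ↥(closure {p}) := by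
    refine csInf_le ⟨-1, ?_⟩ ⟨_, hC, rfl⟩
    rintro d ⟨C, _, rfl⟩
    exact topDim_ge _
  refine h0.trans (topDim_le
    (isClosed_closure.isClosedEmbedding_subtypeVal) _ (by omega) ?_)
  · rintro ⟨x, hx⟩
    have : p ≤ x := by
      rw [PrimeSpectrum.le_iff_specializes, specializes_iff_mem_closure]; exact hx
    exact_mod_cast pd_le this

lemma connDim_lt (Z : Set (PrimeSpectrum R)) (hZ : IsClosed Z) (hd : ¬ ConnectedSpace ↥(Zᶜ))
    (n : ℤ) (hn : -1 ≤ n) (h : n < connDim (PrimeSpectrum R)) : ∃ q ∈ Z, n < (pd q : ℤ) := by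
  have h1 : connDim (PrimeSpectrum R) ≤ topDim Z := by
    refine csInf_le ⟨-1, ?_⟩ ⟨Z, hZ, hd, rfl⟩
    rintro d ⟨C, _, _, rfl⟩
    exact topDim_ge _
  obtain ⟨t, ht⟩ := topDim_lt hZ.isClosedEmbedding_subtypeVal n hn (h.trans_le h1)
  exact ⟨t, t.2, ht⟩

end TopDimSec

/-- Let `(R, m)` be a complete noetherian local ring and let
`a, b ⊆ R` be ideals with `min { dim R/a, dim R/b } > dim R/(a + b)`.  Then
`cd(R, a ∩ b) ≥ min { c(R), sdim R − 1 } − dim R/(a + b)`. -/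
theorem stmt_5 (R : Type) [CommRing R] [IsNoetherianRing R] [IsLocalRing R]
    [IsAdicComplete (IsLocalRing.maximalIdeal R) R] (a b : Ideal R)
    (hab : min (topDim (PrimeSpectrum (R ⧸ a))) (topDim (PrimeSpectrum (R ⧸ b))) >
      topDim (PrimeSpectrum (R ⧸ (a + b)))) :
    cohDim R (a ⊓ b) R ≥
      min (ringConnDim R) (subDim (PrimeSpectrum R) - 1) -
        topDim (PrimeSpectrum (R ⧸ (a + b))) := by
  set δ := topDim (PrimeSpectrum (R ⧸ (a + b))) with hδ
  have hδ1 : -1 ≤ δ := topDim_ge _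
  obtain ⟨Qa, haQ, hda⟩ := quot_lt a δ hδ1 (lt_of_lt_of_le hab (min_le_left _ _))
  obtain ⟨Qb, hbQ, hdb⟩ := quot_lt b δ hδ1 (lt_of_lt_of_le hab (min_le_right _ _))
  have ham : a ≤ IsLocalRing.maximalIdeal R := haQ.trans (IsLocalRing.le_maximalIdeal Qa.2.ne_top)
  have hbm : b ≤ IsLocalRing.maximalIdeal R := hbQ.trans (IsLocalRing.le_maximalIdeal Qb.2.ne_top)
  have hle : ∀ Q : PrimeSpectrum R, a ≤ Q.asIdeal → b ≤ Q.asIdeal → (pd Q : ℤ) ≤ δ :=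
    fun Q h1 h2 => quot_le (a + b) Q (sup_le h1 h2)
  have hδ0 : 0 ≤ δ := by
    have := hle (IsLocalRing.closedPoint R) ham hbm
    omega
  clear_value δ
  lift δ to ℕ using hδ0 with e
  have hcd0 : 0 ≤ cohDim R (a ⊓ b) R := by
    refine int_sSup_ge le_rfl ?_
    rintro d ⟨i, rfl, _⟩
    omega
  by_contra hcon
  rw [ge_iff_le, not_le] at hcon
  obtain ⟨k, hk⟩ : ∃ k : ℕ, (k : ℤ) = min (ringConnDim R) (subDim (PrimeSpectrum R) - 1) - e :=
    ⟨_, Int.toNat_of_nonneg (hcd0.trans hcon.le)⟩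
  rw [← hk] at hcon
  have hk1 : 1 ≤ k := by omega
  have hc1 : (k : ℤ) + e ≤ connDim (PrimeSpectrum R) := by
    have := min_le_left (ringConnDim R) (subDim (PrimeSpectrum R) - 1)
    unfold ringConnDim at this hk
    omega
  have hs1 : (k : ℤ) + e + 1 ≤ subDim (PrimeSpectrum R) := by
    have := min_le_right (ringConnDim R) (subDim (PrimeSpectrum R) - 1)
    omega
  have hv : ∀ i, k ≤ i → Subsingleton (LH (a ⊓ b) i R) := by
    intro i hi
    obtain ⟨j, rfl⟩ := Nat.exists_eq_add_of_le' (hk1.trans hi)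
    rw [← cm_iff]
    by_contra hnt
    rw [not_subsingleton_iff_nontrivial] at hnt
    have : ((j + 1 : ℕ) : ℤ) ≤ cohDim R (a ⊓ b) R := by
      refine le_csSup ?_ ⟨j + 1, rfl, hnt⟩
      obtain ⟨N, hN⟩ := GVbound (a ⊓ b)
      refine ⟨N, ?_⟩
      rintro d ⟨i, rfl, hi'⟩
      by_contra hlt
      obtain ⟨l, rfl⟩ := Nat.exists_eq_add_of_le' (show 1 ≤ i by omega)
      have := hN (l + 1) (by omega) R
      rw [← cm_iff] at this
      exact not_subsingleton_iff_nontrivial.2 hi' this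
    omega
  obtain ⟨E, _, _, hE⟩ := exists_E (R := R)
  by_cases h1 : ∃ p : PrimeSpectrum R, p.asIdeal ∈ minimalPrimes R ∧
      (∃ Q : PrimeSpectrum R, p ≤ Q ∧ a ≤ Q.asIdeal ∧ e < pd Q) ∧
      (∃ Q : PrimeSpectrum R, p ≤ Q ∧ b ≤ Q.asIdeal ∧ e < pd Q)
  · obtain ⟨p, hp, ⟨Q1, h2, h3, h4⟩, ⟨Q2, h5, h6, h7⟩⟩ := h1
    have h8 := CASE1 hE e a b (a ⊓ b) k p Q1 Q2 rfl hk1 hv h2 h3 h4 h5 h6 h7 fun Q hQ => by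
      simp only [sup_le_iff] at hQ
      exact_mod_cast hle Q hQ.1.1 hQ.1.2
    have := subDim_le p hp
    omega
  · push Not at h1
    let A : Set (PrimeSpectrum R) := {p | p.asIdeal ∈ minimalPrimes R ∧
      ∀ Q : PrimeSpectrum R, p ≤ Q → a ≤ Q.asIdeal → pd Q ≤ e}
    let B : Set (PrimeSpectrum R) := {p | p.asIdeal ∈ minimalPrimes R ∧
      ∀ Q : PrimeSpectrum R, p ≤ Q → b ≤ Q.asIdeal → pd Q ≤ e}
    have hfin : ∀ S : Set (PrimeSpectrum R), (∀ p ∈ S, p.asIdeal ∈ minimalPrimes R) →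
        IsClosed (⋃ p ∈ S, closure {p}) := by
      intro S hS
      refine Set.Finite.isClosed_biUnion ?_ fun _ _ => isClosed_closure
      refine Set.Finite.of_finite_image (f := PrimeSpectrum.asIdeal)
        ((minimalPrimes.finite_of_isNoetherianRing R).subset ?_) ?_
      · rintro _ ⟨p, hp, rfl⟩; exact hS p hp
      · exact fun x _ y _ h => PrimeSpectrum.ext h
    have hmem : ∀ (S : Set (PrimeSpectrum R)) Q, Q ∈ (⋃ p ∈ S, closure {p}) ↔ ∃ p ∈ S, p ≤ Q := by
      intro S Q
      simp only [Set.mem_iUnion, exists_prop, PrimeSpectrum.le_iff_specializes,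
        specializes_iff_mem_closure]
    have hA := hfin A fun p hp => hp.1
    have hB := hfin B fun p hp => hp.1
    have hAQ := hmem A
    have hBQ := hmem B
    generalize (⋃ p ∈ A, closure {p}) = VA at hA hAQ
    generalize (⋃ p ∈ B, closure {p}) = VB at hB hBQ
    have hcov : ∀ Q, Q ∈ VA ∨ Q ∈ VB := by
      intro Q
      have := Q.2
      obtain ⟨p, hp, hpQ⟩ := Ideal.exists_minimalPrimes_le (I := ⊥) (J := Q.asIdeal) bot_le
      let p' : PrimeSpectrum R := ⟨p, hp.1.1⟩
      have hp' : p'.asIdeal ∈ minimalPrimes R := hp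
      by_cases h2 : p' ∈ A
      · exact Or.inl ((hAQ Q).2 ⟨p', h2, hpQ⟩)
      · refine Or.inr ((hBQ Q).2 ⟨p', ⟨hp', ?_⟩, hpQ⟩)
        have h3 : ∃ Q : PrimeSpectrum R, p' ≤ Q ∧ a ≤ Q.asIdeal ∧ e < pd Q := by
          by_contra h4
          push Not at h4
          exact h2 ⟨hp', h4⟩
        exact h1 p' hp' h3
    have hAd : ∀ Q ∈ VA, a ≤ Q.asIdeal → pd Q ≤ e := by
      intro Q hQ haQ
      obtain ⟨p, hp, hpQ⟩ := (hAQ Q).1 hQ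
      exact hp.2 Q hpQ haQ
    have hBd : ∀ Q ∈ VB, b ≤ Q.asIdeal → pd Q ≤ e := by
      intro Q hQ hbQ
      obtain ⟨p, hp, hpQ⟩ := (hBQ Q).1 hQ
      exact hp.2 Q hpQ hbQ
    have hdis : ¬ ConnectedSpace ↥((VA ∩ VB)ᶜ) := by
      rw [← isConnected_iff_connectedSpace]
      rintro ⟨-, hpre⟩
      have hQa : Qa ∉ VA := fun h => by have := hAd Qa h haQ; omega
      have hQb : Qb ∉ VB := fun h => by have := hBd Qb h hbQ; omega
      obtain ⟨x, -, hx1, hx2⟩ := hpre VAᶜ VBᶜ hA.isOpen_compl hB.isOpen_compl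
        (by rw [Set.compl_inter]) ⟨Qa, fun h => hQa h.1, hQa⟩ ⟨Qb, fun h => hQb h.2, hQb⟩
      rcases hcov x with h | h
      · exact hx1 h
      · exact hx2 h
    obtain ⟨q, hq, hqd⟩ := connDim_lt _ (hA.inter hB) hdis ((k : ℤ) + e - 1) (by omega) (by omega)
    have := CASE2 hE e (a ⊓ b) k q (inf_le_left.trans ham) hk1 hv fun Q hQ => by
      have hqQ : q ⤳ Q := (PrimeSpectrum.le_iff_specializes _ _).1 (le_sup_right.trans hQ)
      rcases Q.2.inf_le.1 (le_sup_left.trans hQ) with h | h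
      · exact hAd Q (hqQ.mem_closed hA hq.1) h
      · exact hBd Q (hqQ.mem_closed hB hq.2) h
    omega
end

section
/- Let k be a field, P = k[x_1, …, x_n], ω ∈ ℕ^n, and I ⊆ P an ideal. Then: (a) prime ideals ℘_1, …, ℘_s are exactly the minimal primes of I if and only if ^ω℘_1, …, ^ω℘_s are exactly the minimal primes of ^ωI; and (b) dim P[t]/^ωI = dim P/I + 1. -/
/-!
Auxiliary definitions: integer-valued topological (Krull) dimension, connectivity
dimension, subdimension, local cohomological dimension and depth.
-/

open TopologicalSpace

/-- The `ω`-degree of a polynomial: `deg_ω f = max { ω·a | x^a is a term of f }`. -/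
noncomputable def wDeg {k : Type} [Field k] {n : ℕ} (ω : Fin n → ℕ)
    (f : MvPolynomial (Fin n) k) : ℕ :=
  f.support.sup fun a => ∑ i, ω i * a i

/-- The initial form `in_ω(f)`: the sum of the terms of `f` of maximal `ω`-degree. -/
noncomputable def initialForm {k : Type} [Field k] {n : ℕ} (ω : Fin n → ℕ)
    (f : MvPolynomial (Fin n) k) : MvPolynomial (Fin n) k :=
  ∑ a ∈ f.support.filter (fun a => ∑ i, ω i * a i = wDeg ω f),
    MvPolynomial.monomial a (f.coeff a)

/-- The initial ideal `in_ω(I)` of an ideal `I`, generated by the initial forms of its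
nonzero elements. -/
noncomputable def initialIdeal {k : Type} [Field k] {n : ℕ} (ω : Fin n → ℕ)
    (I : Ideal (MvPolynomial (Fin n) k)) : Ideal (MvPolynomial (Fin n) k) :=
  Ideal.span {g | ∃ f ∈ I, f ≠ 0 ∧ g = initialForm ω f}

/-- The `ω`-homogenization `^ωf ∈ P[t]` of a polynomial `f ∈ P`, where `t` is the last
variable: `^ωf = f(x₁/t^{ω₁}, …, xₙ/t^{ωₙ}) · t^{deg_ω f}`. -/
noncomputable def wHomog {k : Type} [Field k] {n : ℕ} (ω : Fin n → ℕ)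
    (f : MvPolynomial (Fin n) k) : MvPolynomial (Fin (n + 1)) k :=
  ∑ a ∈ f.support,
    MvPolynomial.monomial (Finsupp.equivFunOnFinite.symm
      (Fin.snoc (fun i => a i) (wDeg ω f - ∑ i, ω i * a i))) (f.coeff a)

/-- The `ω`-homogenization `^ωI ⊆ P[t]` of an ideal `I ⊆ P`, generated by the
`ω`-homogenizations of its nonzero elements. -/
noncomputable def wHomogIdeal {k : Type} [Field k] {n : ℕ} (ω : Fin n → ℕ)
    (I : Ideal (MvPolynomial (Fin n) k)) : Ideal (MvPolynomial (Fin (n + 1)) k) :=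
  Ideal.span {g | ∃ f ∈ I, f ≠ 0 ∧ g = wHomog ω f}


namespace WH

variable {k : Type} [Field k] {n : ℕ}

/-- The map `x_i ↦ x_i t^{ω_i}`, `t ↦ t`. -/
noncomputable def phi (ω : Fin n → ℕ) :
    MvPolynomial (Fin (n + 1)) k →ₐ[k] Polynomial (MvPolynomial (Fin n) k) :=
  MvPolynomial.aeval (Fin.snoc (α := fun _ => Polynomial (MvPolynomial (Fin n) k))
    (fun i => Polynomial.C (MvPolynomial.X i) * Polynomial.X ^ ω i) Polynomial.X)

/-- restriction of exponents -/
noncomputable def ini (b : Fin (n + 1) →₀ ℕ) : Fin n →₀ ℕ :=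
  Finsupp.equivFunOnFinite.symm (fun i => b i.castSucc)

/-- extension of exponents -/
noncomputable def ext (ω : Fin n → ℕ) (d : ℕ) (a : Fin n →₀ ℕ) : Fin (n + 1) →₀ ℕ :=
  Finsupp.equivFunOnFinite.symm (Fin.snoc (fun i => a i) (d - ∑ i, ω i * a i))

/-- total degree -/
def dg (ω : Fin n → ℕ) (b : Fin (n + 1) →₀ ℕ) : ℕ :=
  ∑ i, ω i * b (Fin.castSucc i) + b (Fin.last n)

lemma phi_monomial (ω : Fin n → ℕ) (b : Fin (n + 1) →₀ ℕ) (c : k) :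
    phi ω (MvPolynomial.monomial b c) =
      Polynomial.monomial (dg ω b) (MvPolynomial.monomial (ini b) c) := by
  rw [phi, MvPolynomial.aeval_monomial, Finsupp.prod_fintype _ _ (by simp), Fin.prod_univ_castSucc]
  simp only [Fin.snoc_castSucc, Fin.snoc_last, mul_pow, Finset.prod_mul_distrib, ← pow_mul,
    Finset.prod_pow_eq_pow_sum]
  rw [← Polynomial.C_mul_X_pow_eq_monomial, dg, pow_add, MvPolynomial.monomial_eq,
    Finsupp.prod_fintype _ _ (by simp)]
  simp only [map_mul, map_prod, map_pow, ini, Finsupp.equivFunOnFinite_symm_apply_apply]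
  rw [IsScalarTower.algebraMap_apply k (MvPolynomial (Fin n) k)]
  simp only [Polynomial.algebraMap_eq, MvPolynomial.algebraMap_eq]
  ring

lemma ini_ext (ω : Fin n → ℕ) (d : ℕ) (a : Fin n →₀ ℕ) : ini (ext ω d a) = a := by
  ext i
  simp [ini, ext]

lemma dg_ext (ω : Fin n → ℕ) (d : ℕ) (a : Fin n →₀ ℕ) (h : ∑ i, ω i * a i ≤ d) :
    dg ω (ext ω d a) = d := by
  simp [dg, ext]
  omega

lemma ext_ini (ω : Fin n → ℕ) (b : Fin (n + 1) →₀ ℕ) : ext ω (dg ω b) (ini b) = b := by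
  ext i
  refine Fin.lastCases ?_ (fun j => ?_) i
  · simp [ext, ini, dg]
  · simp [ext, ini]

/-- The linear homogenization in degree `d`. -/
noncomputable def hom (ω : Fin n → ℕ) (d : ℕ) :
    MvPolynomial (Fin n) k →ₗ[k] MvPolynomial (Fin (n + 1)) k :=
  (MvPolynomial.basisMonomials (Fin n) k).constr k
    (fun a => MvPolynomial.monomial (ext ω d a) (1 : k))

lemma hom_monomial (ω : Fin n → ℕ) (d : ℕ) (a : Fin n →₀ ℕ) (c : k) :
    hom ω d (MvPolynomial.monomial a c) = MvPolynomial.monomial (ext ω d a) c := by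
  have h : MvPolynomial.monomial a c = c • (MvPolynomial.basisMonomials (Fin n) k a) := by
    simp [MvPolynomial.smul_monomial]
  rw [h, map_smul, hom, Module.Basis.constr_basis]
  simp [MvPolynomial.smul_monomial]

lemma hom_eq_sum (ω : Fin n → ℕ) (d : ℕ) (f : MvPolynomial (Fin n) k) :
    hom ω d f = ∑ a ∈ f.support, MvPolynomial.monomial (ext ω d a) (f.coeff a) := by
  conv_lhs => rw [f.as_sum]
  simp only [map_sum, hom_monomial]

lemma wHomog_eq (ω : Fin n → ℕ) (f : MvPolynomial (Fin n) k) :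
    wHomog ω f = hom ω (wDeg ω f) f := by
  rw [hom_eq_sum]; rfl

lemma le_wDeg (ω : Fin n → ℕ) (f : MvPolynomial (Fin n) k) {a} (ha : a ∈ f.support) :
    ∑ i, ω i * a i ≤ wDeg ω f :=
  Finset.le_sup (f := fun a : Fin n →₀ ℕ => ∑ i, ω i * a i) ha

lemma phi_hom (ω : Fin n → ℕ) (f : MvPolynomial (Fin n) k) {d : ℕ} (h : wDeg ω f ≤ d) :
    phi ω (hom ω d f) = Polynomial.monomial d f := by
  rw [hom_eq_sum]
  conv_rhs => rw [f.as_sum]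
  rw [map_sum, map_sum]
  refine Finset.sum_congr rfl fun a ha => ?_
  rw [phi_monomial, ini_ext, dg_ext _ _ _ ((le_wDeg ω f ha).trans h)]

lemma phi_wHomog (ω : Fin n → ℕ) (f : MvPolynomial (Fin n) k) :
    phi ω (wHomog ω f) = Polynomial.monomial (wDeg ω f) f := by
  rw [wHomog_eq, phi_hom _ _ le_rfl]

lemma phi_last (ω : Fin n → ℕ) :
    phi ω (MvPolynomial.X (Fin.last n) : MvPolynomial (Fin (n + 1)) k) = Polynomial.X := by
  simp [phi]

lemma hom_eq_mul (ω : Fin n → ℕ) (f : MvPolynomial (Fin n) k) {d : ℕ} (h : wDeg ω f ≤ d) :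
    hom ω d f = MvPolynomial.X (Fin.last n) ^ (d - wDeg ω f) * wHomog ω f := by
  rw [wHomog_eq, hom_eq_sum, hom_eq_sum, Finset.mul_sum]
  refine Finset.sum_congr rfl fun a ha => ?_
  rw [MvPolynomial.X_pow_eq_monomial, MvPolynomial.monomial_mul, one_mul]
  have := le_wDeg ω f ha
  congr 2
  refine Finsupp.ext fun i => ?_
  refine Fin.lastCases ?_ (fun j => ?_) i
  · simp [ext]; omega
  · simp [ext, Fin.castSucc_ne_last]

lemma hom_mem (ω : Fin n → ℕ) {I : Ideal (MvPolynomial (Fin n) k)} {f : MvPolynomial (Fin n) k}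
    (hf : f ∈ I) {d : ℕ} (h : wDeg ω f ≤ d) : hom ω d f ∈ wHomogIdeal ω I := by
  by_cases h0 : f = 0
  · simp [h0]
  rw [hom_eq_mul _ _ h]
  exact Ideal.mul_mem_left _ _ (Ideal.subset_span ⟨f, hf, h0, rfl⟩)

lemma wHomogIdeal_eq (ω : Fin n → ℕ) (I : Ideal (MvPolynomial (Fin n) k)) :
    wHomogIdeal ω I = (I.map (Polynomial.C : _ →+* Polynomial (MvPolynomial (Fin n) k))).comap
      (phi ω) := by
  apply le_antisymm
  · rw [wHomogIdeal, Ideal.span_le]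
    rintro _ ⟨f, hf, -, rfl⟩
    simp only [SetLike.mem_coe, Ideal.mem_comap, phi_wHomog, Ideal.mem_map_C_iff,
      Polynomial.coeff_monomial]
    intro m
    split_ifs
    exacts [hf, I.zero_mem]
  · intro g hg
    rw [Ideal.mem_comap, Ideal.mem_map_C_iff] at hg
    rw [g.as_sum, ← Finset.sum_fiberwise_of_maps_to (g := dg ω) (t := g.support.image (dg ω))
      (fun b hb => Finset.mem_image_of_mem _ hb)]
    refine Ideal.sum_mem _ fun d _ => ?_
    have h1 : (phi ω g).coeff d = ∑ b ∈ g.support with dg ω b = d,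
        MvPolynomial.monomial (ini b) (g.coeff b) := by
      conv_lhs => rw [g.as_sum]
      rw [map_sum, Polynomial.finsetSum_coeff, Finset.sum_filter]
      refine Finset.sum_congr rfl fun b _ => ?_
      rw [phi_monomial, Polynomial.coeff_monomial]
    have h2 : ∑ b ∈ g.support with dg ω b = d, MvPolynomial.monomial b (g.coeff b) =
        hom ω d ((phi ω g).coeff d) := by
      rw [h1, map_sum]
      refine Finset.sum_congr rfl fun b hb => ?_
      rw [hom_monomial, ← (Finset.mem_filter.1 hb).2, ext_ini]
    rw [h2]
    refine hom_mem ω (hg d) ?_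
    refine Finset.sup_le fun a ha => ?_
    rw [MvPolynomial.mem_support_iff, h1, MvPolynomial.coeff_sum] at ha
    obtain ⟨b, hb, hne⟩ := Finset.exists_ne_zero_of_sum_ne_zero ha
    rw [MvPolynomial.coeff_monomial] at hne
    have hab : ini b = a := by by_contra h; simp [h] at hne
    rw [← (Finset.mem_filter.1 hb).2, ← hab]
    simp [ini, dg]

lemma wHomog_mem_iff (ω : Fin n → ℕ) (I : Ideal (MvPolynomial (Fin n) k))
    (f : MvPolynomial (Fin n) k) : wHomog ω f ∈ wHomogIdeal ω I ↔ f ∈ I := by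
  rw [wHomogIdeal_eq, Ideal.mem_comap, phi_wHomog, Ideal.mem_map_C_iff]
  constructor
  · intro h
    simpa using h (wDeg ω f)
  · intro h m
    rw [Polynomial.coeff_monomial]
    split_ifs
    exacts [h, I.zero_mem]

lemma wHomogIdeal_le_iff (ω : Fin n → ℕ) (I J : Ideal (MvPolynomial (Fin n) k)) :
    wHomogIdeal ω I ≤ wHomogIdeal ω J ↔ I ≤ J := by
  constructor
  · intro h f hf
    exact (wHomog_mem_iff ω J f).1 (h ((wHomog_mem_iff ω I f).2 hf))
  · intro h
    rw [wHomogIdeal_eq, wHomogIdeal_eq]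
    exact Ideal.comap_mono (Ideal.map_mono h)

lemma wHomogIdeal_inj (ω : Fin n → ℕ) :
    Function.Injective (wHomogIdeal (k := k) ω) := fun I J h =>
  le_antisymm ((wHomogIdeal_le_iff ω I J).1 h.le) ((wHomogIdeal_le_iff ω J I).1 h.ge)

lemma wHomogIdeal_prime (ω : Fin n → ℕ) (p : Ideal (MvPolynomial (Fin n) k)) [p.IsPrime] :
    (wHomogIdeal ω p).IsPrime := by
  rw [wHomogIdeal_eq]
  have : (p.map (Polynomial.C : _ →+* Polynomial (MvPolynomial (Fin n) k))).IsPrime :=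
    Ideal.isPrime_map_C_of_isPrime
  exact Ideal.comap_isPrime _ _

lemma exists_min_le (ω : Fin n → ℕ) (I : Ideal (MvPolynomial (Fin n) k))
    (Q : Ideal (MvPolynomial (Fin (n + 1)) k)) [hQ : Q.IsPrime] (h : wHomogIdeal ω I ≤ Q) :
    ∃ p ∈ I.minimalPrimes, wHomogIdeal ω p ≤ Q := by
  have hfin := I.finite_minimalPrimes_of_isNoetherianRing
  have h1 : wHomogIdeal ω I.radical ≤ Q := by
    rw [wHomogIdeal_eq]
    rw [wHomogIdeal_eq] at h
    refine le_trans (Ideal.comap_mono (Ideal.map_radical_le _)) ?_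
    rw [Ideal.comap_radical]
    exact hQ.radical_le_iff.2 h
  have h2 : hfin.toFinset.inf (wHomogIdeal ω) ≤ Q := by
    refine le_trans (fun g hg => ?_) h1
    rw [wHomogIdeal_eq, Ideal.mem_comap, Ideal.mem_map_C_iff]
    intro m
    rw [← Ideal.sInf_minimalPrimes, Ideal.mem_sInf]
    intro p hp
    have : g ∈ wHomogIdeal ω p :=
      (Finset.inf_le (f := wHomogIdeal ω) (hfin.mem_toFinset.2 hp)) hg
    rw [wHomogIdeal_eq, Ideal.mem_comap, Ideal.mem_map_C_iff] at this
    exact this m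
  obtain ⟨p, hp, hpQ⟩ := (hQ.inf_le').1 h2
  exact ⟨p, hfin.mem_toFinset.1 hp, hpQ⟩

lemma minimalPrimes_eq (ω : Fin n → ℕ) (I : Ideal (MvPolynomial (Fin n) k)) :
    (wHomogIdeal ω I).minimalPrimes = wHomogIdeal ω '' I.minimalPrimes := by
  ext Q
  constructor
  · intro hQ
    have := hQ.1.1
    obtain ⟨p, hp, hpQ⟩ := exists_min_le ω I Q hQ.1.2
    have := hp.1.1
    refine ⟨p, hp, le_antisymm hpQ (hQ.2 ⟨wHomogIdeal_prime ω p, ?_⟩ hpQ)⟩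
    exact (wHomogIdeal_le_iff ω _ _).2 hp.1.2
  · rintro ⟨p, hp, rfl⟩
    have := hp.1.1
    refine ⟨⟨wHomogIdeal_prime ω p, (wHomogIdeal_le_iff ω _ _).2 hp.1.2⟩, ?_⟩
    rintro Q ⟨hQ, hIQ⟩ hQp
    obtain ⟨p', hp', hpQ⟩ := exists_min_le ω I Q hIQ
    have h1 := (wHomogIdeal_le_iff ω _ _).1 (hpQ.trans hQp)
    exact ((wHomogIdeal_le_iff ω _ _).2 (hp.2 hp'.1 h1)).trans hpQ

/-! dimension theory -/

lemma dim_integral {R S : Type} [CommRing R] [CommRing S] [Algebra R S] [Algebra.IsIntegral R S]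
    (hinj : Function.Injective (algebraMap R S)) : ringKrullDim S = ringKrullDim R := by
  apply le_antisymm
  · refine Order.krullDim_le_of_strictMono (PrimeSpectrum.comap (algebraMap R S)) ?_
    intro p q hpq
    exact Ideal.IsIntegral.comap_lt_comap (R := R) (I := p.asIdeal) (J := q.asIdeal) hpq
  · rw [ringKrullDim, Order.krullDim]
    refine iSup_le fun l => ?_
    have hF : FaithfulSMul R S := (faithfulSMul_iff_algebraMap_injective _ _).2 hinj
    have hinj' := Algebra.IsIntegral.comap_surjective R S
    obtain ⟨⟨Q, hQ⟩, hQl⟩ := hinj' l.head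
    have : Q.LiesOver l.head.asIdeal := ⟨by rw [← hQl]; rfl⟩
    obtain ⟨L, hL, -, -⟩ := Ideal.exists_ltSeries_of_hasGoingUp l Q
    rw [← hL]
    exact le_iSup (fun l : LTSeries (PrimeSpectrum S) => (l.length : WithBot ℕ∞)) L

lemma dim_trdeg (B : Type) [CommRing B] [IsDomain B] [Algebra k B] [Algebra.FiniteType k B] :
    ∃ s : ℕ, ringKrullDim B = s ∧ Algebra.trdeg k B = s := by
  obtain ⟨s, g, hg, hi⟩ := exists_integral_inj_algHom_of_fg k B
  refine ⟨s, ?_, ?_⟩ <;> algebraize [g.toRingHom]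
  · have := dim_integral (R := MvPolynomial (Fin s) k) (S := B) hg
    rw [this, MvPolynomial.ringKrullDim_of_isNoetherianRing]
    simp
  · have : FaithfulSMul (MvPolynomial (Fin s) k) B := (faithfulSMul_iff_algebraMap_injective _ _).2 hg
    have h := trdeg_add_eq k (MvPolynomial (Fin s) k) (A := B)
    rw [← h, MvPolynomial.trdeg_of_isDomain, trdeg_eq_zero]
    simp

lemma dim_eq_of_alg {B D : Type} [CommRing B] [IsDomain B] [Algebra k B] [Algebra.FiniteType k B]
    [CommRing D] [IsDomain D] [Algebra k D] [Algebra.FiniteType k D]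
    (F : B →+* D) (hk : ∀ a, F (algebraMap k B a) = algebraMap k D a) (hF : Function.Injective F)
    (h : ∀ x, ∃ b c, b ≠ 0 ∧ F b * x = F c) : ringKrullDim B = ringKrullDim D := by
  obtain ⟨s, hs1, hs2⟩ := dim_trdeg (k := k) B
  obtain ⟨r, hr1, hr2⟩ := dim_trdeg (k := k) D
  rw [hs1, hr1]
  algebraize [F]
  have hT : IsScalarTower k B D := IsScalarTower.of_algebraMap_eq fun a => (hk a).symm
  have hF : FaithfulSMul B D := (faithfulSMul_iff_algebraMap_injective _ _).2 hF
  have hA : Algebra.IsAlgebraic B D := by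
    constructor
    intro x
    obtain ⟨b, c, hb, hx⟩ := h x
    refine ⟨Polynomial.C b * Polynomial.X - Polynomial.C c, ?_, ?_⟩
    · intro h
      have := congrArg (fun f => Polynomial.coeff f 1) h
      simp [Polynomial.coeff_C] at this
      exact hb this
    · have e : ∀ y, algebraMap B D y = F y := fun _ => rfl
      simp only [map_sub, map_mul, Polynomial.aeval_C, Polynomial.aeval_X, e, hx, sub_self]
  have h := trdeg_add_eq k B (A := D)
  rw [trdeg_eq_zero (R := B), add_zero, hs2, hr2] at h
  have h' : s = r := by exact_mod_cast h
  rw [h']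

lemma exists_pow_mul (ω : Fin n → ℕ) (F : Polynomial (MvPolynomial (Fin n) k)) :
    ∃ (N : ℕ) (g : MvPolynomial (Fin (n + 1)) k), phi ω g = Polynomial.X ^ N * F := by
  induction F using Polynomial.induction_on' with
  | add F G hF hG =>
    obtain ⟨N, f, hf⟩ := hF
    obtain ⟨M, g, hg⟩ := hG
    refine ⟨N + M, MvPolynomial.X (Fin.last n) ^ M * f + MvPolynomial.X (Fin.last n) ^ N * g, ?_⟩
    simp only [map_add, map_mul, map_pow, phi_last, hf, hg]
    ring
  | monomial m a =>
    refine ⟨wDeg ω a, MvPolynomial.X (Fin.last n) ^ m * wHomog ω a, ?_⟩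
    simp only [map_mul, map_pow, phi_last, phi_wHomog, ← Polynomial.C_mul_X_pow_eq_monomial]
    ring

lemma dim_prime (ω : Fin n → ℕ) (p : Ideal (MvPolynomial (Fin n) k)) [p.IsPrime] :
    ringKrullDim (MvPolynomial (Fin (n + 1)) k ⧸ wHomogIdeal ω p) =
      ringKrullDim (MvPolynomial (Fin n) k ⧸ p) + 1 := by
  have hpp := wHomogIdeal_prime ω p
  set q := p.map (Polynomial.C : _ →+* Polynomial (MvPolynomial (Fin n) k)) with hq
  have hqp : q.IsPrime := Ideal.isPrime_map_C_of_isPrime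
  have hle : wHomogIdeal ω p ≤ q.comap (phi ω) := (wHomogIdeal_eq ω p).le
  let Φ : (MvPolynomial (Fin (n + 1)) k ⧸ wHomogIdeal ω p) →+*
    (Polynomial (MvPolynomial (Fin n) k) ⧸ q) := Ideal.quotientMap q (phi ω).toRingHom hle
  have hΦ : Function.Injective Φ :=
    Ideal.quotientMap_injective' (H := hle) (wHomogIdeal_eq ω p).ge
  have hX : (Ideal.Quotient.mk q Polynomial.X) ≠ 0 := by
    rw [Ne, Ideal.Quotient.eq_zero_iff_mem, hq, Ideal.mem_map_C_iff]
    intro h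
    have := h 1
    rw [Polynomial.coeff_X_one] at this
    exact (Ideal.ne_top_iff_one p).1 (Ideal.IsPrime.ne_top') this
  have hD : ringKrullDim (Polynomial (MvPolynomial (Fin n) k) ⧸ q) =
      ringKrullDim (MvPolynomial (Fin n) k ⧸ p) + 1 := by
    rw [← Polynomial.ringKrullDim_of_isNoetherianRing]
    exact (ringKrullDim_eq_of_ringEquiv
      (Ideal.polynomialQuotientEquivQuotientPolynomial p)).symm
  rw [← hD]
  have : Algebra.FiniteType k (Polynomial (MvPolynomial (Fin n) k)) :=
    Algebra.FiniteType.trans (S := MvPolynomial (Fin n) k) inferInstance inferInstance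
  refine dim_eq_of_alg (k := k) (B := MvPolynomial (Fin (n + 1)) k ⧸ wHomogIdeal ω p)
    (D := Polynomial (MvPolynomial (Fin n) k) ⧸ q) Φ (fun a => ?_) hΦ fun x => ?_
  · change Ideal.Quotient.mk q (phi ω (algebraMap k _ a)) = _
    rw [AlgHom.commutes]; rfl
  obtain ⟨F, rfl⟩ := Ideal.Quotient.mk_surjective x
  obtain ⟨N, g, hg⟩ := exists_pow_mul ω F
  have ht : Φ (Ideal.Quotient.mk _ (MvPolynomial.X (Fin.last n))) =
      Ideal.Quotient.mk q Polynomial.X := by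
    rw [← phi_last ω]; rfl
  have hgg : Φ (Ideal.Quotient.mk _ g) =
      Ideal.Quotient.mk q Polynomial.X ^ N * Ideal.Quotient.mk q F := by
    rw [← map_pow, ← map_mul, ← hg]; rfl
  have ht0 : (Ideal.Quotient.mk (wHomogIdeal ω p) (MvPolynomial.X (Fin.last n))) ≠ 0 := by
    intro h
    rw [h, map_zero] at ht
    exact hX ht.symm
  exact ⟨_ ^ N, Ideal.Quotient.mk _ g, pow_ne_zero N ht0, by rw [map_pow, ht, hgg]⟩

lemma dim_le_of_min {R : Type} [CommRing R] (I : Ideal R) (c : WithBot ℕ∞)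
    (h : ∀ p ∈ I.minimalPrimes, ringKrullDim (R ⧸ p) ≤ c) : ringKrullDim (R ⧸ I) ≤ c := by
  rw [ringKrullDim_quotient, Order.krullDim]
  refine iSup_le fun l => ?_
  have hh : I ≤ l.head.1.asIdeal := l.head.2
  obtain ⟨p, hp, hpl⟩ := Ideal.exists_minimalPrimes_le hh
  refine le_trans ?_ (h p hp)
  rw [ringKrullDim_quotient]
  let l' : LTSeries (PrimeSpectrum.zeroLocus (R := R) p) :=
    { length := l.length
      toFun := fun i => ⟨(l i).1, fun x hx => (l.head_le i : l.head.1.asIdeal ≤ (l i).1.asIdeal) (hpl hx)⟩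
      step := fun i => l.step i }
  exact le_iSup (fun l : LTSeries (PrimeSpectrum.zeroLocus (R := R) p) => (l.length : WithBot ℕ∞)) l'

lemma dim_le_of_le {R : Type} [CommRing R] {I J : Ideal R} (h : I ≤ J) :
    ringKrullDim (R ⧸ J) ≤ ringKrullDim (R ⧸ I) :=
  ringKrullDim_le_of_surjective (Ideal.Quotient.factor h) (Ideal.Quotient.factor_surjective h)

end WH

/-- Let `k` be a field, `P = k[x₁, …, xₙ]`, `ω ∈ ℕⁿ` and `I ⊆ P` an
ideal.  Then (a) prime ideals `℘₁, …, ℘_s` are exactly the minimal primes of `I` if and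
only if `^ω℘₁, …, ^ω℘_s` are exactly the minimal primes of `^ωI`; and
(b) `dim P[t]/^ωI = dim P/I + 1`. -/
theorem stmt_16 {k : Type} [Field k] {n : ℕ} (ω : Fin n → ℕ)
    (I : Ideal (MvPolynomial (Fin n) k)) :
    (∀ (s : ℕ) (p : Fin s → Ideal (MvPolynomial (Fin n) k)), (∀ i, (p i).IsPrime) →
      (Set.range p = I.minimalPrimes ↔
        Set.range (fun i => wHomogIdeal ω (p i)) = (wHomogIdeal ω I).minimalPrimes)) ∧
      ringKrullDim (MvPolynomial (Fin (n + 1)) k ⧸ wHomogIdeal ω I) =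
        ringKrullDim (MvPolynomial (Fin n) k ⧸ I) + 1 := by
  refine ⟨fun s p hp => ?_, ?_⟩
  · rw [WH.minimalPrimes_eq, ← Function.comp_def (wHomogIdeal ω) p, Set.range_comp]
    exact (WH.wHomogIdeal_inj ω).image_injective.eq_iff.symm
  · by_cases hI : I = ⊤
    · have h : wHomogIdeal ω I = ⊤ := by
        rw [WH.wHomogIdeal_eq, hI, Ideal.map_top, Ideal.comap_top]
      have h1 : Subsingleton (MvPolynomial (Fin (n + 1)) k ⧸ wHomogIdeal ω I) :=
        Ideal.Quotient.subsingleton_iff.2 h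
      have h2 : Subsingleton (MvPolynomial (Fin n) k ⧸ I) :=
        Ideal.Quotient.subsingleton_iff.2 hI
      rw [ringKrullDim_eq_bot_of_subsingleton, ringKrullDim_eq_bot_of_subsingleton]
      rfl
    · obtain ⟨p, hp, hmax⟩ := Set.exists_max_image I.minimalPrimes
        (fun p => ringKrullDim (MvPolynomial (Fin n) k ⧸ p))
        I.finite_minimalPrimes_of_isNoetherianRing (Set.nonempty_coe_sort.1 (Ideal.nonempty_minimalPrimes hI))
      have hpp := hp.1.1
      have e : ringKrullDim (MvPolynomial (Fin n) k ⧸ I) =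
          ringKrullDim (MvPolynomial (Fin n) k ⧸ p) :=
        le_antisymm (WH.dim_le_of_min I _ hmax) (WH.dim_le_of_le hp.1.2)
      rw [e]
      apply le_antisymm
      · refine WH.dim_le_of_min _ _ ?_
        rw [WH.minimalPrimes_eq]
        rintro _ ⟨q, hq, rfl⟩
        have := hq.1.1
        rw [WH.dim_prime]
        exact add_le_add_left (hmax q hq) 1
      · rw [← WH.dim_prime ω p]
        exact WH.dim_le_of_le ((WH.wHomogIdeal_le_iff ω _ _).2 hp.1.2)
end

section
/- Let (R, m) be a catenary noetherian local ring. Then c(R) ≥ depth R − 1. Moreover, if in addition R satisfies Serre's condition S2, then R is connected in codimension 1. -/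
/-!
Auxiliary definitions: integer-valued topological (Krull) dimension, connectivity
dimension, subdimension, local cohomological dimension and depth.
-/

open TopologicalSpace

/-- Serre's condition `S2`: `depth (R_℘) ≥ min {2, dim R_℘}` for every prime `℘`. -/
def SerreS2 (R : Type) [CommRing R] : Prop :=
  ∀ (p : Ideal R) [p.IsPrime],
    idealDepth (Localization.AtPrime p)
        (IsLocalRing.maximalIdeal (Localization.AtPrime p)) (Localization.AtPrime p) ≥
      min 2 (topDim (PrimeSpectrum (Localization.AtPrime p)))

/-- A finite strictly increasing chain of primes is saturated if no prime can be inserted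
between two consecutive members. -/
def IsSaturatedChain (R : Type) [CommRing R] {m : ℕ}
    (c : Fin (m + 1) → PrimeSpectrum R) : Prop :=
  StrictMono c ∧ ∀ i : Fin m, ∀ q : PrimeSpectrum R,
    ¬ (c i.castSucc < q ∧ q < c i.succ)

/-- A ring is catenary if, for any pair of primes `p ≤ q`, all saturated chains of primes
from `p` to `q` have the same length. -/
def IsCatenaryRing (R : Type) [CommRing R] : Prop :=
  ∀ p q : PrimeSpectrum R, p ≤ q →
    ∀ (m₁ m₂ : ℕ) (c₁ : Fin (m₁ + 1) → PrimeSpectrum R)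
      (c₂ : Fin (m₂ + 1) → PrimeSpectrum R),
      IsSaturatedChain R c₁ → IsSaturatedChain R c₂ →
      c₁ 0 = p → c₁ (Fin.last m₁) = q → c₂ 0 = p → c₂ (Fin.last m₂) = q → m₁ = m₂

namespace Stmt18
open RingTheory.Sequence CategoryTheory Abelian Limits Pointwise IsLocalRing


lemma exch {R : Type} [CommRing R] [IsNoetherianRing R] [IsLocalRing R]
    (M : Type) [AddCommGroup M] [Module R M] [Module.Finite R M] (rs : List R) (n : ℕ)
    (hl : rs.length = n + 1)
    (mem : ∀ r ∈ rs, r ∈ maximalIdeal R) (reg : IsRegular M rs) (y : R)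
    (hy : y ∈ maximalIdeal R) (hreg : IsSMulRegular M y) :
    ∃ rs' : List R, rs'.length = n ∧ (∀ r ∈ rs', r ∈ maximalIdeal R) ∧
      IsRegular (QuotSMulTop y M) rs' := by
  have hnt : Nontrivial M := reg.nontrivial
  have lt1 : ∀ (L : Type) [AddCommGroup L] [Module R L] [Module.Finite R L] [Nontrivial L],
      maximalIdeal R • (⊤ : Submodule R L) < ⊤ := fun L _ _ _ _ =>
    lt_of_le_of_ne le_top (Submodule.top_ne_ideal_smul_of_le_jacobson_annihilator
      (maximalIdeal_le_jacobson _)).symm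
  have hs : Module.support R (R ⧸ maximalIdeal R) =
      PrimeSpectrum.zeroLocus (maximalIdeal R) := by
    rw [Module.support_eq_zeroLocus, Ideal.annihilator_quotient]
  have h1 := ModuleCat.subsingleton_ext_of_exists_isRegular (maximalIdeal R)
    (ModuleCat.of R (R ⧸ maximalIdeal R)) hs.subset (ModuleCat.of R M) (lt1 M) rs mem reg
  have := nontrivial_quotSMulTop_of_mem_maximalIdeal M hy
  apply ModuleCat.exists_isRegular_of_exists_subsingleton_ext (maximalIdeal R) n
    (ModuleCat.of R (QuotSMulTop y M)) (lt1 _) (ModuleCat.of R (R ⧸ maximalIdeal R)) hs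
  intro i hi
  have zero1 := AddCommGrpCat.isZero_of_iff_subsingleton.mpr (h1 i (by omega))
  have zero2 := AddCommGrpCat.isZero_of_iff_subsingleton.mpr (h1 (i + 1) (by omega))
  have hreg' : IsSMulRegular (ModuleCat.of R M) y := hreg
  exact AddCommGrpCat.subsingleton_of_isZero <| ShortComplex.Exact.isZero_of_both_zeros
    ((Ext.covariant_sequence_exact₃' (ModuleCat.of R (R ⧸ maximalIdeal R))
      hreg'.smulShortComplex_shortExact) i (i + 1) rfl)
    (zero1.eq_zero_of_src _) (zero2.eq_zero_of_tgt _)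

lemma ass_dim {R : Type} [CommRing R] [IsNoetherianRing R] [IsLocalRing R]
    (rs : List R) : ∀ (M : Type) [AddCommGroup M] [Module R M] [Module.Finite R M]
    (_ : ∀ r ∈ rs, r ∈ maximalIdeal R) (_ : IsRegular M rs) (P : PrimeSpectrum R)
    (_ : IsAssociatedPrime P.asIdeal M), (rs.length : ℕ∞) ≤ Order.coheight P := by
  induction rs with
  | nil => intros; simp
  | cons x rs ih =>
    intro M _ _ _ mem reg P hP
    rw [isRegular_cons_iff] at reg
    obtain ⟨hx, reg⟩ := reg
    have hxm := mem x (by simp)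
    obtain ⟨-, w, hw⟩ := isAssociatedPrime_iff.1 hP
    let N : Submodule R M := Submodule.torsionBySet R M P.asIdeal
    have hN : ∀ u, u ∈ N ↔ ∀ r ∈ P.asIdeal, r • u = 0 := by
      intro u; simp [N, Submodule.mem_torsionBySet_iff]
    have hwN : w ∈ N := by
      rw [hN]; intro r hr; rw [hw, Submodule.mem_colon_singleton] at hr; simpa using hr
    have hw0 : w ≠ 0 := by
      rintro rfl
      apply hP.isPrime.ne_top
      rw [hw]; simp
    have hxP : x ∉ P.asIdeal := fun h => hw0 (hx (by simpa using (hN w).1 hwN x h))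
    have hex : ∃ u ∈ N, u ∉ x • (⊤ : Submodule R M) := by
      by_contra! hcon
      have : N ≤ maximalIdeal R • N := by
        intro u hu
        obtain ⟨v, -, rfl⟩ := (Submodule.mem_smul_pointwise_iff_exists _ _ _).1 (hcon u hu)
        refine Submodule.smul_mem_smul hxm ((hN v).2 fun r hr => hx ?_)
        have := (hN _).1 hu r hr
        change x • r • v = x • 0
        rw [smul_zero, smul_comm]; exact this
      have := Submodule.eq_bot_of_le_smul_of_le_jacobson_bot _ N
        (IsNoetherian.noetherian N) this (maximalIdeal_le_jacobson _)
      rw [this] at hwN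
      exact hw0 (by simpa using hwN)
    obtain ⟨u, huN, hu⟩ := hex
    obtain ⟨Q, hQ, hle⟩ := exists_le_isAssociatedPrime_of_isNoetherianRing R
      (Submodule.Quotient.mk u : QuotSMulTop x M)
      (by rwa [Ne, Submodule.Quotient.mk_eq_zero])
    have hPQ : P < ⟨Q, hQ.isPrime⟩ := by
      refine lt_of_le_of_ne (fun r hr => hle ?_) ?_
      · rw [Submodule.mem_colon_singleton, ← Submodule.Quotient.mk_smul, (hN u).1 huN r hr]
        simp
      · intro h
        apply hxP
        rw [h]
        refine hle ?_
        rw [Submodule.mem_colon_singleton, ← Submodule.Quotient.mk_smul]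
        rw [Submodule.mem_bot, Submodule.Quotient.mk_eq_zero]
        exact Submodule.smul_mem_pointwise_smul _ _ _ trivial
    have := ih (QuotSMulTop x M) (fun r hr => mem r (by simp [hr])) reg ⟨Q, hQ.isPrime⟩ hQ
    have h2 := Order.coheight_add_one_le hPQ
    push_cast [List.length_cons]
    exact le_trans (by gcongr) h2

lemma exists_reg {R : Type} [CommRing R] [IsNoetherianRing R] [IsLocalRing R]
    (rs : List R) (M : Type) [AddCommGroup M] [Module R M] [Module.Finite R M]
    (mem : ∀ r ∈ rs, r ∈ maximalIdeal R) (reg : IsRegular M rs) (c : Ideal R)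
    (hc : ∀ P : PrimeSpectrum R, c ≤ P.asIdeal → Order.coheight P < rs.length) :
    ∃ y ∈ c, IsSMulRegular M y := by
  by_contra! hcon
  have hsub : (c : Set R) ⊆ ⋃ p ∈ associatedPrimes R M, p := by
    rw [biUnion_associatedPrimes_eq_compl_regular]
    intro y hy; exact hcon y hy
  obtain ⟨P, hP, hle⟩ := (c.subset_union_prime_finite (associatedPrimes.finite R M) (f := id) 0 0
    fun _ h _ _ => h.1).1 hsub
  have := hc ⟨P, hP.1⟩ hle
  exact absurd (ass_dim rs M mem reg ⟨P, hP.1⟩ hP) (not_le.2 this)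

lemma core0 {R : Type} [CommRing R] [IsLocalRing R] (a b : Ideal R) (hab : a * b = ⊥)
    (x y : R) (hx : x ∈ a ⊔ b) (hy : y ∈ a ⊔ b) (hxr : IsSMulRegular R x)
    (hyr : IsSMulRegular (QuotSMulTop x R) y) : a = ⊥ ∨ b = ⊥ := by
  have h0 : ∀ s ∈ a, ∀ t ∈ b, s * t = 0 := fun s hs t ht => by
    simpa [hab] using Ideal.mul_mem_mul hs ht
  obtain ⟨s, hs, t, ht, rfl⟩ := Submodule.mem_sup.1 hx
  obtain ⟨s', hs', t', ht', rfl⟩ := Submodule.mem_sup.1 hy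
  have hst := h0 s hs t ht
  have h1 : s ∈ (s + t) • (⊤ : Submodule R R) := by
    refine mem_of_isSMulRegular_quotient_of_smul_mem hyr ?_
    rw [Submodule.mem_smul_pointwise_iff_exists]
    refine ⟨s', trivial, ?_⟩
    have := h0 s hs t' ht'
    have := h0 s' hs' t ht
    simp only [smul_eq_mul]; grind
  obtain ⟨e, -, he⟩ := (Submodule.mem_smul_pointwise_iff_exists _ _ _).1 h1
  simp only [smul_eq_mul] at he
  have hreg : ∀ z, (s + t) * z = 0 → z = 0 := fun z hz => hxr (by simpa using hz)
  have hid : e * (1 - e) = 0 := by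
    apply hreg; apply hreg
    grind
  have : e = 0 ∨ 1 - e = 0 := by
    rcases isUnit_or_isUnit_one_sub_self e with h | h
    · right; exact (h.mul_right_eq_zero).1 hid
    · left; exact (h.mul_left_eq_zero).1 hid
  rcases this with h | h
  · left
    rw [eq_bot_iff]
    intro z hz
    apply hreg
    have := h0 z hz t ht
    grind
  · right
    rw [eq_bot_iff]
    intro z hz
    apply hreg
    have := h0 s hs z hz
    grind

lemma core {R : Type} [CommRing R] [IsNoetherianRing R] [IsLocalRing R]
    (rs : List R) (mem : ∀ r ∈ rs, r ∈ maximalIdeal R) (reg : IsRegular R rs) (k : ℕ)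
    (hk : rs.length = k + 1) (a b : Ideal R)
    (hab : ∀ P : PrimeSpectrum R, a ≤ P.asIdeal ∨ b ≤ P.asIdeal)
    (ha : ∃ P : PrimeSpectrum R, ¬ a ≤ P.asIdeal)
    (hb : ∃ P : PrimeSpectrum R, ¬ b ≤ P.asIdeal) :
    ∃ P : PrimeSpectrum R, a ≤ P.asIdeal ∧ b ≤ P.asIdeal ∧ (k : ℕ∞) ≤ Order.coheight P := by
  by_contra! hcon
  have hnil : a * b ≤ nilradical R := by
    rw [nilradical_eq_sInf]
    refine le_sInf fun P hP => ?_
    rcases hab ⟨P, hP⟩ with h | h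
    · exact Ideal.mul_le_left.trans h
    · exact Ideal.mul_le_right.trans h
  obtain ⟨N, hN⟩ := Ideal.exists_pow_le_of_le_radical_of_fg (I := a * b) (J := ⊥) hnil
    (IsNoetherian.noetherian _)
  have hc : ∀ P : PrimeSpectrum R, a ^ N ⊔ b ^ N ≤ P.asIdeal → Order.coheight P < (k : ℕ∞) := by
    intro P hP
    have := P.2
    exact hcon P (this.le_of_pow_le (le_sup_left.trans hP)) (this.le_of_pow_le (le_sup_right.trans hP))
  have hle : a ^ N ⊔ b ^ N ≤ maximalIdeal R := by
    have hN0 : N ≠ 0 := by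
      rintro rfl
      rw [pow_zero, Ideal.one_eq_top, le_bot_iff] at hN
      exact top_ne_bot hN
    refine sup_le ((Ideal.pow_le_self hN0).trans (le_maximalIdeal ?_))
      ((Ideal.pow_le_self hN0).trans (le_maximalIdeal ?_))
    · rintro rfl
      obtain ⟨P, hP⟩ := hb
      exact hP ((hab P).resolve_left fun h => P.2.ne_top (top_le_iff.1 h))
    · rintro rfl
      obtain ⟨P, hP⟩ := ha
      exact hP ((hab P).resolve_right fun h => P.2.ne_top (top_le_iff.1 h))
  obtain ⟨x, hxc, hx⟩ := exists_reg rs R mem reg (a ^ N ⊔ b ^ N) (fun P hP =>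
    (hc P hP).trans (by rw [hk]; exact_mod_cast Nat.lt_succ_self k))
  obtain ⟨rs', hl', mem', reg'⟩ := exch R rs k hk mem reg x (hle hxc) hx
  obtain ⟨y, hyc, hy⟩ := exists_reg rs' (QuotSMulTop x R) mem' reg' (a ^ N ⊔ b ^ N) (fun P hP =>
    (hc P hP).trans_eq (by rw [hl']))
  rcases core0 (a ^ N) (b ^ N) (by rw [← mul_pow]; exact le_bot_iff.1 hN) x y hxc hyc hx hy with h | h
  · obtain ⟨P, hP⟩ := ha
    have := P.2
    exact hP (this.le_of_pow_le (h.le.trans bot_le))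
  · obtain ⟨P, hP⟩ := hb
    have := P.2
    exact hP (this.le_of_pow_le (h.le.trans bot_le))

lemma topDim_iff (T : Type*) [TopologicalSpace T] (h : topologicalKrullDim T ≠ ⊤) (n : ℕ) :
    (n : ℤ) ≤ topDim T ↔ (n : WithBot ℕ∞) ≤ topologicalKrullDim T := by
  set S : Set ℤ := {-1} ∪ {d : ℤ | ∃ n : ℕ, d = (n : ℤ) ∧
    ∃ c : Fin (n + 1) → IrreducibleCloseds T, StrictMono c} with hS
  have hle : ∀ (n : ℕ) (c : Fin (n + 1) → IrreducibleCloseds T), StrictMono c →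
      (n : WithBot ℕ∞) ≤ topologicalKrullDim T := fun n c hc =>
    Order.le_krullDim_iff.2 ⟨LTSeries.mk n c hc, rfl⟩
  have hne : S.Nonempty := ⟨-1, by simp [hS]⟩
  have hbdd : BddAbove S := by
    obtain ⟨N, hN⟩ : ∃ N : ℕ, topologicalKrullDim T ≤ (N : WithBot ℕ∞) := by
      cases hd : topologicalKrullDim T with
      | bot => exact ⟨0, bot_le⟩
      | coe d =>
        cases d with
        | top => exact absurd hd h
        | coe d => exact ⟨d, le_rfl⟩
    refine ⟨N, ?_⟩
    rintro d (rfl | ⟨n, rfl, c, hc⟩)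
    · omega
    · have := (hle n c hc).trans hN
      exact_mod_cast this
  constructor
  · intro hn
    rcases Int.csSup_mem hne hbdd with h1 | ⟨k, hk, c, hc⟩
    · change topDim T = -1 at h1
      omega
    · change topDim T = k at hk
      refine le_trans ?_ (hle k c hc)
      have : n ≤ k := by omega
      exact_mod_cast this
  · intro hn
    obtain ⟨l, hl⟩ := Order.le_krullDim_iff.1 hn
    subst hl
    exact le_csSup hbdd (Or.inr ⟨_, rfl, l.toFun, l.strictMono⟩)

lemma neg_one_le_topDim (T : Type*) [TopologicalSpace T] : -1 ≤ topDim T := by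
  unfold topDim
  by_cases hb : BddAbove (({-1} : Set ℤ) ∪ {d : ℤ | ∃ n : ℕ, d = (n : ℤ) ∧
    ∃ c : Fin (n + 1) → IrreducibleCloseds T, StrictMono c})
  · exact le_csSup hb (by simp)
  · rw [Int.csSup_of_not_bddAbove hb]; norm_num

lemma topDim_closed {R : Type} [CommRing R] [IsNoetherianRing R] [IsLocalRing R]
    (Z : Set (PrimeSpectrum R)) (hZ : IsClosed Z) (p : PrimeSpectrum R) (hp : p ∈ Z) (n : ℕ)
    (hn : (n : ℕ∞) ≤ Order.coheight p) : (n : ℤ) ≤ topDim Z := by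
  have hfin : topologicalKrullDim (PrimeSpectrum R) < ⊤ := by
    rw [PrimeSpectrum.topologicalKrullDim_eq_ringKrullDim]
    exact ringKrullDim_lt_top
  rw [topDim_iff _ ((topologicalKrullDim_subspace_le _ Z).trans_lt hfin).ne]
  obtain ⟨l, hl, rfl⟩ := Order.exists_series_of_le_coheight p hn
  have hmem : ∀ i, l i ∈ Z := fun i => by
    have : p ≤ l i := by rw [← hl]; exact l.head_le i
    exact ((PrimeSpectrum.le_iff_specializes _ _).1 this).mem_closed hZ hp
  let g : Fin (l.length + 1) → IrreducibleCloseds Z := fun i =>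
    ⟨closure {⟨l i.rev, hmem i.rev⟩}, isIrreducible_singleton.closure, isClosed_closure⟩
  have hg : StrictMono g := by
    intro i j hij
    have hlt : l j.rev < l i.rev := l.strictMono (Fin.rev_lt_rev.2 hij)
    have key : ∀ a b : Z, closure {a} ≤ closure {b} ↔ b.1 ≤ a.1 := by
      intro a b
      rw [PrimeSpectrum.le_iff_specializes, ← subtype_specializes_iff,
        specializes_iff_closure_subset]
    have h1 : ∀ i j, g i ≤ g j ↔ l j.rev ≤ l i.rev := fun i j => key _ _
    rw [lt_iff_le_not_ge, h1, h1]
    exact ⟨hlt.le, hlt.not_ge⟩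
  exact Order.le_krullDim_iff.2 ⟨LTSeries.mk _ g hg, rfl⟩

lemma exists_sat {R : Type} [CommRing R] [IsNoetherianRing R] [IsLocalRing R]
    (x : PrimeSpectrum R) : ∃ (n : ℕ) (c : Fin (n + 1) → PrimeSpectrum R),
      Order.coheight x = n ∧ IsSaturatedChain R c ∧ c 0 = x ∧
      c (Fin.last n) = IsLocalRing.closedPoint R := by
  have : FiniteDimensionalOrder (PrimeSpectrum R) := inferInstanceAs (FiniteRingKrullDim R)
  obtain ⟨n, hn⟩ := ENat.ne_top_iff_exists.1 (Order.coheight_lt_top x).ne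
  obtain ⟨l, hl, rfl⟩ := Order.exists_series_of_coheight_eq_coe x hn.symm
  have hix := fun i => Order.coheight_eq_index_of_length_eq_head_coheight (p := l)
    (by rw [hl, hn]) i
  refine ⟨l.length, l.toFun, hn.symm, ⟨l.strictMono, ?_⟩, hl, ?_⟩
  · rintro i q ⟨h1, h2⟩
    have a1 := Order.coheight_add_one_le h1
    have a2 := Order.coheight_add_one_le h2
    have b1 : Order.coheight (l.toFun i.castSucc) = _ := hix i.castSucc
    have b2 : Order.coheight (l.toFun i.succ) = _ := hix i.succ
    rw [b1] at a1
    rw [b2] at a2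
    obtain ⟨k, hk⟩ := ENat.ne_top_iff_exists.1 (Order.coheight_lt_top q).ne
    rw [← hk] at a1 a2
    norm_cast at a1 a2
    simp [Fin.val_rev] at a1 a2
    omega
  · have : Order.coheight (l.toFun (Fin.last _)) = _ := hix (Fin.last _)
    have hmax : IsMax (l.toFun (Fin.last _)) := by
      rw [← Order.coheight_eq_zero, this]; simp
    exact hmax.eq_of_le (IsLocalRing.le_maximalIdeal (l.toFun (Fin.last _)).2.ne_top)

lemma coheight_cov {R : Type} [CommRing R] [IsNoetherianRing R] [IsLocalRing R]
    (hcat : IsCatenaryRing R) (q p : PrimeSpectrum R) (hqp : q < p)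
    (hcov : ∀ r, ¬ (q < r ∧ r < p)) : Order.coheight q = Order.coheight p + 1 := by
  obtain ⟨n, c, hn, hc, hc0, hcl⟩ := exists_sat q
  obtain ⟨k, d, hk, hd, hd0, hdl⟩ := exists_sat p
  have hsat : IsSaturatedChain R (m := k + 1) (Fin.cons q d : Fin (k + 1 + 1) → PrimeSpectrum R) := by
    refine ⟨?_, ?_⟩
    · rw [Fin.strictMono_iff_lt_succ]
      intro i
      refine Fin.cases ?_ (fun i => ?_) i
      · simpa [hd0] using hqp
      · rw [← Fin.succ_castSucc, Fin.cons_succ, Fin.cons_succ]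
        exact hd.1 Fin.castSucc_lt_succ
    · intro i r
      refine Fin.cases ?_ (fun i => ?_) i
      · simpa [hd0] using hcov r
      · rw [← Fin.succ_castSucc, Fin.cons_succ, Fin.cons_succ]
        exact hd.2 i r
  have := hcat q (IsLocalRing.closedPoint R) (IsLocalRing.le_maximalIdeal q.2.ne_top)
    n (k + 1) c (Fin.cons q d) hc hsat hc0 hcl rfl
    (by rw [← Fin.succ_last, Fin.cons_succ, hdl])
  rw [hn, hk, this]; push_cast; rfl

lemma depth_mem {R : Type} [CommRing R] [IsLocalRing R] (n : ℕ) (hn : 0 < n)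
    (h : (n : ℤ) ≤ idealDepth R (maximalIdeal R) R) :
    ∃ rs : List R, n ≤ rs.length ∧ (∀ r ∈ rs, r ∈ maximalIdeal R) ∧ IsRegular R rs := by
  unfold idealDepth at h
  set S : Set ℤ := {d : ℤ | ∃ rs : List R, d = (rs.length : ℤ) ∧ (∀ r ∈ rs, r ∈ maximalIdeal R) ∧
    IsRegular R rs}
  have hne : S.Nonempty := ⟨0, [], by simp, by simp, IsRegular.nil R R⟩
  by_cases hb : BddAbove S
  · obtain ⟨rs, h1, h2, h3⟩ := Int.csSup_mem hne hb
    exact ⟨rs, by omega, h2, h3⟩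
  · rw [Int.csSup_of_not_bddAbove hb] at h
    omega

lemma loc_S2 {R : Type} [CommRing R] [IsNoetherianRing R] (hS2 : SerreS2 R)
    (p : PrimeSpectrum R) (a b : Ideal R)
    (hab : ∀ P : PrimeSpectrum R, a ≤ P.asIdeal ∨ b ≤ P.asIdeal)
    (ha : ∃ P : PrimeSpectrum R, P ≤ p ∧ ¬ a ≤ P.asIdeal)
    (hb : ∃ P : PrimeSpectrum R, P ≤ p ∧ ¬ b ≤ P.asIdeal)
    (hmin : ∀ r : PrimeSpectrum R, a ≤ r.asIdeal → b ≤ r.asIdeal → ¬ r < p)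
    (q r : PrimeSpectrum R) : ¬ (q < r ∧ r < p) := by
  rintro ⟨hqr, hrp⟩
  have hdim : (2 : ℤ) ≤ topDim (PrimeSpectrum (Localization.AtPrime p.asIdeal)) := by
    refine (topDim_iff _ ?_ 2).2 ?_
    · rw [PrimeSpectrum.topologicalKrullDim_eq_ringKrullDim]
      exact ringKrullDim_lt_top.ne
    · rw [PrimeSpectrum.topologicalKrullDim_eq_ringKrullDim,
        IsLocalization.AtPrime.ringKrullDim_eq_height p.asIdeal,
        PrimeSpectrum.height_eq_orderHeight]
      have h1 := Order.height_add_one_le hqr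
      have h2 := Order.height_add_one_le hrp
      have : (2 : ℕ∞) ≤ Order.height p := by
        refine le_trans ?_ h2
        refine le_trans ?_ (add_le_add_left h1 1)
        rw [add_assoc, one_add_one_eq_two]
        exact le_add_self
      exact WithBot.coe_le_coe.2 this
  have hdep := hS2 p.asIdeal
  rw [min_eq_left hdim] at hdep
  obtain ⟨rs, hl, mem, reg⟩ := depth_mem 2 (by norm_num) (by exact_mod_cast hdep)
  let e := IsLocalization.AtPrime.primeSpectrumOrderIso (Localization.AtPrime p.asIdeal) p.asIdeal
  have he : ∀ (c : Ideal R) (P : PrimeSpectrum (Localization.AtPrime p.asIdeal)),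
      c.map (algebraMap R _) ≤ P.asIdeal ↔ c ≤ (e P).1.asIdeal := by
    intro c P
    rw [Ideal.map_le_iff_le_comap]
    rfl
  obtain ⟨P, h1, h2, h3⟩ := core rs mem reg (rs.length - 1) (by omega)
    (a.map (algebraMap R _)) (b.map (algebraMap R _))
    (fun P => by simpa only [he] using hab (e P).1)
    (by
      obtain ⟨P, hP, h⟩ := ha
      exact ⟨e.symm ⟨P, hP⟩, by rw [he, e.apply_symm_apply]; exact h⟩)
    (by
      obtain ⟨P, hP, h⟩ := hb
      exact ⟨e.symm ⟨P, hP⟩, by rw [he, e.apply_symm_apply]; exact h⟩)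
  rw [he] at h1 h2
  refine hmin _ h1 h2 (lt_of_le_of_ne (e P).2 fun heq => ?_)
  have hpos : 0 < Order.coheight P := by
    refine lt_of_lt_of_le ?_ h3
    have : 0 < rs.length - 1 := by omega
    exact_mod_cast this
  rw [Order.coheight_pos] at hpos
  apply hpos
  intro Q _
  rw [← e.le_iff_le]
  change (e Q).1 ≤ (e P).1
  rw [heq]
  exact (e Q).2

lemma exists_ht_one {R : Type} [CommRing R] [IsNoetherianRing R] [IsLocalRing R]
    (hS2 : SerreS2 R) (S : Set (PrimeSpectrum R)) (q₁ q₂ : PrimeSpectrum R)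
    (h₁ : q₁ ∈ S) (h₂ : q₂ ∉ S) (hm₁ : IsMin q₁) (hm₂ : IsMin q₂) :
    ∃ p q q' : PrimeSpectrum R, IsMin q ∧ IsMin q' ∧ q ∈ S ∧ q' ∉ S ∧ q < p ∧ q' < p ∧
      ∀ s r : PrimeSpectrum R, ¬ (s < r ∧ r < p) := by
  have hfin : {q : PrimeSpectrum R | IsMin q}.Finite := by
    refine Set.Finite.of_finite_image (f := PrimeSpectrum.asIdeal)
      ((minimalPrimes.finite_of_isNoetherianRing R).subset ?_)
      (fun x _ y _ h => PrimeSpectrum.ext h)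
    rintro _ ⟨q, hq, rfl⟩
    exact PrimeSpectrum.isMin_iff.1 hq
  let I : Set (PrimeSpectrum R) → Ideal R := fun T =>
    ⨅ q ∈ {q : PrimeSpectrum R | IsMin q} ∩ T, q.asIdeal
  have hI : ∀ T (P : PrimeSpectrum R), I T ≤ P.asIdeal ↔ ∃ q, IsMin q ∧ q ∈ T ∧ q ≤ P := by
    intro T P
    have hf : ({q : PrimeSpectrum R | IsMin q} ∩ T).Finite := hfin.inter_of_left T
    have : I T = hf.toFinset.inf PrimeSpectrum.asIdeal := by
      rw [Finset.inf_eq_iInf]; simp [I]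
    rw [this, P.2.inf_le']
    simp only [Set.Finite.mem_toFinset]
    constructor
    · rintro ⟨q, ⟨h1, h2⟩, h3⟩; exact ⟨q, h1, h2, h3⟩
    · rintro ⟨q, h1, h2, h3⟩; exact ⟨q, ⟨h1, h2⟩, h3⟩
  have hbel : ∀ P : PrimeSpectrum R, ∃ q, IsMin q ∧ q ≤ P := by
    intro P
    obtain ⟨q, hq, hle⟩ := Ideal.exists_minimalPrimes_le (I := ⊥) (J := P.asIdeal) bot_le
    exact ⟨⟨q, hq.1.1⟩, PrimeSpectrum.isMin_iff.2 hq, hle⟩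
  have hle : ∀ P : PrimeSpectrum R, P ≤ closedPoint R := fun P => le_maximalIdeal P.2.ne_top
  obtain ⟨p, hp, -⟩ := Ideal.exists_minimalPrimes_le (I := I S ⊔ I Sᶜ)
    (J := (closedPoint R).asIdeal)
    (sup_le ((hI _ _).2 ⟨q₁, hm₁, h₁, hle _⟩) ((hI _ _).2 ⟨q₂, hm₂, h₂, hle _⟩))
  have hpp := hp.1.1
  obtain ⟨q, hq, hqS, hqp⟩ := (hI S ⟨p, hpp⟩).1 (le_sup_left.trans hp.1.2)
  obtain ⟨q', hq', hqS', hqp'⟩ := (hI Sᶜ ⟨p, hpp⟩).1 (le_sup_right.trans hp.1.2)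
  have hne : q ≠ q' := fun h => hqS' (h ▸ hqS)
  have hl : q < ⟨p, hpp⟩ := lt_of_le_of_ne hqp fun h => hne (hq.eq_of_le (h ▸ hqp')).symm
  have hl' : q' < ⟨p, hpp⟩ := lt_of_le_of_ne hqp' fun h => hne (hq'.eq_of_le (h ▸ hqp))
  refine ⟨⟨p, hpp⟩, q, q', hq, hq', hqS, hqS', hl, hl', ?_⟩
  refine loc_S2 hS2 ⟨p, hpp⟩ (I S) (I Sᶜ) (fun P => ?_) ⟨q', hqp', ?_⟩ ⟨q, hqp, ?_⟩ ?_
  · obtain ⟨z, hz, hzP⟩ := hbel P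
    by_cases h : z ∈ S
    · left; exact (hI _ _).2 ⟨z, hz, h, hzP⟩
    · right; exact (hI _ _).2 ⟨z, hz, h, hzP⟩
  · rw [hI]
    rintro ⟨z, hz, hzS, hzq⟩
    exact hqS' (hq'.eq_of_le hzq ▸ hzS)
  · rw [hI]
    rintro ⟨z, hz, hzS, hzq⟩
    exact hzS (hq.eq_of_le hzq ▸ hqS)
  · intro r h1 h2 hr
    exact hr.not_ge (hp.2 ⟨r.2, sup_le h1 h2⟩ hr.le)

lemma split_of_disconn {T : Type*} [TopologicalSpace T] (Z : Set T) (hZ : IsClosed Z)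
    (hne : Zᶜ.Nonempty) (h : ¬ ConnectedSpace ↥(Zᶜ)) :
    ∃ A B : Set T, IsClosed A ∧ IsClosed B ∧ (∀ x, x ∈ A ∨ x ∈ B) ∧ A ∩ B ⊆ Z ∧
      (∃ x, x ∉ A) ∧ ∃ x, x ∉ B := by
  have h1 : ¬ IsPreconnected Zᶜ := fun hp => h (isConnected_iff_connectedSpace.1 ⟨hne, hp⟩)
  rw [isPreconnected_closed_iff] at h1
  push Not at h1
  obtain ⟨t, t', ht, ht', hsub, ⟨x, hx, hxt⟩, ⟨y, hy, hyt⟩, hemp⟩ := h1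
  have hem : ∀ z, z ∉ Z → z ∈ t → z ∈ t' → False := fun z h1 h2 h3 => by
    have : z ∈ Zᶜ ∩ (t ∩ t') := ⟨h1, h2, h3⟩
    simp [hemp] at this
  refine ⟨t ∪ Z, t' ∪ Z, ht.union hZ, ht'.union hZ, ?_, ?_, ⟨y, ?_⟩, ⟨x, ?_⟩⟩
  · intro z
    by_cases hz : z ∈ Z
    · simp [hz]
    · rcases hsub hz with h | h <;> simp [h]
  · rintro z ⟨h1, h2⟩
    by_contra hz
    exact hem z hz (h1.resolve_right hz) (h2.resolve_right hz)
  · rintro (h | h)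
    · exact hem y hy h hyt
    · exact hy h
  · rintro (h | h)
    · exact hem x hx hxt h
    · exact hx h

lemma mem_closed_of_le {R : Type} [CommRing R] (A : Set (PrimeSpectrum R)) (hA : IsClosed A)
    {x y : PrimeSpectrum R} (hx : x ∈ A) (hxy : x ≤ y) : y ∈ A :=
  ((PrimeSpectrum.le_iff_specializes _ _).1 hxy).mem_closed hA hx

lemma part1 {R : Type} [CommRing R] [IsNoetherianRing R] [IsLocalRing R]
    (Z : Set (PrimeSpectrum R)) (hZ : IsClosed Z) (h : ¬ ConnectedSpace ↥(Zᶜ)) (rs : List R)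
    (mem : ∀ r ∈ rs, r ∈ maximalIdeal R) (reg : IsRegular R rs) :
    (rs.length : ℤ) ≤ topDim Z + 1 := by
  rcases Nat.eq_zero_or_pos rs.length with h0 | hpos
  · rw [h0]; have := neg_one_le_topDim Z; push_cast; omega
  obtain ⟨k, hk⟩ : ∃ k, rs.length = k + 1 := ⟨rs.length - 1, by omega⟩
  have hgoal : ∀ p ∈ Z, (k : ℕ∞) ≤ Order.coheight p → (rs.length : ℤ) ≤ topDim Z + 1 := by
    intro p hp hk'
    have := topDim_closed Z hZ p hp k hk'
    rw [hk]; push_cast; omega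
  by_cases hne : Zᶜ.Nonempty
  · obtain ⟨A, B, hA, hB, hcov, hint, ⟨x, hx⟩, ⟨y, hy⟩⟩ := split_of_disconn Z hZ hne h
    obtain ⟨a, rfl⟩ := (PrimeSpectrum.isClosed_iff_zeroLocus_ideal _).1 hA
    obtain ⟨b, rfl⟩ := (PrimeSpectrum.isClosed_iff_zeroLocus_ideal _).1 hB
    obtain ⟨P, h1, h2, h3⟩ := core rs mem reg k hk a b hcov ⟨x, hx⟩ ⟨y, hy⟩
    exact hgoal P (hint ⟨h1, h2⟩) h3
  · have hZu : ∀ p, p ∈ Z := fun p => by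
      by_contra hp; exact hne ⟨p, hp⟩
    obtain ⟨P, hP, -⟩ := exists_le_isAssociatedPrime_of_isNoetherianRing R (1 : R) one_ne_zero
    refine hgoal ⟨P, hP.1⟩ (hZu _) (le_trans ?_ (ass_dim rs R mem reg ⟨P, hP.1⟩ hP))
    rw [hk]; exact_mod_cast Nat.le_succ k

lemma part2 {R : Type} [CommRing R] [IsNoetherianRing R] [IsLocalRing R]
    (hcat : IsCatenaryRing R) (hS2 : SerreS2 R)
    (Z : Set (PrimeSpectrum R)) (hZ : IsClosed Z) (h : ¬ ConnectedSpace ↥(Zᶜ)) :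
    topDim (PrimeSpectrum R) ≤ topDim Z + 1 := by
  by_contra! hlt
  have hbel : ∀ P : PrimeSpectrum R, ∃ q, IsMin q ∧ q ≤ P := by
    intro P
    obtain ⟨q, hq, hle⟩ := Ideal.exists_minimalPrimes_le (I := ⊥) (J := P.asIdeal) bot_le
    exact ⟨⟨q, hq.1.1⟩, PrimeSpectrum.isMin_iff.2 hq, hle⟩
  have hm1 := neg_one_le_topDim Z
  obtain ⟨n, hn⟩ : ∃ n : ℕ, topDim (PrimeSpectrum R) = n := Int.eq_ofNat_of_zero_le (by omega)
  have hn2 := (topDim_iff (PrimeSpectrum R) (by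
    rw [PrimeSpectrum.topologicalKrullDim_eq_ringKrullDim]
    exact ringKrullDim_lt_top.ne) n).1 hn.ge
  rw [PrimeSpectrum.topologicalKrullDim_eq_ringKrullDim] at hn2
  obtain ⟨l, hl⟩ := Order.le_krullDim_iff.1 hn2
  obtain ⟨q₀, hq₀, hq₀l⟩ := hbel l.head
  have hq₀n : (n : ℕ∞) ≤ Order.coheight q₀ := by
    rw [← hl]; exact Order.length_le_coheight hq₀l
  have hequi : ∀ q : PrimeSpectrum R, IsMin q → Order.coheight q = Order.coheight q₀ := by
    intro q hq
    by_contra hqne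
    obtain ⟨p, s, s', -, -, hs, hs', hsp, hsp', hcov⟩ := exists_ht_one hS2
      {q | Order.coheight q = Order.coheight q₀} q₀ q rfl hqne hq₀ hq
    apply hs'
    have e1 := coheight_cov hcat s p hsp (hcov s)
    have e2 := coheight_cov hcat s' p hsp' (hcov s')
    exact (e2.trans e1.symm).trans hs
  by_cases hne : Zᶜ.Nonempty
  · obtain ⟨A, B, hA, hB, hcov, hint, ⟨x, hx⟩, ⟨y, hy⟩⟩ := split_of_disconn Z hZ hne h
    obtain ⟨q₁, hq₁, hq₁y⟩ := hbel y
    obtain ⟨q₂, hq₂, hq₂x⟩ := hbel x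
    have h1 : q₁ ∈ Bᶜ := fun hh => hy (mem_closed_of_le B hB hh hq₁y)
    have h2 : q₂ ∉ Bᶜ := fun hh => hx (mem_closed_of_le A hA ((hcov q₂).resolve_right hh) hq₂x)
    obtain ⟨p, s, s', hsm, -, hs, hs', hsp, hsp', hc⟩ := exists_ht_one hS2 Bᶜ q₁ q₂ h1 h2 hq₁ hq₂
    have hpA : p ∈ A := mem_closed_of_le A hA ((hcov s).resolve_right hs) hsp.le
    have hpB : p ∈ B := mem_closed_of_le B hB (not_not.1 hs') hsp'.le
    have e1 := coheight_cov hcat s p hsp (hc s)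
    rw [hequi s hsm] at e1
    rw [e1] at hq₀n
    have : ((n - 1 : ℕ) : ℕ∞) ≤ Order.coheight p := by
      have : FiniteDimensionalOrder (PrimeSpectrum R) := inferInstanceAs (FiniteRingKrullDim R)
      obtain ⟨k, hk⟩ := ENat.ne_top_iff_exists.1 (Order.coheight_lt_top p).ne
      rw [← hk] at hq₀n ⊢
      norm_cast at hq₀n ⊢
      omega
    have := topDim_closed Z hZ p (hint ⟨hpA, hpB⟩) _ this
    omega
  · have hZu : ∀ p, p ∈ Z := fun p => by
      by_contra hp; exact hne ⟨p, hp⟩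
    have := topDim_closed Z hZ q₀ (hZu _) n hq₀n
    omega

lemma le_connDim (T : Type*) [TopologicalSpace T] (d : ℤ)
    (h : ∀ Z : Set T, IsClosed Z → ¬ ConnectedSpace ↥(Zᶜ) → d ≤ topDim Z) : d ≤ connDim T := by
  refine le_csInf ⟨_, Set.univ, isClosed_univ, ?_, rfl⟩ ?_
  · intro hc
    obtain ⟨x, hx⟩ := hc.toNonempty
    exact hx trivial
  · rintro _ ⟨Z, hZ, hd, rfl⟩
    exact h Z hZ hd

end Stmt18

/-- Let `(R, m)` be a catenary noetherian local ring.  Then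
`c(R) ≥ depth R − 1`.  Moreover, if in addition `R` satisfies Serre's condition `S2`,
then `R` is connected in codimension 1. -/
theorem stmt_18 (R : Type) [CommRing R] [IsNoetherianRing R] [IsLocalRing R]
    (hcat : IsCatenaryRing R) :
    connDim (PrimeSpectrum R) ≥ idealDepth R (IsLocalRing.maximalIdeal R) R - 1 ∧
      (SerreS2 R → connDim (PrimeSpectrum R) ≥ topDim (PrimeSpectrum R) - 1) := by
  refine ⟨Stmt18.le_connDim _ _ fun Z hZ h => ?_, fun hS2 => Stmt18.le_connDim _ _ fun Z hZ h => ?_⟩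
  · rw [sub_le_iff_le_add]
    refine csSup_le ⟨0, [], by simp, by simp, RingTheory.Sequence.IsRegular.nil R R⟩ ?_
    rintro _ ⟨rs, rfl, mem, reg⟩
    exact Stmt18.part1 Z hZ h rs mem reg
  · have := Stmt18.part2 hcat hS2 Z hZ h
    omega
end
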